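/- Let k be an even integer ≥ 4. The number of zeros of E_k' in H with real part equal to 1/2 is 1 + 2·⌊(k−2)/6⌋. More precisely: exactly ⌊(k−4)/6⌋ of them have imaginary part strictly greater than √3/2; exactly ⌊(k+2)/6⌋ of them have imaginary part strictly between √3/6 and √3/2; none has imaginary part strictly less than √3/6; and when k ≡ 2 (mod 6), one of them has imaginary part √3/6 and another one has imaginary part √3/2 (while when k ≢ 2 (mod 6), neither 1/2 + i√3/6 nor 1/2 + i√3/2 is a zero of E_k'). -/

import Mathlib

/-- The normalized Eisenstein series of even weight `k ≥ 4` (the definition also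
makes sense for `k = 2`, giving the quasi-modular Eisenstein series `E₂`), defined by
its Fourier expansion `E_k(z) = 1 - (2k/B_k) ∑_{n≥1} σ_{k-1}(n) qⁿ`, `q = exp(2πiz)`. -/
noncomputable def Ek (k : ℕ) (z : ℂ) : ℂ :=
  1 - (2 * (k : ℂ) / ((bernoulli k : ℚ) : ℂ)) *
    ∑' n : ℕ, (∑ d ∈ n.divisors, (d : ℂ) ^ (k - 1)) * Complex.exp (2 * Real.pi * Complex.I * z) ^ n

section EisensteinDerivativeZeros

open MeasureTheory Filter Topology Polynomial

/-- Sequences of at most polynomial growth. -/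
def PolyGrowth (a : ℕ → ℂ) : Prop := ∃ p : ℕ, ∀ n : ℕ, ‖a n‖ ≤ ((n : ℝ) + 1) ^ p

/-- The power series with coefficients `a`. -/
noncomputable def pser (a : ℕ → ℂ) (q : ℂ) : ℂ := ∑' n : ℕ, a n * q ^ n

lemma PolyGrowth.mul_nat {a : ℕ → ℂ} (ha : PolyGrowth a) :
    PolyGrowth (fun n => (n : ℂ) * a n) := by
  obtain ⟨p, hp⟩ := ha
  refine ⟨p + 1, fun n => ?_⟩
  rw [norm_mul, Complex.norm_natCast, pow_succ, mul_comm]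
  exact mul_le_mul (hp n) (by linarith) (by positivity) (by positivity)

lemma summable_succ_pow_mul_geometric (p : ℕ) {r : ℝ} (h0 : 0 ≤ r) (h1 : r < 1) :
    Summable (fun n : ℕ => ((n : ℝ) + 1) ^ p * r ^ n) := by
  have h := summable_pow_mul_geometric_of_norm_lt_one p
    (r := r) (by rwa [Real.norm_of_nonneg h0])
  refine Summable.of_nonneg_of_le (fun n => by positivity) (fun n => ?_)
    ((h.mul_left (2 ^ p)).add (summable_geometric_of_lt_one h0 h1))
  rcases Nat.eq_zero_or_pos n with rfl | hn
  · simp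
  · have hn' : (1 : ℝ) ≤ n := by exact_mod_cast hn
    have : ((n : ℝ) + 1) ^ p ≤ 2 ^ p * n ^ p := by
      rw [← mul_pow]; gcongr; linarith
    have h2 : 0 ≤ r ^ n := by positivity
    nlinarith [mul_le_mul_of_nonneg_right this h2]

lemma PolyGrowth.summable_norm {a : ℕ → ℂ} (ha : PolyGrowth a) {q : ℂ} (hq : ‖q‖ < 1) :
    Summable (fun n : ℕ => ‖a n * q ^ n‖) := by
  obtain ⟨p, hp⟩ := ha
  refine Summable.of_nonneg_of_le (fun n => norm_nonneg _) (fun n => ?_)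
    (summable_succ_pow_mul_geometric p (norm_nonneg q) hq)
  rw [norm_mul, norm_pow]
  gcongr
  exact hp n

lemma PolyGrowth.summable {a : ℕ → ℂ} (ha : PolyGrowth a) {q : ℂ} (hq : ‖q‖ < 1) :
    Summable (fun n : ℕ => a n * q ^ n) := (ha.summable_norm hq).of_norm

lemma PolyGrowth.hasDerivAt {a : ℕ → ℂ} (ha : PolyGrowth a) {q : ℂ} (hq : ‖q‖ < 1) :
    HasDerivAt (pser a) (∑' n : ℕ, a n * (n * q ^ (n - 1))) q := by
  obtain ⟨p, hp⟩ := id ha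
  obtain ⟨ρ, hρ, hρ1⟩ := exists_between hq
  have hρ0 : 0 < ρ := (norm_nonneg q).trans_lt hρ
  have hu : Summable (fun n : ℕ => ρ⁻¹ * (((n : ℝ) + 1) ^ (p + 1) * ρ ^ n)) :=
    (summable_succ_pow_mul_geometric (p + 1) hρ0.le hρ1).mul_left _
  refine hasDerivAt_tsum_of_isPreconnected (t := Metric.ball (0 : ℂ) ρ)
    (g := fun (n : ℕ) (y : ℂ) => a n * y ^ n)
    (g' := fun (n : ℕ) (y : ℂ) => a n * (n * y ^ (n - 1))) (y₀ := q) hu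
    Metric.isOpen_ball (convex_ball _ _).isPreconnected ?_ ?_ ?_ ?_ ?_
  · intro n y _
    exact (hasDerivAt_pow n y).const_mul _
  · intro n y hy
    have hy' : ‖y‖ < ρ := by simpa using hy
    rcases Nat.eq_zero_or_pos n with rfl | hn
    · simp; positivity
    · rw [norm_mul, norm_mul, norm_pow, Complex.norm_natCast]
      have e : ρ ^ n = ρ ^ (n - 1) * ρ := by rw [← pow_succ]; congr 1; omega
      have : ρ⁻¹ * (((n : ℝ) + 1) ^ (p + 1) * ρ ^ n)
          = ((n : ℝ) + 1) ^ p * (((n : ℝ) + 1) * ρ ^ (n - 1)) := by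
        rw [e]; field_simp; ring
      rw [this]
      gcongr
      · exact hp n
      · linarith
  · simpa using hρ
  · exact ha.summable hq
  · simpa using hρ

lemma PolyGrowth.differentiableOn {a : ℕ → ℂ} (ha : PolyGrowth a) :
    DifferentiableOn ℂ (pser a) (Metric.ball 0 1) := fun q hq =>
  (ha.hasDerivAt (by simpa using hq)).differentiableAt.differentiableWithinAt

lemma PolyGrowth.mul_deriv {a : ℕ → ℂ} (q : ℂ) :
    q * (∑' n : ℕ, a n * (n * q ^ (n - 1))) = pser (fun n => (n : ℂ) * a n) q := by
  rw [pser, ← tsum_mul_left]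
  congr 1; ext n
  rcases Nat.eq_zero_or_pos n with rfl | hn
  · simp
  · have e : q ^ n = q ^ (n - 1) * q := by rw [← pow_succ]; congr 1; omega
    rw [e]; ring

lemma PolyGrowth.hasDerivAt_comp_exp {a : ℕ → ℂ} (ha : PolyGrowth a) {c z : ℂ}
    (hz : ‖Complex.exp (c * z)‖ < 1) :
    HasDerivAt (fun w : ℂ => pser a (Complex.exp (c * w)))
      (c * pser (fun n => (n : ℂ) * a n) (Complex.exp (c * z))) z := by
  have h1 : HasDerivAt (fun w : ℂ => Complex.exp (c * w)) (Complex.exp (c * z) * c) z := by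
    have := ((hasDerivAt_id z).const_mul c).cexp
    simpa using this
  have := (ha.hasDerivAt hz).comp z h1
  rw [← PolyGrowth.mul_deriv]
  refine this.congr_deriv ?_
  ring

lemma polyGrowth_pow (p : ℕ) : PolyGrowth (fun n => (n : ℂ) ^ p) :=
  ⟨p, fun n => by rw [norm_pow, Complex.norm_natCast]; gcongr; linarith⟩

/-- The divisor power sum with complex values. -/
noncomputable def divSum (p n : ℕ) : ℂ := ∑ d ∈ n.divisors, (d : ℂ) ^ p

lemma polyGrowth_divSum (p : ℕ) : PolyGrowth (divSum p) := by
  refine ⟨p + 1, fun n => ?_⟩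
  rw [divSum]
  refine (norm_sum_le _ _).trans ?_
  calc ∑ d ∈ n.divisors, ‖(d : ℂ) ^ p‖ ≤ ∑ d ∈ n.divisors, ((n : ℝ) + 1) ^ p := by
        refine Finset.sum_le_sum fun d hd => ?_
        rw [norm_pow, Complex.norm_natCast]
        gcongr
        have : (d : ℝ) ≤ n := by exact_mod_cast Nat.divisor_le hd
        linarith
    _ = n.divisors.card * ((n : ℝ) + 1) ^ p := by simp
    _ ≤ ((n : ℝ) + 1) * ((n : ℝ) + 1) ^ p := by
        gcongr
        have : (n.divisors.card : ℝ) ≤ n := by exact_mod_cast Nat.card_divisors_le_self n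
        linarith
    _ = _ := by ring

/-- `∑ n ^ p q ^ n`. -/
noncomputable def Lser (p : ℕ) : ℂ → ℂ := pser (fun n => (n : ℂ) ^ p)

/-- `∑ n ^ j σ_p(n) q ^ n`. -/
noncomputable def Dser (p j : ℕ) : ℂ → ℂ := pser (fun n => (n : ℂ) ^ j * divSum p n)

lemma polyGrowth_Dser (p j : ℕ) : PolyGrowth (fun n => (n : ℂ) ^ j * divSum p n) := by
  induction j with
  | zero => simpa using polyGrowth_divSum p
  | succ j ih =>
    have := ih.mul_nat
    convert this using 2
    ring

lemma Dser_hasDerivAt_exp (p j : ℕ) {c z : ℂ} (hz : ‖Complex.exp (c * z)‖ < 1) :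
    HasDerivAt (fun w : ℂ => Dser p j (Complex.exp (c * w)))
      (c * Dser p (j + 1) (Complex.exp (c * z))) z := by
  have := (polyGrowth_Dser p j).hasDerivAt_comp_exp hz
  refine this.congr_deriv ?_
  unfold Dser
  congr 2
  funext n; ring

lemma Lser_norm_le (p : ℕ) {q : ℂ} (hq : ‖q‖ < 1) :
    ‖Lser p q‖ ≤ ‖Lser p (‖q‖ : ℂ)‖ := by
  have hs := (polyGrowth_pow p).summable_norm hq
  have e : Lser p (‖q‖ : ℂ) = ((∑' n : ℕ, ‖(n : ℂ) ^ p * q ^ n‖ : ℝ) : ℂ) := by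
    rw [Lser, pser, Complex.ofReal_tsum]
    congr 1; ext n
    simp
  rw [e, Complex.norm_real, Real.norm_of_nonneg (tsum_nonneg fun _ => norm_nonneg _)]
  exact norm_tsum_le_tsum_norm hs

lemma sum_antidiag_eq (p j n : ℕ) (q : ℂ) :
    ∑ x ∈ n.divisorsAntidiagonal, (x.1 : ℂ) ^ j * (x.2 : ℂ) ^ (p + j) * q ^ (x.1 * x.2)
      = (n : ℂ) ^ j * divSum p n * q ^ n := by
  have h : ∀ x ∈ n.divisorsAntidiagonal,
      (x.1 : ℂ) ^ j * (x.2 : ℂ) ^ (p + j) * q ^ (x.1 * x.2)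
        = (n : ℂ) ^ j * q ^ n * (x.2 : ℂ) ^ p := by
    intro x hx
    have := (Nat.mem_divisorsAntidiagonal.mp hx).1
    rw [this, ← this]; push_cast; ring
  rw [Finset.sum_congr rfl h, ← Finset.mul_sum,
    Nat.sum_divisorsAntidiagonal' (fun _ y => (y : ℂ) ^ p), divSum]
  ring

lemma hasSum_prod_Dser (p j : ℕ) {q : ℂ} (hq : ‖q‖ < 1) :
    HasSum (fun c : ℕ+ × ℕ+ => ((c.1 : ℕ) : ℂ) ^ j * ((c.2 : ℕ) : ℂ) ^ (p + j)
      * q ^ ((c.1 : ℕ) * (c.2 : ℕ))) (Dser p j q) := by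
  rw [← sigmaAntidiagonalEquivProd.hasSum_iff]
  have hfin : ∀ n : ℕ+, HasSum (fun x : {x // x ∈ (n : ℕ).divisorsAntidiagonal} =>
      ((x.1.1 : ℕ) : ℂ) ^ j * ((x.1.2 : ℕ) : ℂ) ^ (p + j) * q ^ (x.1.1 * x.1.2))
      (((n : ℕ) : ℂ) ^ j * divSum p n * q ^ (n : ℕ)) := by
    intro n
    have := hasSum_fintype (fun x : {x // x ∈ (n : ℕ).divisorsAntidiagonal} =>
      ((x.1.1 : ℕ) : ℂ) ^ j * ((x.1.2 : ℕ) : ℂ) ^ (p + j) * q ^ (x.1.1 * x.1.2))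
    convert this using 1
    rw [Finset.univ_eq_attach, Finset.sum_attach _ (fun x : ℕ × ℕ =>
      ((x.1 : ℕ) : ℂ) ^ j * ((x.2 : ℕ) : ℂ) ^ (p + j) * q ^ (x.1 * x.2)), sum_antidiag_eq]
  have hD := (polyGrowth_Dser p j).summable hq
  have hD' := (polyGrowth_Dser p j).summable_norm hq
  have hsum : Summable (fun c : (n : ℕ+) × {x // x ∈ (n : ℕ).divisorsAntidiagonal} =>
      ((c.2.1.1 : ℕ) : ℂ) ^ j * ((c.2.1.2 : ℕ) : ℂ) ^ (p + j) * q ^ (c.2.1.1 * c.2.1.2)) := by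
    apply Summable.of_norm
    rw [summable_sigma_of_nonneg (fun a ↦ by positivity)]
    refine ⟨fun n => (hasSum_fintype _).summable, ?_⟩
    have hr : ‖((‖q‖ : ℝ) : ℂ)‖ < 1 := by simpa using hq
    have := ((polyGrowth_Dser p j).summable_norm hr).comp_injective PNat.coe_injective
    refine this.congr fun n => ?_
    rw [tsum_fintype, Finset.univ_eq_attach, Finset.sum_attach _ (fun x : ℕ × ℕ =>
      ‖((x.1 : ℕ) : ℂ) ^ j * ((x.2 : ℕ) : ℂ) ^ (p + j) * q ^ (x.1 * x.2)‖)]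
    have e := sum_antidiag_eq p j n ((‖q‖ : ℝ) : ℂ)
    rw [Function.comp_apply, ← e]
    have : (∑ x ∈ (n : ℕ).divisorsAntidiagonal,
        ((x.1 : ℕ) : ℂ) ^ j * ((x.2 : ℕ) : ℂ) ^ (p + j) * ((‖q‖ : ℝ) : ℂ) ^ (x.1 * x.2))
        = ((∑ x ∈ (n : ℕ).divisorsAntidiagonal,
          ‖((x.1 : ℕ) : ℂ) ^ j * ((x.2 : ℕ) : ℂ) ^ (p + j) * q ^ (x.1 * x.2)‖ : ℝ) : ℂ) := by
      push_cast
      refine Finset.sum_congr rfl fun x _ => ?_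
      simp
    rw [this, Complex.norm_real,
      Real.norm_of_nonneg (Finset.sum_nonneg fun _ _ => norm_nonneg _)]
  have h1 := HasSum.sigma_of_hasSum (f := fun c : (n : ℕ+) ×
      {x // x ∈ (n : ℕ).divisorsAntidiagonal} =>
      ((c.2.1.1 : ℕ) : ℂ) ^ j * ((c.2.1.2 : ℕ) : ℂ) ^ (p + j) * q ^ (c.2.1.1 * c.2.1.2))
      (g := fun n : ℕ+ => ((n : ℕ) : ℂ) ^ j * divSum p n * q ^ (n : ℕ))
      (a := Dser p j q) ?_ hfin hsum
  · exact h1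
  · have h0 : ∀ x ∉ Set.range (fun n : ℕ+ => (n : ℕ)),
        (x : ℂ) ^ j * divSum p x * q ^ x = 0 := by
      intro x hx
      have : x = 0 := by
        by_contra h
        exact hx ⟨⟨x, Nat.pos_of_ne_zero h⟩, rfl⟩
      subst this
      simp [divSum]
    have := (PNat.coe_injective.hasSum_iff h0).mpr hD.hasSum
    exact this

lemma hasSum_Lser_Dser (p j : ℕ) (hp : p + j ≠ 0) {q : ℂ} (hq : ‖q‖ < 1) :
    HasSum (fun m : ℕ+ => ((m : ℕ) : ℂ) ^ j * Lser (p + j) (q ^ (m : ℕ))) (Dser p j q) := by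
  refine (hasSum_prod_Dser p j hq).prod_fiberwise fun m => ?_
  have hqm : ‖q ^ (m : ℕ)‖ < 1 := by
    rw [norm_pow]; exact pow_lt_one₀ (norm_nonneg _) hq m.ne_zero
  have h := (((polyGrowth_pow (p + j)).summable hqm).hasSum).mul_left (((m : ℕ) : ℂ) ^ j)
  have h0 : ∀ x ∉ Set.range (fun n : ℕ+ => (n : ℕ)),
      ((m : ℕ) : ℂ) ^ j * ((x : ℂ) ^ (p + j) * (q ^ (m : ℕ)) ^ x) = 0 := by
    intro x hx
    have : x = 0 := by
      by_contra h
      exact hx ⟨⟨x, Nat.pos_of_ne_zero h⟩, rfl⟩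
    subst this
    simp only [Nat.cast_zero, zero_pow hp, zero_mul, mul_zero]
  have := (PNat.coe_injective.hasSum_iff h0).mpr h
  refine this.congr_fun fun x => ?_
  simp only [Function.comp_apply, pow_mul, mul_assoc]

lemma exists_eq_prod_mul {g : ℂ → ℂ} {U : Set ℂ} (hU : IsOpen U) (hg : DifferentiableOn ℂ g U)
    (Z : Finset ℝ) (hZU : ∀ z ∈ Z, (z : ℂ) ∈ U) (hZ : ∀ z ∈ Z, g z = 0) :
    ∃ u : ℂ → ℂ, DifferentiableOn ℂ u U ∧ ∀ q, g q = (∏ z ∈ Z, (q - z)) * u q := by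
  classical
  induction Z using Finset.induction_on with
  | empty => exact ⟨g, hg, fun q => by simp⟩
  | insert a Z ha ih =>
    obtain ⟨u, hu, hgu⟩ := ih (fun z hz => hZU z (Finset.mem_insert_of_mem hz))
      (fun z hz => hZ z (Finset.mem_insert_of_mem hz))
    have hua : u a = 0 := by
      have h := hgu a
      rw [hZ a (Finset.mem_insert_self _ _)] at h
      refine (mul_eq_zero.mp h.symm).resolve_left ?_
      refine Finset.prod_ne_zero_iff.mpr fun z hz => ?_
      rw [sub_ne_zero]
      norm_cast
      rintro rfl
      exact ha hz
    refine ⟨dslope u a, (Complex.differentiableOn_dslope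
      (hU.mem_nhds (hZU a (Finset.mem_insert_self _ _)))).mpr hu, fun q => ?_⟩
    rw [hgu q, Finset.prod_insert ha]
    have := sub_smul_dslope u a q
    rw [hua, sub_zero, smul_eq_mul] at this
    rw [← this]; ring

lemma sq_sub_mul_eq {r : ℝ} {q : ℂ} (hq : ‖q‖ = r) (a : ℝ) :
    (r : ℂ) ^ 2 - a * q = q * (starRingEnd ℂ) (q - a) := by
  rw [map_sub, Complex.conj_ofReal, mul_sub, Complex.mul_conj, Complex.normSq_eq_norm_sq, hq]
  push_cast; ring

lemma prod_sq_sub_mul_eq {r : ℝ} {q : ℂ} (hq : ‖q‖ = r) (A : Finset ℝ) :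
    ∏ a ∈ A, ((r : ℂ) ^ 2 - a * q)
      = q ^ A.card * (starRingEnd ℂ) (∏ a ∈ A, (q - a)) := by
  rw [map_prod, ← Finset.prod_const, ← Finset.prod_mul_distrib]
  exact Finset.prod_congr rfl fun a _ => sq_sub_mul_eq hq a

lemma re_pos_of_norm_sub_lt {a b : ℂ} (h : ‖a - b‖ < ‖b‖) : 0 < (a / b).re := by
  have hb : b ≠ 0 := by
    rintro rfl
    simp at h
    linarith [norm_nonneg a]
  have h1 : ‖a / b - 1‖ < 1 := by
    rw [div_sub_one hb, norm_div]
    exact (div_lt_one (norm_pos_iff.mpr hb)).mpr h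
  have := Complex.abs_re_le_norm (a / b - 1)
  rw [Complex.sub_re, Complex.one_re] at this
  linarith [(abs_le.mp this).1]

/-- A form of Rouché's theorem for functions with real zeros in a disc. -/
lemma card_zeros_le_of_norm_sub_lt {g v : ℂ → ℂ} {r : ℝ} (hr0 : 0 < r) (hr1 : r < 1)
    (hg : DifferentiableOn ℂ g (Metric.ball 0 1)) (hv : DifferentiableOn ℂ v (Metric.ball 0 1))
    (hv0 : ∀ q, ‖q‖ ≤ r → v q ≠ 0) (A Z : Finset ℝ) (hZr : ∀ z ∈ Z, |z| < r)
    (hZ : ∀ z ∈ Z, g z = 0)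
    (hlt : ∀ q, ‖q‖ = r →
      ‖g q - (∏ a ∈ A, (q - a)) * v q‖ < ‖(∏ a ∈ A, (q - a)) * v q‖) :
    Z.card ≤ A.card := by
  by_contra hcard
  push Not at hcard
  obtain ⟨d, hd⟩ := Nat.exists_eq_add_of_lt hcard
  obtain ⟨u, hu, hgu⟩ := exists_eq_prod_mul Metric.isOpen_ball hg Z
    (fun z hz => by
      have := hZr z hz
      simp only [Metric.mem_ball, dist_zero_right, Complex.norm_real, Real.norm_eq_abs]
      linarith) hZ
  have hsub : Metric.closedBall (0 : ℂ) r ⊆ Metric.ball 0 1 := Metric.closedBall_subset_ball hr1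
  set W : ℂ → ℂ := fun q => u q * (∏ a ∈ A, ((r : ℂ) ^ 2 - a * q)) /
    (v q * ∏ z ∈ Z, ((r : ℂ) ^ 2 - z * q)) with hW
  have hPs : ∀ q, ‖q‖ ≤ r → ∏ z ∈ Z, ((r : ℂ) ^ 2 - z * q) ≠ 0 := by
    intro q hq
    refine Finset.prod_ne_zero_iff.mpr fun z hz h => ?_
    have h1 : (r : ℂ) ^ 2 = z * q := sub_eq_zero.mp h
    have h2 : r ^ 2 = |z| * ‖q‖ := by
      have := congrArg norm h1
      simpa [abs_of_pos hr0] using this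
    have h3 := hZr z hz
    nlinarith [abs_nonneg z, norm_nonneg q]
  have hWd : DifferentiableOn ℂ W (Metric.closedBall 0 r) := by
    have hlin : ∀ B : Finset ℝ,
        DifferentiableOn ℂ (fun q : ℂ => ∏ a ∈ B, ((r : ℂ) ^ 2 - a * q))
          (Metric.closedBall 0 r) := fun B => by fun_prop
    refine ((hu.mono hsub).mul (hlin A)).div ((hv.mono hsub).mul (hlin Z)) fun q hq => ?_
    have hq' : ‖q‖ ≤ r := by simpa using hq
    exact mul_ne_zero (hv0 q hq') (hPs q hq')
  have hpos : ∀ q, ‖q‖ = r → 0 < (q ^ (d + 1) * W q).re := by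
    intro q hq
    have hq0 : q ≠ 0 := by rintro rfl; simp at hq; linarith
    have hh := re_pos_of_norm_sub_lt (hlt q hq)
    set a := ∏ a ∈ A, (q - a) with ha
    set P := ∏ z ∈ Z, (q - z) with hP
    have hPs' := hPs q hq.le
    rw [prod_sq_sub_mul_eq hq] at hPs'
    have hv' := hv0 q hq.le
    have ha0 : a ≠ 0 := by
      intro h0
      rw [h0] at hh; simp at hh
    have hP0 : P ≠ 0 := by
      intro h0
      rw [← hP, h0] at hPs'; simp at hPs'
    have hPc : (starRingEnd ℂ) P ≠ 0 := by simpa using hP0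
    have e : q ^ (d + 1) * W q = ((Complex.normSq a / Complex.normSq P : ℝ) : ℂ) *
        (g q / (a * v q)) := by
      rw [hW]
      simp only
      rw [prod_sq_sub_mul_eq hq, prod_sq_sub_mul_eq hq, hgu q, hd]
      push_cast
      rw [← Complex.mul_conj, ← Complex.mul_conj, ← ha, ← hP]
      field_simp
      ring
    rw [e, Complex.re_ofReal_mul]
    have h1 := Complex.normSq_pos.mpr ha0
    have h2 := Complex.normSq_pos.mpr hP0
    positivity
  have hF : DiffContOnCl ℂ (fun q => Complex.exp (-(q ^ (d + 1) * W q))) (Metric.ball 0 r) := by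
    apply DifferentiableOn.diffContOnCl
    rw [closure_ball _ hr0.ne']
    exact (((differentiable_id.pow _).differentiableOn).mul hWd).neg.cexp
  obtain ⟨w, hw, hmax⟩ := Complex.exists_mem_frontier_isMaxOn_norm
    Metric.isBounded_ball ⟨(0 : ℂ), Metric.mem_ball_self hr0⟩ hF
  rw [frontier_ball _ hr0.ne'] at hw
  have hw' : ‖w‖ = r := by simpa using hw
  have h0 := hmax (subset_closure (Metric.mem_ball_self hr0))
  simp only [Function.comp_apply, Set.mem_ofPred_eq, Complex.norm_exp, Complex.neg_re] at h0
  have h1 := hpos w hw'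
  have := Real.exp_le_exp.mp h0
  rw [zero_pow (Nat.succ_ne_zero d), zero_mul, Complex.zero_re] at this
  linarith

/-- `∑ n ^ k q ^ n` is the value of this polynomial at `(1 + q) / (1 - q)`. -/
noncomputable def Qpoly : ℕ → ℝ[X]
  | 0 => C (1 / 2) * (X + 1)
  | k + 1 => C (1 / 2) * (X ^ 2 - 1) * derivative (Qpoly k)

lemma Qpoly_natDegree_le (k : ℕ) : (Qpoly k).natDegree ≤ k + 1 := by
  induction k with
  | zero => unfold Qpoly; compute_degree
  | succ k ih =>
    rw [Qpoly]
    refine natDegree_mul_le.trans ?_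
    have h1 : (C (1 / 2 : ℝ) * (X ^ 2 - 1)).natDegree ≤ 2 := by compute_degree
    have h2 := natDegree_derivative_le (Qpoly k)
    omega

lemma Qpoly_comp_neg (k : ℕ) : (Qpoly (k + 1)).comp (-X) = (-1) ^ k * Qpoly (k + 1) := by
  induction k with
  | zero => 
    simp [Qpoly]
  | succ k ih =>
    have h : (derivative (Qpoly (k + 1))).comp (-X) = (-1) ^ (k + 1) * derivative (Qpoly (k + 1)) := by
      have := congrArg derivative ih
      rw [derivative_comp] at this
      simp only [derivative_neg, derivative_X, neg_mul, one_mul, derivative_mul] at this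
      have h3 : derivative ((-1 : ℝ[X]) ^ k) = 0 := by
        have : ((-1 : ℝ[X]) ^ k) = C ((-1) ^ k) := by simp
        rw [this, derivative_C]
      rw [h3] at this
      rw [pow_succ]
      linear_combination -this
    rw [Qpoly, mul_comp, h]
    simp
    ring

lemma Qpoly_eval_neg {k : ℕ} (hk : Even k) (hk0 : k ≠ 0) (y : ℝ) :
    (Qpoly k).eval (-y) = -(Qpoly k).eval y := by
  obtain ⟨m, rfl⟩ := Nat.exists_eq_succ_of_ne_zero hk0
  have h := congrArg (eval y) (Qpoly_comp_neg m)
  have hm : Odd m := by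
    by_contra h'
    rw [Nat.not_odd_iff_even] at h'
    exact (Nat.not_even_iff_odd.mpr h'.add_one) hk
  simp only [eval_comp, eval_neg, eval_X, hm.neg_one_pow, eval_mul, eval_one] at h
  simpa using h

lemma Qpoly_eval_one (k : ℕ) : (Qpoly (k + 1)).eval 1 = 0 := by
  simp [Qpoly]

lemma Lser_eq_Qpoly (k : ℕ) {q : ℂ} (hq : ‖q‖ < 1) :
    Lser k q = aeval ((1 + q) / (1 - q)) (Qpoly k) := by
  induction k generalizing q with
  | zero =>
    have h1 : (1 : ℂ) - q ≠ 0 := by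
      rw [sub_ne_zero]; rintro rfl; simp at hq
    simp only [Lser, pser, pow_zero, one_mul, tsum_geometric_of_norm_lt_one hq, Qpoly]
    simp
    field_simp
    ring
  | succ k ih =>
    have h1 : (1 : ℂ) - q ≠ 0 := by
      rw [sub_ne_zero]; rintro rfl; simp at hq
    have hd : HasDerivAt (fun w : ℂ => (1 + w) / (1 - w)) (2 / (1 - q) ^ 2) q := by
      have := ((hasDerivAt_id q).const_add 1).div ((hasDerivAt_id q).const_sub 1) h1
      refine this.congr_deriv ?_
      simp only [id]
      field_simp
      ring
    have h2 : HasDerivAt (fun w : ℂ => aeval ((1 + w) / (1 - w)) (Qpoly k))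
        (aeval ((1 + q) / (1 - q)) (derivative (Qpoly k)) * (2 / (1 - q) ^ 2)) q := by
      have h := (Qpoly k).hasDerivAt_aeval ((1 + q) / (1 - q))
      exact HasDerivAt.comp (h₂ := fun u : ℂ => aeval u (Qpoly k)) q h hd
    have h3 := (polyGrowth_pow k).hasDerivAt hq
    have h4 : (fun w : ℂ => aeval ((1 + w) / (1 - w)) (Qpoly k)) =ᶠ[nhds q]
        pser (fun n => (n : ℂ) ^ k) := by
      have : Metric.ball (0 : ℂ) 1 ∈ nhds q := Metric.isOpen_ball.mem_nhds (by simpa using hq)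
      filter_upwards [this] with w hw
      exact (ih (by simpa using hw)).symm
    have h5 := (h3.congr_of_eventuallyEq h4).unique h2
    have h6 := PolyGrowth.mul_deriv (a := fun n => (n : ℂ) ^ k) q
    rw [h5] at h6
    have h7 : Lser (k + 1) q = pser (fun n => (n : ℂ) * (n : ℂ) ^ k) q := by
      unfold Lser; congr 1; funext n; ring
    rw [h7, ← h6, Qpoly]
    simp
    field_simp
    ring

lemma Qpoly_eq_prod {k n : ℕ} (hk : k = 2 * n) (hn : 1 ≤ n) (Y : ℕ → ℝ)
    (hanti : ∀ i j, 1 ≤ i → i < j → j ≤ n → Y j < Y i)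
    (hpos : ∀ j, 1 ≤ j → j ≤ n → 0 < Y j) (hlt : ∀ j, 1 ≤ j → j ≤ n → Y j < 1)
    (hsign : ∀ j, 1 ≤ j → j ≤ n → 0 < (-1) ^ j * (Qpoly k).eval (Y j)) :
    ∃ R : Finset ℝ, R.card = k + 1 ∧ (∀ y ∈ R, |y| ≤ 1) ∧
      (∀ J, 1 ≤ J → J ≤ n → (R.filter (fun y => Y J < y)).card ≤ J) ∧
      ∃ c : ℝ, Qpoly k = C c * ∏ y ∈ R, (X - C y) := by
  classical
  have hke : Even k := ⟨n, by omega⟩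
  have hk0 : k ≠ 0 := by omega
  have hex : ∀ j, 1 ≤ j → j < n → ∃ x, Y (j + 1) < x ∧ x < Y j ∧ (Qpoly k).eval x = 0 := by
    intro j h1 h2
    have hY := hanti j (j + 1) h1 (by omega) (by omega)
    have ha := hsign j h1 h2.le
    have hb := hsign (j + 1) (by omega) h2
    have hcont : ContinuousOn (fun x => (-1) ^ j * (Qpoly k).eval x) (Set.Icc (Y (j + 1)) (Y j)) :=
      (continuous_const.mul (Qpoly k).continuous).continuousOn
    have := intermediate_value_Ioo hY.le hcont
    have h0 : (0 : ℝ) ∈ Set.Ioo ((-1) ^ j * (Qpoly k).eval (Y (j + 1)))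
        ((-1) ^ j * (Qpoly k).eval (Y j)) := by
      refine ⟨?_, ha⟩
      rw [pow_succ] at hb
      linarith
    obtain ⟨x, hx, hx0⟩ := this h0
    refine ⟨x, hx.1, hx.2, ?_⟩
    exact (mul_eq_zero.mp hx0).resolve_left (pow_ne_zero _ (by norm_num))
  choose! x hx1 hx2 hx0 using hex
  have hxanti : ∀ i j, 1 ≤ i → i < j → j < n → x j < x i := by
    intro i j h1 h2 h3
    have a := hx2 j (by omega) h3
    have b := hx1 i h1 (by omega)
    rcases Nat.lt_or_ge (i + 1) j with h | h
    · linarith [hanti (i + 1) j (by omega) h h3.le]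
    · have : j = i + 1 := by omega
      subst this; linarith
  have hxpos : ∀ j, 1 ≤ j → j < n → 0 < x j := fun j h1 h2 =>
    (hpos (j + 1) (by omega) h2).trans (hx1 j h1 h2)
  have hxlt : ∀ j, 1 ≤ j → j < n → x j < 1 := fun j h1 h2 =>
    (hx2 j h1 h2).trans (hlt j h1 h2.le)
  set I := Finset.Ico 1 n with hI
  have hinj : Set.InjOn x I := by
    intro i hi j hj hij
    simp only [hI, Finset.coe_Ico, Set.mem_Ico] at hi hj
    rcases lt_trichotomy i j with h | h | h
    · linarith [hxanti i j hi.1 h hj.2]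
    · exact h
    · linarith [hxanti j i hj.1 h hi.2]
  set P := insert 1 (I.image x) with hP
  have hPpos : ∀ y ∈ P, 0 < y ∧ y ≤ 1 := by
    intro y hy
    rw [hP, Finset.mem_insert, Finset.mem_image] at hy
    rcases hy with rfl | ⟨j, hj, rfl⟩
    · norm_num
    · rw [hI, Finset.mem_Ico] at hj
      exact ⟨hxpos j hj.1 hj.2, (hxlt j hj.1 hj.2).le⟩
  have hPcard : P.card = n := by
    rw [hP, Finset.card_insert_of_notMem, Finset.card_image_of_injOn hinj, hI, Nat.card_Ico]
    · omega
    · rw [Finset.mem_image]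
      rintro ⟨j, hj, h⟩
      rw [hI, Finset.mem_Ico] at hj
      linarith [hxlt j hj.1 hj.2]
  have hProot : ∀ y ∈ P, (Qpoly k).eval y = 0 := by
    intro y hy
    rw [hP, Finset.mem_insert, Finset.mem_image] at hy
    rcases hy with rfl | ⟨j, hj, rfl⟩
    · obtain ⟨m, rfl⟩ := Nat.exists_eq_succ_of_ne_zero hk0
      exact Qpoly_eval_one m
    · rw [hI, Finset.mem_Ico] at hj
      exact hx0 j hj.1 hj.2
  set R := (insert 0 P) ∪ P.image (fun y => -y) with hR
  have hRcard : R.card = k + 1 := by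
    rw [hR, Finset.card_union_of_disjoint, Finset.card_insert_of_notMem,
      Finset.card_image_of_injective _ neg_injective, hPcard]
    · omega
    · intro h
      exact (hPpos 0 h).1.ne rfl
    · rw [Finset.disjoint_left]
      intro y hy hy'
      rw [Finset.mem_image] at hy'
      obtain ⟨w, hw, rfl⟩ := hy'
      have h1 := (hPpos w hw).1
      rw [Finset.mem_insert] at hy
      rcases hy with h | h
      · linarith
      · linarith [(hPpos _ h).1]
  have hz : (Qpoly k).eval 0 = 0 := by
    have := Qpoly_eval_neg hke hk0 0
    rw [neg_zero] at this
    linarith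
  have hRroot : ∀ y ∈ R, (Qpoly k).eval y = 0 := by
    intro y hy
    rw [hR, Finset.mem_union, Finset.mem_insert, Finset.mem_image] at hy
    rcases hy with (rfl | h) | ⟨w, hw, rfl⟩
    · exact hz
    · exact hProot y h
    · rw [Qpoly_eval_neg hke hk0, hProot w hw, neg_zero]
  refine ⟨R, hRcard, ?_, ?_, ?_⟩
  · intro y hy
    rw [hR, Finset.mem_union, Finset.mem_insert, Finset.mem_image] at hy
    rcases hy with (rfl | h) | ⟨w, hw, rfl⟩
    · simp
    · have := hPpos y h
      rw [abs_of_pos this.1]; exact this.2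
    · have := hPpos w hw
      rw [abs_neg, abs_of_pos this.1]; exact this.2
  · intro J hJ1 hJn
    have hsub : R.filter (fun y => Y J < y) ⊆ insert 1 ((Finset.Ico 1 J).image x) := by
      intro y hy
      rw [Finset.mem_filter] at hy
      obtain ⟨hy, hYy⟩ := hy
      have hYJ := hpos J hJ1 hJn
      rw [hR, Finset.mem_union, Finset.mem_insert, Finset.mem_image] at hy
      rcases hy with (rfl | h) | ⟨w, hw, rfl⟩
      · linarith
      · rw [hP, Finset.mem_insert, Finset.mem_image] at h
        rcases h with rfl | ⟨j, hj, rfl⟩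
        · simp
        · rw [hI, Finset.mem_Ico] at hj
          rw [Finset.mem_insert, Finset.mem_image]
          refine Or.inr ⟨j, ?_, rfl⟩
          rw [Finset.mem_Ico]
          refine ⟨hj.1, ?_⟩
          by_contra hJj
          push Not at hJj
          have h1 := hx2 j hj.1 hj.2
          rcases hJj.lt_or_eq with h | h
          · linarith [hanti J j hJ1 h hj.2.le]
          · subst h; linarith
      · linarith [(hPpos w hw).1]
    refine (Finset.card_le_card hsub).trans ((Finset.card_insert_le _ _).trans ?_)
    have := Finset.card_image_le (s := Finset.Ico 1 J) (f := x)
    rw [Nat.card_Ico] at this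
    omega
  · have hne : Qpoly k ≠ 0 := by
      intro h
      have := hsign 1 le_rfl hn
      rw [h] at this; simp at this
    have hle : R.val ≤ (Qpoly k).roots := by
      rw [Multiset.le_iff_subset R.nodup]
      intro y hy
      rw [mem_roots hne]
      exact hRroot y hy
    have hcard : (Qpoly k).roots.card ≤ (Qpoly k).natDegree := card_roots' _
    have hdeg := Qpoly_natDegree_le k
    have hRv : R.val.card = k + 1 := hRcard
    have heq : R.val = (Qpoly k).roots := Multiset.eq_of_le_of_card_le hle (by omega)
    have hc := congrArg Multiset.card heq
    refine ⟨(Qpoly k).leadingCoeff, ?_⟩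
    have := C_leadingCoeff_mul_prod_multiset_X_sub_C (p := Qpoly k) (by omega)
    rw [← heq] at this
    exact this.symm

lemma norm_add_mul_ge {a b r : ℝ} (ha : 0 ≤ a) (hb : 0 ≤ b) {q : ℂ} (hq : ‖q‖ = r) :
    |a - b * r| ≤ ‖(a : ℂ) + b * q‖ := by
  have h := abs_norm_sub_norm_le (a : ℂ) (-(b * q))
  rw [norm_neg, norm_mul, Complex.norm_real, Complex.norm_real, Real.norm_of_nonneg ha,
    Real.norm_of_nonneg hb, hq] at h
  simpa using h

lemma Lser_eq_prod {k : ℕ} {R : Finset ℝ} {c : ℝ} (hR : R.card = k + 1)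
    (hQ : Qpoly k = C c * ∏ y ∈ R, (X - C y)) {q : ℂ} (hq : ‖q‖ < 1) :
    Lser k q = c * (∏ y ∈ R, (((1 - y : ℝ) : ℂ) + ((1 + y : ℝ) : ℂ) * q)) / (1 - q) ^ (k + 1) := by
  have h1 : (1 : ℂ) - q ≠ 0 := by
    rw [sub_ne_zero]; rintro rfl; simp at hq
  rw [Lser_eq_Qpoly k hq, hQ, ← hR, ← Finset.prod_const, mul_div_assoc, ← Finset.prod_div_distrib]
  simp only [map_mul, aeval_C, map_prod, map_sub, aeval_X]
  congr 1
  refine Finset.prod_congr rfl fun y _ => ?_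
  push_cast
  simp only [Complex.coe_algebraMap]
  field_simp
  ring

lemma norm_Lser_neg_le {k : ℕ} {R : Finset ℝ} {c : ℝ} (hR : R.card = k + 1)
    (hR1 : ∀ y ∈ R, |y| ≤ 1) (hQ : Qpoly k = C c * ∏ y ∈ R, (X - C y)) {r : ℝ} (hr0 : 0 ≤ r)
    (hr1 : r < 1) {q : ℂ} (hq : ‖q‖ = r) : ‖Lser k (-r : ℂ)‖ ≤ ‖Lser k q‖ := by
  have hn : ‖(-r : ℂ)‖ < 1 := by simpa [abs_of_nonneg hr0] using hr1
  have hq1 : (1 : ℂ) - q ≠ 0 := by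
    rw [sub_ne_zero]; rintro rfl; simp at hq; linarith
  rw [Lser_eq_prod hR hQ hn, Lser_eq_prod hR hQ (hq.trans_lt hr1)]
  rw [norm_div, norm_div, norm_mul, norm_mul, norm_prod, norm_prod, norm_pow, norm_pow]
  have hden : ‖(1 : ℂ) - q‖ ≤ ‖(1 : ℂ) - -r‖ := by
    have e : ‖(1 : ℂ) - -r‖ = 1 + r := by
      rw [sub_neg_eq_add]
      have : (1 : ℂ) + r = ((1 + r : ℝ) : ℂ) := by push_cast; rfl
      rw [this, Complex.norm_real, Real.norm_of_nonneg (by linarith)]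
    rw [e]
    calc ‖(1 : ℂ) - q‖ ≤ ‖(1 : ℂ)‖ + ‖q‖ := norm_sub_le _ _
      _ = 1 + r := by rw [hq, norm_one]
  have hpos : 0 < ‖(1 : ℂ) - q‖ := norm_pos_iff.mpr hq1
  gcongr with y hy
  have hy := abs_le.mp (hR1 y hy)
  have := norm_add_mul_ge (a := 1 - y) (b := 1 + y) (by linarith) (by linarith) hq
  refine le_trans (le_of_eq ?_) this
  rw [← Real.norm_eq_abs, ← Complex.norm_real]
  congr 1
  push_cast; ring

/-- In the disc of radius `r`, the series `Lser k` is a polynomial with few real roots times a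
nonvanishing function. -/
lemma exists_Lser_factor {k : ℕ} {R : Finset ℝ} {c : ℝ} (hR : R.card = k + 1)
    (hR1 : ∀ y ∈ R, |y| ≤ 1) (hQ : Qpoly k = C c * ∏ y ∈ R, (X - C y)) {r : ℝ} (hr0 : 0 < r)
    (hr1 : r < 1) (hL : Lser k (-r : ℂ) ≠ 0) :
    ∃ (A : Finset ℝ) (v : ℂ → ℂ), A.card ≤ (R.filter (fun y => (1 - r) / (1 + r) < y)).card ∧
      DifferentiableOn ℂ v (Metric.ball 0 1) ∧ (∀ q, ‖q‖ ≤ r → v q ≠ 0) ∧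
      ∀ q, ‖q‖ < 1 → Lser k q = (∏ a ∈ A, (q - a)) * v q := by
  classical
  set y₀ := (1 - r) / (1 + r) with hy₀
  have hy₀pos : 0 < y₀ := div_pos (by linarith) (by linarith)
  have hn : ‖(-r : ℂ)‖ < 1 := by simpa [abs_of_pos hr0] using hr1
  have hc : c ≠ 0 := by
    rintro rfl
    rw [Lser_eq_prod hR hQ hn] at hL
    simp at hL
  set R₁ := R.filter (fun y => y₀ < y) with hR₁
  set R₂ := R.filter (fun y => ¬ y₀ < y) with hR₂
  have hinj : Set.InjOn (fun y : ℝ => -((1 - y) / (1 + y))) R₁ := by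
    intro a ha b hb hab
    have ha' : y₀ < a := by simp [hR₁] at ha; exact ha.2
    have hb' : y₀ < b := by simp [hR₁] at hb; exact hb.2
    have h1 : 1 + a ≠ 0 := by linarith
    have h2 : 1 + b ≠ 0 := by linarith
    simp only [neg_inj] at hab
    rw [div_eq_div_iff h1 h2] at hab
    linarith
  refine ⟨R₁.image (fun y => -((1 - y) / (1 + y))),
    fun q => c * (∏ y ∈ R₁, ((1 + y : ℝ) : ℂ)) *
      (∏ y ∈ R₂, (((1 - y : ℝ) : ℂ) + ((1 + y : ℝ) : ℂ) * q)) / (1 - q) ^ (k + 1),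
    Finset.card_image_le, ?_, ?_, ?_⟩
  · refine DifferentiableOn.div (by fun_prop) (by fun_prop) fun q hq => ?_
    have hq' : ‖q‖ < 1 := by simpa using hq
    refine pow_ne_zero _ ?_
    rw [sub_ne_zero]; rintro rfl; simp at hq'
  · intro q hq
    have hq1 : (1 : ℂ) - q ≠ 0 := by
      rw [sub_ne_zero]; rintro rfl; simp at hq; linarith
    refine div_ne_zero (mul_ne_zero (mul_ne_zero (by exact_mod_cast hc) ?_) ?_)
      (pow_ne_zero _ hq1)
    · refine Finset.prod_ne_zero_iff.mpr fun y hy => ?_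
      have hy : y₀ < y := (Finset.mem_filter.mp hy).2
      have : 1 + y ≠ 0 := by linarith
      exact_mod_cast this
    · refine Finset.prod_ne_zero_iff.mpr fun y hy h0 => ?_
      obtain ⟨hyR, hy⟩ := Finset.mem_filter.mp hy
      push Not at hy
      have hy1 := abs_le.mp (hR1 y hyR)
      have hlt : y < y₀ := by
        refine lt_of_le_of_ne hy ?_
        rintro rfl
        apply hL
        rw [Lser_eq_prod hR hQ hn, Finset.prod_eq_zero hyR]
        · simp
        · have e : (1 - y₀) + (1 + y₀) * (-r) = 0 := by
            rw [hy₀]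
            have : 1 + r ≠ 0 := by linarith
            field_simp
            ring
          exact_mod_cast e
      have h1 : (1 + y) * r < 1 - y := by
        rw [hy₀, lt_div_iff₀ (by linarith)] at hlt
        linarith
      have h2 : ((1 - y : ℝ) : ℂ) = -(((1 + y : ℝ) : ℂ) * q) := by
        linear_combination h0
      have h3 := congrArg norm h2
      rw [norm_neg, norm_mul, Complex.norm_real, Complex.norm_real,
        Real.norm_of_nonneg (by linarith), Real.norm_of_nonneg (by linarith)] at h3
      nlinarith [norm_nonneg q]
  · intro q hq
    rw [Lser_eq_prod hR hQ hq, ← Finset.prod_filter_mul_prod_filter_not R (fun y => y₀ < y),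
      Finset.prod_image hinj]
    have e : ∏ y ∈ R₁, (((1 - y : ℝ) : ℂ) + ((1 + y : ℝ) : ℂ) * q)
        = (∏ y ∈ R₁, (q - ((-((1 - y) / (1 + y)) : ℝ) : ℂ))) * ∏ y ∈ R₁, ((1 + y : ℝ) : ℂ) := by
      rw [← Finset.prod_mul_distrib]
      refine Finset.prod_congr rfl fun y hy => ?_
      have hy : y₀ < y := (Finset.mem_filter.mp hy).2
      have h0 : 1 + y ≠ 0 := by linarith
      have h1 : (1 + y : ℂ) ≠ 0 := by exact_mod_cast h0
      push_cast
      field_simp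
      ring
    rw [e]
    ring

lemma integrableOn_pow_mul_exp_neg (k : ℕ) {b : ℝ} (hb : 0 < b) :
    IntegrableOn (fun y : ℝ => y ^ k * Real.exp (-(b * y))) (Set.Ioi 0) := by
  have := integrableOn_rpow_mul_exp_neg_mul_rpow (p := 1) (s := k) (b := b)
    (by linarith [(Nat.cast_nonneg k : (0 : ℝ) ≤ k)]) one_pos hb
  refine this.congr_fun (fun y _ => ?_) measurableSet_Ioi
  simp

lemma integral_pow_mul_exp_neg (k : ℕ) {b : ℝ} (hb : 0 < b) :
    ∫ y in Set.Ioi (0 : ℝ), y ^ k * Real.exp (-(b * y)) = k.factorial / b ^ (k + 1) := by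
  have h := Real.integral_rpow_mul_exp_neg_mul_Ioi (a := k + 1) (by positivity) hb
  rw [Real.Gamma_nat_eq_factorial] at h
  have e : (1 / b) ^ ((k : ℝ) + 1) = 1 / b ^ (k + 1) := by
    have : ((k : ℝ) + 1) = ((k + 1 : ℕ) : ℝ) := by push_cast; rfl
    rw [this, Real.rpow_natCast, one_div_pow]
  rw [e] at h
  rw [div_eq_mul_one_div, mul_comm, ← h]
  refine setIntegral_congr_fun measurableSet_Ioi fun y _ => ?_
  simp

lemma norm_pow_mul_cexp (k : ℕ) (c : ℂ) {y : ℝ} (hy : 0 < y) :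
    ‖(y : ℂ) ^ k * Complex.exp (-(c * y))‖ = y ^ k * Real.exp (-(c.re * y)) := by
  rw [norm_mul, norm_pow, Complex.norm_real, Real.norm_of_nonneg hy.le, Complex.norm_exp]
  simp

lemma integrableOn_pow_mul_cexp_neg (k : ℕ) {c : ℂ} (hc : 0 < c.re) :
    IntegrableOn (fun y : ℝ => (y : ℂ) ^ k * Complex.exp (-(c * y))) (Set.Ioi 0) := by
  refine Integrable.mono' (integrableOn_pow_mul_exp_neg k hc) ?_ ?_
  · exact (Continuous.aestronglyMeasurable (by fun_prop))
  · filter_upwards [ae_restrict_mem measurableSet_Ioi] with y hy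
    exact (norm_pow_mul_cexp k c hy).le

lemma integral_pow_mul_cexp_neg (k : ℕ) {c : ℂ} (hc : 0 < c.re) :
    ∫ y in Set.Ioi (0 : ℝ), (y : ℂ) ^ k * Complex.exp (-(c * y)) = k.factorial / c ^ (k + 1) := by
  have hc0 : c ≠ 0 := by rintro rfl; simp at hc
  have hexp : ∀ y : ℝ, HasDerivAt (fun y : ℝ => Complex.exp (-(c * y)))
      (-c * Complex.exp (-(c * y))) y := by
    intro y
    have h1 : HasDerivAt (fun y : ℝ => -(c * (y : ℂ))) (-c) y := by
      have := ((Complex.ofRealCLM.hasDerivAt (x := y)).const_mul c).neg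
      refine this.congr_deriv ?_
      simp
    refine h1.cexp.congr_deriv ?_
    ring
  have hlim : ∀ j : ℕ, Tendsto (fun y : ℝ => (y : ℂ) ^ j * Complex.exp (-(c * y))) atTop (𝓝 0) := by
    intro j
    rw [tendsto_zero_iff_norm_tendsto_zero]
    have h2 := (isLittleO_pow_exp_pos_mul_atTop j hc).tendsto_div_nhds_zero
    refine h2.congr' ?_
    filter_upwards [eventually_gt_atTop 0] with y hy
    rw [norm_pow_mul_cexp j c hy, Real.exp_neg, div_eq_mul_inv]
  induction k with
  | zero =>
    have hInt := integrableOn_pow_mul_cexp_neg 0 hc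
    have h := integral_Ioi_of_hasDerivAt_of_tendsto' (a := 0)
      (f := fun y : ℝ => Complex.exp (-(c * y)))
      (f' := fun y : ℝ => -c * Complex.exp (-(c * y))) (m := 0) (fun y _ => hexp y)
      (by
        have h1 : Integrable (fun y : ℝ => -c * ((y : ℂ) ^ 0 * Complex.exp (-(c * y))))
          (volume.restrict (Set.Ioi 0)) := hInt.const_mul (-c)
        simp only [pow_zero, one_mul] at h1
        exact h1) (by simpa using hlim 0)
    rw [integral_const_mul] at h
    simp at h ⊢
    field_simp
    linear_combination h
  | succ k ih =>
    have hder : ∀ y : ℝ, HasDerivAt (fun y : ℝ => (y : ℂ) ^ (k + 1) * Complex.exp (-(c * y)))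
        ((k + 1 : ℂ) * ((y : ℂ) ^ k * Complex.exp (-(c * y)))
          - c * ((y : ℂ) ^ (k + 1) * Complex.exp (-(c * y)))) y := by
      intro y
      have h1 : HasDerivAt (fun y : ℝ => (y : ℂ) ^ (k + 1)) ((k + 1 : ℂ) * (y : ℂ) ^ k) y := by
        have := (Complex.ofRealCLM.hasDerivAt (x := y)).pow (k + 1)
        refine this.congr_deriv ?_
        simp
      refine (h1.mul (hexp y)).congr_deriv ?_
      ring
    have i1 := (integrableOn_pow_mul_cexp_neg k hc).const_mul (k + 1 : ℂ)
    have i2 := (integrableOn_pow_mul_cexp_neg (k + 1) hc).const_mul c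
    have h := integral_Ioi_of_hasDerivAt_of_tendsto' (a := 0) (m := 0) (fun y _ => hder y)
      (i1.sub i2) (hlim (k + 1))
    rw [integral_sub i1 i2, integral_const_mul, integral_const_mul, ih] at h
    simp at h
    rw [sub_eq_zero] at h
    rw [eq_div_iff (pow_ne_zero _ hc0), Nat.factorial_succ]
    push_cast
    field_simp at h
    linear_combination -h

lemma half_le_re_inv_one_sub {v : ℂ} (hv : ‖v‖ < 1) : 1 / 2 ≤ ((1 - v)⁻¹).re := by
  have h1 : (1 : ℂ) - v ≠ 0 := by
    rw [sub_ne_zero]; rintro rfl; simp at hv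
  rw [Complex.inv_re, div_le_div_iff₀ two_pos (Complex.normSq_pos.mpr h1)]
  have h2 : Complex.normSq v < 1 := by
    rw [Complex.normSq_eq_norm_sq]; nlinarith [norm_nonneg v]
  rw [Complex.normSq_apply] at h2 ⊢
  simp
  nlinarith

lemma half_le_re_tsum_inv_pow (k : ℕ) (hk : 1 ≤ k) {w : ℂ} (hw : 0 < w.re) :
    Summable (fun n : ℕ => ((1 + n * w) ^ (k + 1))⁻¹) ∧
    1 / 2 ≤ (∑' n : ℕ, ((1 + n * w) ^ (k + 1))⁻¹).re := by
  have hre : ∀ n : ℕ, 0 < (1 + n * w).re := by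
    intro n
    simp only [Complex.add_re, Complex.one_re, Complex.mul_re, Complex.natCast_re,
      Complex.natCast_im, zero_mul, sub_zero]
    positivity
  set F : ℕ → ℝ → ℂ := fun n y => (y : ℂ) ^ k * Complex.exp (-((1 + n * w) * y)) with hF
  have hInt : ∀ n, Integrable (F n) (volume.restrict (Set.Ioi 0)) := fun n =>
    integrableOn_pow_mul_cexp_neg k (hre n)
  have hnorm : ∀ n : ℕ, ∫ y in Set.Ioi (0 : ℝ), ‖F n y‖
      = k.factorial / (1 + n * w.re) ^ (k + 1) := by
    intro n
    have h1 : ∫ y in Set.Ioi (0 : ℝ), ‖F n y‖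
        = ∫ y in Set.Ioi (0 : ℝ), y ^ k * Real.exp (-((1 + n * w.re) * y)) := by
      refine setIntegral_congr_fun measurableSet_Ioi fun y hy => ?_
      simp only [hF]
      rw [norm_pow_mul_cexp k _ hy]
      simp
    rw [h1, integral_pow_mul_exp_neg k (by positivity)]
  have hs : Summable (fun n : ℕ => ∫ y in Set.Ioi (0 : ℝ), ‖F n y‖) := by
    simp_rw [hnorm]
    have h2 : Summable (fun n : ℕ => (1 : ℝ) / ((n : ℝ)) ^ 2) := Real.summable_one_div_nat_pow.mpr one_lt_two
    rw [← summable_nat_add_iff 1] at h2 ⊢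
    refine Summable.of_nonneg_of_le (fun n => by positivity) (fun n => ?_)
      (h2.mul_left (k.factorial / w.re ^ 2))
    rw [div_mul_div_comm, mul_one]
    have : w.re ^ 2 * ((n + 1 : ℕ) : ℝ) ^ 2 ≤ (1 + ((n + 1 : ℕ) : ℝ) * w.re) ^ (k + 1) := by
      calc w.re ^ 2 * ((n + 1 : ℕ) : ℝ) ^ 2 ≤ (1 + ((n + 1 : ℕ) : ℝ) * w.re) ^ 2 := by
            rw [← mul_pow]
            gcongr
            linarith
        _ ≤ _ := pow_le_pow_right₀ (by linarith [show 0 ≤ ((n + 1 : ℕ) : ℝ) * w.re by positivity])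
            (by omega)
    gcongr
  have hmain := hasSum_integral_of_summable_integral_norm hInt hs
  have hk0 : (k.factorial : ℂ) ≠ 0 := by exact_mod_cast k.factorial_ne_zero
  have hval : ∀ n : ℕ, (k.factorial : ℂ)⁻¹ * ∫ y in Set.Ioi (0 : ℝ), F n y
      = ((1 + n * w) ^ (k + 1))⁻¹ := by
    intro n
    rw [hF]
    simp only
    rw [integral_pow_mul_cexp_neg k (hre n)]
    field_simp
  have hJ := hmain.mul_left (k.factorial : ℂ)⁻¹
  simp_rw [hval] at hJ
  refine ⟨hJ.summable, ?_⟩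
  rw [hJ.tsum_eq]
  have htsum : ∀ y ∈ Set.Ioi (0 : ℝ), ∑' n, F n y
      = (y : ℂ) ^ k * Complex.exp (-y) * (1 - Complex.exp (-(w * y)))⁻¹ ∧
      ‖Complex.exp (-(w * y))‖ < 1 := by
    intro y hy
    have hy : 0 < y := hy
    have hv : ‖Complex.exp (-(w * y))‖ < 1 := by
      rw [Complex.norm_exp, Real.exp_lt_one_iff]
      simp
      positivity
    refine ⟨?_, hv⟩
    rw [← tsum_geometric_of_norm_lt_one hv, ← tsum_mul_left]
    congr 1; ext n
    rw [hF]
    simp only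
    rw [← Complex.exp_nat_mul, mul_assoc, ← Complex.exp_add]
    congr 2; ring
  have hint2 : Integrable (fun y => ∑' n, F n y) (volume.restrict (Set.Ioi (0 : ℝ))) := by
    have hcongr : Set.EqOn (fun y : ℝ => ∑' n, F n y)
        (fun y : ℝ => (y : ℂ) ^ k * Complex.exp (-y) * (1 - Complex.exp (-(w * y)))⁻¹)
        (Set.Ioi 0) := fun y hy => (htsum y hy).1
    refine IntegrableOn.congr_fun ?_ hcongr.symm measurableSet_Ioi
    have hdom : Integrable (fun y : ℝ => y ^ k * Real.exp (-(1 * y))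
        + (w.re)⁻¹ * (y ^ (k - 1) * Real.exp (-(1 * y)))) (volume.restrict (Set.Ioi (0 : ℝ))) :=
      (integrableOn_pow_mul_exp_neg k one_pos).add
        ((integrableOn_pow_mul_exp_neg (k - 1) one_pos).const_mul _)
    refine Integrable.mono' hdom (Measurable.aestronglyMeasurable (by fun_prop)) ?_
    filter_upwards [ae_restrict_mem measurableSet_Ioi] with y hy
    have hy : 0 < y := hy
    have h2 := (htsum y hy).2
    have hx : 0 < w.re * y := by positivity
    have hn : ‖Complex.exp (-(w * y))‖ ≤ 1 / (1 + w.re * y) := by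
      rw [Complex.norm_exp]
      have : (-(w * (y : ℂ))).re = -(w.re * y) := by simp
      rw [this, Real.exp_neg, one_div]
      gcongr
      linarith [Real.add_one_le_exp (w.re * y)]
    have hlow : w.re * y / (1 + w.re * y) ≤ ‖1 - Complex.exp (-(w * y))‖ := by
      have := norm_sub_norm_le (1 : ℂ) (Complex.exp (-(w * y)))
      rw [norm_one] at this
      have e : w.re * y / (1 + w.re * y) = 1 - 1 / (1 + w.re * y) := by
        field_simp; ring
      rw [e]; linarith
    rw [norm_mul, norm_inv, norm_mul, norm_pow, Complex.norm_real, Real.norm_of_nonneg hy.le,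
      Complex.norm_exp]
    have e1 : y ^ k = y ^ (k - 1) * y := by rw [← pow_succ]; congr 1; omega
    have hinv : ‖1 - Complex.exp (-(w * y))‖⁻¹ ≤ (w.re * y / (1 + w.re * y))⁻¹ := by
      gcongr
    calc y ^ k * Real.exp (-(y : ℂ)).re * ‖1 - Complex.exp (-(w * y))‖⁻¹
        ≤ y ^ k * Real.exp (-(y : ℂ)).re * (w.re * y / (1 + w.re * y))⁻¹ := by gcongr
      _ = _ := by
        simp only [Complex.neg_re, Complex.ofReal_re, one_mul]
        rw [e1]
        field_simp
        ring
  have hre2 : (∫ y in Set.Ioi (0 : ℝ), ∑' n, F n y).re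
      = ∫ y in Set.Ioi (0 : ℝ), (∑' n, F n y).re := by
    exact (integral_re hint2).symm
  have hge : ∫ y in Set.Ioi (0 : ℝ), 1 / 2 * (y ^ k * Real.exp (-(1 * y)))
      ≤ ∫ y in Set.Ioi (0 : ℝ), (∑' n, F n y).re := by
    refine setIntegral_mono_on ((integrableOn_pow_mul_exp_neg k one_pos).const_mul _) hint2.re
      measurableSet_Ioi fun y hy => ?_
    obtain ⟨h1, h2⟩ := htsum y hy
    have hy : 0 < y := hy
    rw [h1]
    have e : (y : ℂ) ^ k * Complex.exp (-y) = ((y ^ k * Real.exp (-y) : ℝ) : ℂ) := by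
      push_cast; rfl
    rw [e, Complex.re_ofReal_mul, one_mul, mul_comm]
    exact mul_le_mul_of_nonneg_left (half_le_re_inv_one_sub h2) (by positivity)
  have hval1 : ∫ y in Set.Ioi (0 : ℝ), 1 / 2 * (y ^ k * Real.exp (-(1 * y)))
      = 1 / 2 * k.factorial := by
    rw [integral_const_mul]
    rw [integral_pow_mul_exp_neg k one_pos, one_pow, div_one]
  rw [hval1, ← hre2] at hge
  have e : (k.factorial : ℂ)⁻¹ = ((k.factorial : ℝ)⁻¹ : ℝ) := by push_cast; rfl
  rw [e, Complex.re_ofReal_mul]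
  have hkp : (0 : ℝ) < k.factorial := by exact_mod_cast k.factorial_pos
  rw [inv_mul_eq_div, le_div_iff₀ hkp]
  exact hge

lemma norm_cexp_lt_one {z : ℂ} (hz : 0 < z.im) :
    ‖Complex.exp (2 * Real.pi * Complex.I * z)‖ < 1 := by
  rw [Complex.norm_exp, Real.exp_lt_one_iff]
  simp
  positivity

/-- The Lipschitz formula. -/
lemma hasSum_lipschitz {k : ℕ} (hk : 1 ≤ k) {z : ℂ} (hz : 0 < z.im) :
    HasSum (fun n : ℤ => (k.factorial : ℂ) * ((-2 * Real.pi * Complex.I * (z + n)) ^ (k + 1))⁻¹)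
      (Lser k (Complex.exp (2 * Real.pi * Complex.I * z))) := by
  have h := EisensteinSeries.qExpansion_identity hk ⟨z, hz⟩
  have hs : Summable (fun n : ℤ => 1 / (z + n) ^ (k + 1)) := by
    have := EisensteinSeries.linear_right_summable z 1 (k := (k + 1 : ℕ)) (by push_cast; omega)
    refine this.congr fun n => ?_
    rw [zpow_natCast]; simp
  have h1 := hs.hasSum
  have h2 : (∑' n : ℤ, 1 / (z + n) ^ (k + 1)) = _ := h
  rw [h2] at h1
  have hk0 : (k.factorial : ℂ) ≠ 0 := by exact_mod_cast k.factorial_ne_zero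
  have hp : (-2 * Real.pi * Complex.I : ℂ) ^ (k + 1) ≠ 0 := by
    refine pow_ne_zero _ ?_
    simp [Real.pi_ne_zero]
  have h3 := h1.mul_left ((k.factorial : ℂ) * ((-2 * Real.pi * Complex.I) ^ (k + 1))⁻¹)
  have e : Lser k (Complex.exp (2 * Real.pi * Complex.I * z))
      = (k.factorial : ℂ) * ((-2 * Real.pi * Complex.I) ^ (k + 1))⁻¹ *
      ((-2 * Real.pi * Complex.I) ^ (k + 1) / (k.factorial : ℂ) *
        ∑' n : ℕ, (n : ℂ) ^ k * Complex.exp (2 * Real.pi * Complex.I * z) ^ n) := by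
    rw [Lser, pser]
    field_simp
  rw [e]
  refine h3.congr_fun fun n => ?_
  rw [mul_pow (-2 * Real.pi * Complex.I) (z + n), mul_inv]
  simp only [one_div]
  ring

/-- `exp (-2πt)` for `t = cot α / 2`. -/
noncomputable def rad (α : ℝ) : ℝ := Real.exp (-(Real.pi * (Real.cos α / Real.sin α)))

/-- `k! / (2π) ^ (k + 1)` -/
noncomputable def kap (k : ℕ) : ℝ := k.factorial / (2 * Real.pi) ^ (k + 1)

lemma kap_pos (k : ℕ) : 0 < kap k := by
  have := Real.pi_pos
  unfold kap; positivity

/-- The point of the line `Re z = 1/2` with `Im z = cot α / 2`. -/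
noncomputable def zpt (α : ℝ) : ℂ :=
  1 / 2 + ((Real.cos α / (2 * Real.sin α) : ℝ) : ℂ) * Complex.I

/-- The inverse of `zpt α`. -/
noncomputable def wpt (α : ℝ) : ℂ :=
  2 * Real.sin α * (Real.sin α - Real.cos α * Complex.I)

lemma zpt_eq {α : ℝ} (hs : 0 < Real.sin α) :
    -2 * Real.pi * Complex.I * zpt α
      = 2 * Real.pi * (2 * Real.sin α)⁻¹ * Complex.exp (-(α * Complex.I)) := by
  have hs' : (Real.sin α : ℂ) ≠ 0 := by exact_mod_cast hs.ne'
  have e : Complex.exp (-(α * Complex.I)) = Real.cos α - Real.sin α * Complex.I := by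
    rw [← neg_mul, Complex.exp_mul_I, Complex.cos_neg, Complex.sin_neg]
    push_cast; ring
  rw [e, zpt]
  push_cast at hs' ⊢
  field_simp
  ring_nf
  simp only [Complex.I_sq]
  ring

lemma zpt_mul_wpt {α : ℝ} (hs : 0 < Real.sin α) : zpt α * wpt α = 1 := by
  have hs' : (Real.sin α : ℂ) ≠ 0 := by exact_mod_cast hs.ne'
  have h1 : (Real.sin α : ℂ) ^ 2 + (Real.cos α : ℂ) ^ 2 = 1 := by
    exact_mod_cast Real.sin_sq_add_cos_sq α
  rw [zpt, wpt]
  push_cast at hs' h1 ⊢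
  field_simp
  ring_nf
  simp only [Complex.I_sq]
  linear_combination h1

lemma cexp_zpt (α : ℝ) :
    Complex.exp (2 * Real.pi * Complex.I * zpt α) = -(rad α : ℂ) := by
  have e : 2 * Real.pi * Complex.I * zpt α
      = Real.pi * Complex.I + ((-(Real.pi * (Real.cos α / Real.sin α)) : ℝ) : ℂ) := by
    rw [zpt]
    push_cast
    have h : Complex.cos α / (2 * Complex.sin α) = (Complex.cos α / Complex.sin α) / 2 := by
      rw [div_div, mul_comm]
    rw [h]
    ring_nf
    simp only [Complex.I_sq]
    ring
  rw [e, Complex.exp_add, Complex.exp_pi_mul_I, rad, Complex.ofReal_exp]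
  ring

lemma zpt_im_pos {α : ℝ} (hs : 0 < Real.sin α) (hc : 0 < Real.cos α) : 0 < (zpt α).im := by
  rw [zpt]
  simp only [Complex.add_im, Complex.mul_im, Complex.ofReal_re, Complex.I_im, Complex.ofReal_im,
    Complex.I_re]
  have : (1 / 2 : ℂ).im = 0 := by norm_num
  rw [this]
  have : 0 < Real.cos α / (2 * Real.sin α) := by positivity
  linarith

lemma wpt_re_pos {α : ℝ} (hs : 0 < Real.sin α) : 0 < (wpt α).re := by
  have : wpt α = ((2 * Real.sin α ^ 2 : ℝ) : ℂ) + ((-(2 * Real.sin α * Real.cos α) : ℝ) : ℂ)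
      * Complex.I := by
    rw [wpt]; push_cast; ring
  rw [this]
  simp only [Complex.add_re, Complex.ofReal_re, Complex.mul_re, Complex.I_re, Complex.ofReal_im,
    Complex.I_im]
  have : 0 < Real.sin α ^ 2 := by positivity
  linarith

/-- `∑ (1 + n w) ^ (-(k+1))` with `w = wpt α`. -/
noncomputable def Jsum (k : ℕ) (α : ℝ) : ℂ := ∑' n : ℕ, ((1 + n * wpt α) ^ (k + 1))⁻¹

lemma Lser_neg_rad {k : ℕ} (hk : 1 ≤ k) {α : ℝ} (hs : 0 < Real.sin α) (hc : 0 < Real.cos α) :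
    Lser k (-(rad α : ℂ)) = ((2 * kap k * (2 * Real.sin α) ^ (k + 1) *
      (Complex.exp (((k + 1 : ℕ) * α : ℝ) * Complex.I) * Jsum k α).re : ℝ) : ℂ) := by
  have hz := zpt_im_pos hs hc
  have h := (hasSum_lipschitz hk hz).nat_add_neg_add_one
  rw [cexp_zpt] at h
  have hJ := (half_le_re_tsum_inv_pow k hk (wpt_re_pos hs)).1.hasSum
  have hpi := Real.pi_pos
  have hzw := zpt_mul_wpt hs
  have hz0 : zpt α ≠ 0 := left_ne_zero_of_mul_eq_one hzw
  set x : ℕ → ℂ := fun n => (kap k * (2 * Real.sin α) ^ (k + 1) : ℝ) *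
    (Complex.exp (((k + 1 : ℕ) * α : ℝ) * Complex.I) * ((1 + n * wpt α) ^ (k + 1))⁻¹) with hx
  have hterm : ∀ n : ℕ, (k.factorial : ℂ) *
      ((-2 * Real.pi * Complex.I * (zpt α + (n : ℤ))) ^ (k + 1))⁻¹ = x n := by
    intro n
    have e : -2 * Real.pi * Complex.I * (zpt α + (n : ℤ))
        = 2 * Real.pi * (2 * Real.sin α)⁻¹ * Complex.exp (-(α * Complex.I)) *
          (1 + n * wpt α) := by
      rw [← zpt_eq hs]
      push_cast
      linear_combination (2 * Real.pi * Complex.I * n) * hzw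
    have e2 : Complex.exp (((k + 1 : ℕ) * α : ℝ) * Complex.I)
        = ((Complex.exp (-(α * Complex.I))) ^ (k + 1))⁻¹ := by
      rw [← Complex.exp_nat_mul, ← Complex.exp_neg]
      congr 1
      push_cast; ring
    rw [e, hx]
    simp only
    rw [e2, kap]
    push_cast
    simp only [mul_pow, mul_inv, inv_pow, inv_inv]
    ring
  have hterm' : ∀ n : ℕ, (k.factorial : ℂ) *
      ((-2 * Real.pi * Complex.I * (zpt α + ((-(n + 1) : ℤ) : ℂ))) ^ (k + 1))⁻¹
        = (starRingEnd ℂ) (x n) := by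
    intro n
    rw [← hterm n, map_mul, map_inv₀, map_pow]
    congr 3
    · simp
    · rw [zpt]
      simp only [map_mul, map_add, map_neg, Complex.conj_I, Complex.conj_ofReal, map_intCast,
        map_div₀, map_one, map_ofNat]
      push_cast
      ring
  have hx2 : HasSum (fun n => x n + (starRingEnd ℂ) (x n)) (Lser k (-(rad α : ℂ))) := by
    refine h.congr_fun fun n => ?_
    rw [hterm n, ← hterm' n]
  have hxs : HasSum x ((kap k * (2 * Real.sin α) ^ (k + 1) : ℝ) *
    (Complex.exp (((k + 1 : ℕ) * α : ℝ) * Complex.I) * Jsum k α)) :=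
    (hJ.mul_left _).mul_left _
  have hx3 := hxs.add ((Complex.hasSum_conj' ).mpr hxs)
  rw [hx2.unique hx3, Complex.add_conj, Complex.re_ofReal_mul]
  push_cast; ring

lemma cexp_I_of_sample {s j : ℕ} (hs : s ≠ 0) :
    Complex.exp ((s * (j * Real.pi / s) : ℝ) * Complex.I) = (((-1) ^ j : ℝ) : ℂ) := by
  have hs' : (s : ℝ) ≠ 0 := by exact_mod_cast hs
  have : (s * (j * Real.pi / s) : ℝ) = j * Real.pi := by field_simp
  rw [this]
  push_cast
  rw [mul_assoc, Complex.exp_nat_mul, Complex.exp_pi_mul_I]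

lemma Lser_sample {k : ℕ} (hk : 1 ≤ k) {α : ℝ} (hs : 0 < Real.sin α) (hc : 0 < Real.cos α)
    {j : ℕ} (hα : α = j * Real.pi / (k + 1 : ℕ)) :
    ∃ l : ℝ, Lser k (-(rad α : ℂ)) = l ∧ kap k * (2 * Real.sin α) ^ (k + 1) ≤ (-1) ^ j * l := by
  refine ⟨_, Lser_neg_rad hk hs hc, ?_⟩
  have hJ := (half_le_re_tsum_inv_pow k hk (wpt_re_pos hs)).2
  have e : Complex.exp (((k + 1 : ℕ) * α : ℝ) * Complex.I) = (((-1) ^ j : ℝ) : ℂ) := by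
    rw [hα]; exact cexp_I_of_sample (Nat.succ_ne_zero k)
  rw [e, Complex.re_ofReal_mul]
  have h1 : ((-1 : ℝ) ^ j) * (-1) ^ j = 1 := by rw [← mul_pow]; simp
  have h2 : 0 < kap k * (2 * Real.sin α) ^ (k + 1) := by have := kap_pos k; positivity
  change 1 / 2 ≤ (Jsum k α).re at hJ
  calc kap k * (2 * Real.sin α) ^ (k + 1)
      ≤ 2 * (kap k * (2 * Real.sin α) ^ (k + 1)) * (Jsum k α).re := by nlinarith
    _ = 2 * (kap k * (2 * Real.sin α) ^ (k + 1)) * (Jsum k α).re * (((-1 : ℝ) ^ j) * (-1) ^ j) := by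
        rw [h1, mul_one]
    _ = _ := by ring

lemma hasSum_Dser_sub_Lser (p j : ℕ) (hp : p + j ≠ 0) {q : ℂ} (hq : ‖q‖ < 1) :
    HasSum (fun n : ℕ => ((n : ℂ) + 2) ^ j * Lser (p + j) (q ^ (n + 2)))
      (Dser p j q - Lser (p + j) q) := by
  have h := hasSum_Lser_Dser p j hp hq
  rw [← Equiv.pnatEquivNat.symm.hasSum_iff] at h
  have h2 := (hasSum_nat_add_iff' 1).mpr h
  simp only [Finset.range_one, Finset.sum_singleton, Function.comp_apply,
    Equiv.pnatEquivNat_symm_apply, Nat.succPNat_coe] at h2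
  simp only [Nat.succ_eq_add_one, zero_add, Nat.cast_one, one_pow, one_mul, pow_one] at h2
  refine h2.congr_fun fun n => ?_
  push_cast
  ring

lemma norm_Lser_rad_pow_le {k : ℕ} (hk : 1 ≤ k) {α : ℝ} (hs : 0 < Real.sin α)
    (hc : 0 < Real.cos α) {m : ℕ} (hm : 1 ≤ m) {b : ℤ → ℝ} {B : ℝ}
    (hb : HasSum b B) (hle : ∀ n : ℤ,
      ((√((m * Real.cos α) ^ 2 + (2 * n * Real.sin α) ^ 2)) ^ (k + 1))⁻¹ ≤ b n) :
    ‖Lser k ((rad α : ℂ) ^ m)‖ ≤ kap k * (2 * Real.sin α) ^ (k + 1) * B := by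
  have hm' : (0 : ℝ) < m := by exact_mod_cast hm
  set z : ℂ := ((m * (Real.cos α / (2 * Real.sin α)) : ℝ) : ℂ) * Complex.I with hz
  have hzim : 0 < z.im := by
    rw [hz]; simp only [Complex.mul_im, Complex.ofReal_re, Complex.I_im, Complex.ofReal_im,
      Complex.I_re]
    have : 0 < m * (Real.cos α / (2 * Real.sin α)) := by positivity
    linarith
  have h := hasSum_lipschitz hk hzim
  have e : Complex.exp (2 * Real.pi * Complex.I * z) = (rad α : ℂ) ^ m := by
    rw [rad, Complex.ofReal_exp, ← Complex.exp_nat_mul, hz]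
    congr 1
    have hs' : (Real.sin α : ℂ) ≠ 0 := by exact_mod_cast hs.ne'
    push_cast at hs' ⊢
    field_simp
    ring_nf
    simp only [Complex.I_sq]
    ring
  rw [e] at h
  rw [← h.tsum_eq]
  refine tsum_of_norm_bounded (hb.mul_left _) fun n => ?_
  refine le_trans (le_of_eq ?_) (mul_le_mul_of_nonneg_left (hle n) ?_)
  · have hn : ‖z + n‖ = √((m * Real.cos α) ^ 2 + (2 * n * Real.sin α) ^ 2) / (2 * Real.sin α) := by
      have e1 : z + n = ((n : ℝ) : ℂ) + ((m * (Real.cos α / (2 * Real.sin α)) : ℝ) : ℂ) * Complex.I := by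
        rw [hz]; push_cast; ring
      rw [e1, Complex.norm_add_mul_I, eq_div_iff (by positivity)]
      nth_rw 2 [← Real.sqrt_sq (show 0 ≤ 2 * Real.sin α by positivity)]
      rw [← Real.sqrt_mul (by positivity)]
      congr 1
      field_simp
      ring
    have hpi := Real.pi_pos
    rw [norm_mul, norm_inv, norm_pow, norm_mul, hn, kap]
    have : ‖(-2 * Real.pi * Complex.I : ℂ)‖ = 2 * Real.pi := by
      simp [abs_of_pos hpi]
    rw [this, Complex.norm_natCast, mul_pow, div_pow, mul_inv, inv_div]
    field_simp
  · have := kap_pos k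
    positivity
lemma hasSum_int_inv_sq : HasSum (fun n : ℤ => 1 / (n : ℝ) ^ 2) (Real.pi ^ 2 / 3) := by
  have h1 : HasSum (fun n : ℕ => 1 / (((n : ℤ) : ℝ)) ^ 2) (Real.pi ^ 2 / 6) :=
    hasSum_zeta_two.congr_fun fun n => by rw [Int.cast_natCast]
  have h2 : HasSum (fun n : ℕ => 1 / (((-(n : ℤ) : ℤ)) : ℝ) ^ 2) (Real.pi ^ 2 / 6) :=
    hasSum_zeta_two.congr_fun fun n => by rw [Int.cast_neg, Int.cast_natCast, neg_sq]
  have h3 := HasSum.of_nat_of_neg (f := fun n : ℤ => 1 / (n : ℝ) ^ 2) h1 h2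
  have e : Real.pi ^ 2 / 6 + Real.pi ^ 2 / 6 - 1 / (((0 : ℤ)) : ℝ) ^ 2 = Real.pi ^ 2 / 3 := by
    rw [Int.cast_zero, zero_pow two_ne_zero, div_zero]
    ring
  exact e ▸ h3

lemma hasSum_inv_succ_mul (N : ℕ) :
    HasSum (fun n : ℕ => 1 / (((n : ℝ) + N + 1) * (n + N + 2) * (n + N + 3)))
      (1 / (2 * ((N : ℝ) + 1) * (N + 2))) := by
  set g : ℕ → ℝ := fun i => -(1 / (2 * ((i : ℝ) + N + 1) * (i + N + 2))) with hg
  have h : ∀ n : ℕ, 1 / (((n : ℝ) + N + 1) * (n + N + 2) * (n + N + 3)) = g (n + 1) - g n := by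
    intro n
    simp only [hg]
    push_cast
    have h1 : (n : ℝ) + N + 1 ≠ 0 := by positivity
    have h2 : (n : ℝ) + N + 2 ≠ 0 := by positivity
    have h3 : (n : ℝ) + N + 3 ≠ 0 := by positivity
    have h4 : (n : ℝ) + 1 + N + 1 ≠ 0 := by positivity
    have h5 : (n : ℝ) + 1 + N + 2 ≠ 0 := by positivity
    field_simp
    ring
  rw [hasSum_iff_tendsto_nat_of_nonneg (fun n => by positivity)]
  simp_rw [h, Finset.sum_range_sub]
  have : Tendsto g atTop (𝓝 (-0)) := by
    refine Tendsto.neg ?_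
    refine Tendsto.div_atTop tendsto_const_nhds ?_
    refine Tendsto.atTop_mul_atTop₀ ?_ ?_
    · refine Tendsto.const_mul_atTop two_pos ?_
      exact tendsto_atTop_add_const_right _ _ (tendsto_atTop_add_const_right _ _
        tendsto_natCast_atTop_atTop)
    · exact tendsto_atTop_add_const_right _ _ (tendsto_atTop_add_const_right _ _
        tendsto_natCast_atTop_atTop)
  have h2 := this.sub_const (g 0)
  convert h2 using 2
  simp [hg]

lemma amgm_cube {a b : ℝ} (ha : 0 ≤ a) (hb : 0 ≤ b) : 27 * a ^ 2 * b ≤ 4 * (a + b) ^ 3 := by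
  nlinarith [mul_nonneg (sq_nonneg (a - 2 * b)) (add_nonneg (mul_nonneg (by norm_num : (0:ℝ) ≤ 4) ha) hb)]

lemma norm_Lser_rad_pow_le_of_two_le {k : ℕ} (hk : 6 ≤ k) {α : ℝ} (hs : 0 < Real.sin α)
    (hc : 0 < Real.cos α) {m : ℕ} (hm : 2 ≤ m) :
    ‖Lser k ((rad α : ℂ) ^ m)‖ ≤ kap k * (2 * Real.sin α) ^ (k + 1) *
      (((m * Real.cos α) ^ (k + 1))⁻¹ + (27 * 2 ^ (k - 5) * m ^ 4 *
        (Real.cos α ^ 4 * Real.sin α ^ 2))⁻¹ * (Real.pi ^ 2 / 3)) := by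
  have hm' : (2 : ℝ) ≤ m := by exact_mod_cast hm
  have h1 := hasSum_ite_eq (0 : ℤ) (((m * Real.cos α) ^ (k + 1))⁻¹)
  have h2 := hasSum_int_inv_sq.mul_left
    (27 * 2 ^ (k - 5) * m ^ 4 * (Real.cos α ^ 4 * Real.sin α ^ 2))⁻¹
  refine norm_Lser_rad_pow_le (by omega) hs hc (by omega) (h1.add h2) fun n => ?_
  rcases eq_or_ne n 0 with rfl | hn
  · simp
    rw [Real.sqrt_sq (by positivity)]
  · simp only [hn, if_false, zero_add]
    rw [one_div, ← mul_inv]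
    have hn1 : (1 : ℝ) ≤ (n : ℝ) ^ 2 := by
      have : 1 ≤ n ^ 2 := by
        have := Int.one_le_abs hn
        nlinarith [sq_abs n]
      exact_mod_cast this
    have hsc := Real.sin_sq_add_cos_sq α
    set x := (m * Real.cos α) ^ 2 + (2 * n * Real.sin α) ^ 2 with hx
    have hx4 : 4 ≤ x := by
      have : 4 * Real.cos α ^ 2 ≤ (m * Real.cos α) ^ 2 := by
        rw [mul_pow]; gcongr; nlinarith
      have : 4 * Real.sin α ^ 2 ≤ (2 * n * Real.sin α) ^ 2 := by
        nlinarith [mul_nonneg (sub_nonneg.2 hn1) (sq_nonneg (Real.sin α))]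
      linarith
    have hy : 2 ≤ √x := Real.le_sqrt_of_sq_le (by linarith)
    have hx3 : 27 * m ^ 4 * Real.cos α ^ 4 * Real.sin α ^ 2 * n ^ 2 ≤ x ^ 3 := by
      have := amgm_cube (a := (m * Real.cos α) ^ 2) (b := (2 * n * Real.sin α) ^ 2)
        (by positivity) (by positivity)
      rw [← hx] at this
      nlinarith
    have hn0 : (0 : ℝ) < (n : ℝ) ^ 2 := by linarith
    refine inv_anti₀ (by positivity) ?_
    have e : √x ^ (k + 1) = √x ^ (k - 5) * x ^ 3 := by
      nth_rw 3 [← Real.sq_sqrt (show 0 ≤ x by linarith)]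
      rw [← pow_mul, ← pow_add]; congr 1; omega
    rw [e]
    calc _ = 2 ^ (k - 5) * (27 * m ^ 4 * Real.cos α ^ 4 * Real.sin α ^ 2 * n ^ 2) := by ring
      _ ≤ _ := by gcongr

/-- The tail of the divisor series at radius `rad α`. -/
lemma norm_Dser_sub_Lser_le {k : ℕ} (hk : 6 ≤ k) {α : ℝ} (hs : 0 < Real.sin α)
    (hc : 0 < Real.cos α) {q : ℂ} (hq : ‖q‖ = rad α) :
    ‖Dser (k - 1) 1 q - Lser k q‖ ≤ kap k * (2 * Real.sin α) ^ (k + 1) *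
      (2.4 * ((2 * Real.cos α) ^ (k + 1))⁻¹ +
        0.0306 * (2 ^ (k - 5) * (Real.cos α ^ 4 * Real.sin α ^ 2))⁻¹) := by
  have hq1 : ‖q‖ < 1 := by
    rw [hq, rad, Real.exp_lt_one_iff]
    have := Real.pi_pos
    have : 0 < Real.pi * (Real.cos α / Real.sin α) := by positivity
    linarith
  have h := hasSum_Dser_sub_Lser (k - 1) 1 (by omega) hq1
  rw [show k - 1 + 1 = k by omega] at h
  rw [← h.tsum_eq]
  set P := kap k * (2 * Real.sin α) ^ (k + 1) with hP
  have hP0 : 0 < P := by have := kap_pos k; positivity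
  set U := ((2 * Real.cos α) ^ (k + 1))⁻¹ with hU
  have hU0 : 0 < U := by positivity
  set V := (2 ^ (k - 5) * (Real.cos α ^ 4 * Real.sin α ^ 2))⁻¹ with hV
  have hV0 : 0 < V := by positivity
  have s1 := hasSum_inv_succ_mul 0
  have s2 := hasSum_ite_eq (0 : ℕ) (0.605 : ℝ)
  have hpi : Real.pi ^ 2 / 81 ≤ 0.1224 := by
    have := Real.pi_lt_d4
    nlinarith [Real.pi_pos]
  have hB : HasSum (fun n : ℕ => P * (2 * U * ((if n = 0 then (0.605 : ℝ) else 0) + 64 / 27 *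
      (1 / (((n : ℝ) + (0 : ℕ) + 1) * (n + (0 : ℕ) + 2) * (n + (0 : ℕ) + 3)))) + 0.1224 * V *
      (1 / (((n : ℝ) + (0 : ℕ) + 1) * (n + (0 : ℕ) + 2) * (n + (0 : ℕ) + 3)))))
      _ :=
    (((s2.add (s1.mul_left (64 / 27))).mul_left (2 * U)).add (s1.mul_left (0.1224 * V))).mul_left P
  refine (tsum_of_norm_bounded hB fun n => ?_).trans ?_
  · have hL := norm_Lser_rad_pow_le_of_two_le hk hs hc (m := n + 2) (by omega)
    have hL2 := Lser_norm_le k (q := q ^ (n + 2)) (by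
      rw [norm_pow]; exact pow_lt_one₀ (norm_nonneg _) hq1 (by omega))
    have e : (((‖q ^ (n + 2)‖ : ℝ)) : ℂ) = (rad α : ℂ) ^ (n + 2) := by
      rw [norm_pow, hq]; push_cast; ring
    rw [e] at hL2
    rw [norm_mul, pow_one]
    have en : ‖(n : ℂ) + 2‖ = (n : ℝ) + 2 := by
      have := Complex.norm_natCast (n + 2)
      push_cast at this; exact this
    rw [en]
    have hn0 : (0 : ℝ) ≤ n := n.cast_nonneg
    have hm3 : 1 / ((n : ℝ) + 2) ^ 3 ≤ 1 / (((n : ℝ) + (0 : ℕ) + 1) * (n + (0 : ℕ) + 2) * (n + (0 : ℕ) + 3)) := by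
      push_cast
      refine one_div_le_one_div_of_le (by positivity) ?_
      nlinarith
    set b := 1 / (((n : ℝ) + (0 : ℕ) + 1) * (n + (0 : ℕ) + 2) * (n + (0 : ℕ) + 3)) with hb
    have hfirst : ((n : ℝ) + 2) * ((((n : ℝ) + 2) * Real.cos α) ^ (k + 1))⁻¹
        ≤ 2 * U * ((if n = 0 then (0.605 : ℝ) else 0) + 64 / 27 * b) := by
      have e1 : ((n : ℝ) + 2) * ((((n : ℝ) + 2) * Real.cos α) ^ (k + 1))⁻¹
          = 2 * U * (2 / ((n : ℝ) + 2)) ^ k := by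
        rw [hU]
        simp only [mul_pow, div_pow, pow_succ]
        field_simp
      rw [e1]
      refine mul_le_mul_of_nonneg_left ?_ (by positivity)
      rcases Nat.eq_zero_or_pos n with rfl | hn
      · simp [hb]; norm_num
      · have hn1 : (1 : ℝ) ≤ n := by exact_mod_cast hn
        rw [if_neg (by omega), zero_add]
        calc (2 / ((n : ℝ) + 2)) ^ k ≤ (2 / ((n : ℝ) + 2)) ^ 6 := by
              refine pow_le_pow_of_le_one (by positivity) ?_ hk
              rw [div_le_one (by positivity)]; linarith
          _ = (4 / ((n : ℝ) + 2)) ^ 3 * (1 / ((n : ℝ) + 2) ^ 3) := by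
              field_simp; norm_num
          _ ≤ 64 / 27 * b := by
              gcongr
              calc (4 / ((n : ℝ) + 2)) ^ 3 ≤ (4 / 3) ^ 3 := by gcongr; linarith
                _ = 64 / 27 := by norm_num
    have hsecond : ((n : ℝ) + 2) * ((27 * 2 ^ (k - 5) * ((n : ℝ) + 2) ^ 4 *
        (Real.cos α ^ 4 * Real.sin α ^ 2))⁻¹ * (Real.pi ^ 2 / 3)) ≤ 0.1224 * V * b := by
      have e1 : ((n : ℝ) + 2) * ((27 * 2 ^ (k - 5) * ((n : ℝ) + 2) ^ 4 *
        (Real.cos α ^ 4 * Real.sin α ^ 2))⁻¹ * (Real.pi ^ 2 / 3))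
          = (Real.pi ^ 2 / 81) * V * (1 / ((n : ℝ) + 2) ^ 3) := by
        rw [hV]
        field_simp
        norm_num
      rw [e1]
      gcongr
    push_cast at hL
    calc _ ≤ ((n : ℝ) + 2) * _ := mul_le_mul_of_nonneg_left (hL2.trans hL) (by positivity)
      _ = P * (((n : ℝ) + 2) * ((((n : ℝ) + 2) * Real.cos α) ^ (k + 1))⁻¹ + ((n : ℝ) + 2) * ((27 * 2 ^ (k - 5) * ((n : ℝ) + 2) ^ 4 *
        (Real.cos α ^ 4 * Real.sin α ^ 2))⁻¹ * (Real.pi ^ 2 / 3))) := by rw [hP]; ring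
      _ ≤ _ := by gcongr
  · refine mul_le_mul_of_nonneg_left ?_ hP0.le
    push_cast
    nlinarith

lemma one_add_pow_ge_sq {w : ℝ} (hw : 0 ≤ w) (n : ℕ) :
    1 + n * w + n * (n - 1) / 2 * w ^ 2 ≤ (1 + w) ^ n := by
  induction n with
  | zero => simp
  | succ n ih =>
    rw [pow_succ]
    have h := mul_le_mul_of_nonneg_right ih (by linarith : 0 ≤ 1 + w)
    refine le_trans ?_ h
    push_cast
    have : 0 ≤ (n : ℝ) * (n - 1) / 2 * w ^ 3 := by
      rcases Nat.eq_zero_or_pos n with rfl | hn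
      · simp
      · have : (1 : ℝ) ≤ n := by exact_mod_cast hn
        have : 0 ≤ (n : ℝ) - 1 := by linarith
        positivity
    nlinarith

lemma two_cos_ge {δ : ℝ} (h0 : 0 < δ) (h1 : δ ≤ 0.15) :
    1 + 1.64 * δ ≤ 2 * Real.cos (Real.pi / 3 - δ) := by
  rw [Real.cos_sub, Real.cos_pi_div_three, Real.sin_pi_div_three]
  have hc := Real.one_sub_sq_div_two_le_cos (x := δ)
  have hs := Real.sin_gt_sub_cube h0
  have h3 : (1.732 : ℝ) ≤ √3 := Real.le_sqrt_of_sq_le (by norm_num)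
  have h4 : 1.732 * (δ - δ ^ 3 / 6) ≤ √3 * Real.sin δ :=
    mul_le_mul h3 hs.le (by nlinarith [mul_nonneg h0.le (by nlinarith : 0 ≤ 1 - δ ^ 2 / 6)]) (by positivity)
  have : 1.732 * δ ^ 3 / 6 ≤ 0.01 * δ := by
    have : δ ^ 2 ≤ 0.0225 := by nlinarith
    nlinarith [mul_le_mul_of_nonneg_left this h0.le]
  nlinarith [mul_le_mul_of_nonneg_left h1 h0.le]

lemma sq_le_two_pow {k : ℕ} (hk : 6 ≤ k) : 2 * ((k : ℝ) + 1) ^ 2 ≤ 49 * 2 ^ (k - 5) := by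
  induction k, hk using Nat.le_induction with
  | base => norm_num
  | succ n hn ih =>
    rw [show n + 1 - 5 = (n - 5) + 1 by omega, pow_succ 2 (n - 5)]
    have : (6 : ℝ) ≤ n := by exact_mod_cast hn
    push_cast
    nlinarith

lemma norm_Dser_sub_Lser_lt_of_le {k : ℕ} (hk : 6 ≤ k) {α : ℝ} (h0 : 0 < α) (h1 : α ≤ Real.pi / 4)
    (hs : 2.9 / ((k : ℝ) + 1) ≤ Real.sin α) {q : ℂ} (hq : ‖q‖ = rad α) :
    ‖Dser (k - 1) 1 q - Lser k q‖ < kap k * (2 * Real.sin α) ^ (k + 1) := by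
  have hpi := Real.pi_pos
  have hsp : 0 < Real.sin α := Real.sin_pos_of_pos_of_lt_pi h0 (by linarith)
  have hc : √2 / 2 ≤ Real.cos α := by
    rw [← Real.cos_pi_div_four]
    exact Real.cos_le_cos_of_nonneg_of_le_pi h0.le (by linarith) h1
  have h2 : (1.414 : ℝ) ≤ √2 := Real.le_sqrt_of_sq_le (by norm_num)
  have hcp : 0 < Real.cos α := by linarith
  refine (norm_Dser_sub_Lser_le hk hsp hcp hq).trans_lt ?_
  have hP : 0 < kap k * (2 * Real.sin α) ^ (k + 1) := by have := kap_pos k; positivity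
  refine mul_lt_of_lt_one_right hP ?_
  have b1 : ((2 * Real.cos α) ^ (k + 1))⁻¹ ≤ (11 : ℝ)⁻¹ := by
    refine inv_anti₀ (by norm_num) ?_
    calc (11 : ℝ) ≤ 1.414 ^ 7 := by norm_num
      _ ≤ (2 * Real.cos α) ^ 7 := by gcongr; linarith
      _ ≤ (2 * Real.cos α) ^ (k + 1) := pow_le_pow_right₀ (by linarith) (by omega)
  have b2 : (2 ^ (k - 5) * (Real.cos α ^ 4 * Real.sin α ^ 2))⁻¹ ≤ (0.085 : ℝ)⁻¹ := by
    refine inv_anti₀ (by norm_num) ?_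
    have hk1 : (0 : ℝ) < (k : ℝ) + 1 := by positivity
    have c4 : 1 / 4 ≤ Real.cos α ^ 4 := by
      have : 1 / 2 ≤ Real.cos α ^ 2 := by
        have := Real.sq_sqrt (show (0 : ℝ) ≤ 2 by norm_num)
        nlinarith
      nlinarith
    calc (0.085 : ℝ) ≤ (2 * ((k : ℝ) + 1) ^ 2 / 49) * (1 / 4 * (2.9 / ((k : ℝ) + 1)) ^ 2) := by
          field_simp; norm_num
      _ ≤ _ := by
          gcongr
          have := sq_le_two_pow hk
          linarith
  have : (11 : ℝ)⁻¹ < 0.091 := by norm_num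
  have : (0.085 : ℝ)⁻¹ < 12 := by norm_num
  nlinarith

lemma norm_Dser_sub_Lser_lt_of_ge {k : ℕ} (hk : 6 ≤ k) {α : ℝ} (h0 : Real.pi / 4 ≤ α)
    (h1 : α ≤ Real.pi / 3 - Real.pi / (3 * ((k : ℝ) + 1))) {q : ℂ} (hq : ‖q‖ = rad α) :
    ‖Dser (k - 1) 1 q - Lser k q‖ < kap k * (2 * Real.sin α) ^ (k + 1) := by
  have hpi := Real.pi_pos
  have hpi3 := Real.pi_gt_d2
  have hpi4 := Real.pi_lt_d2
  have hk6 : (6 : ℝ) ≤ k := by exact_mod_cast hk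
  set δ := Real.pi / (3 * ((k : ℝ) + 1)) with hδ
  have hδ0 : 0 < δ := by positivity
  have hδs : ((k : ℝ) + 1) * δ = Real.pi / 3 := by rw [hδ]; field_simp
  have hδ1 : δ ≤ 0.15 := by
    nlinarith
  have hsp : 0 < Real.sin α := Real.sin_pos_of_pos_of_lt_pi (by linarith) (by linarith)
  have hc2 : 1 + 1.64 * δ ≤ 2 * Real.cos α := by
    refine (two_cos_ge hδ0 hδ1).trans ?_
    have := Real.cos_le_cos_of_nonneg_of_le_pi (x := α) (y := Real.pi / 3 - δ) (by linarith)
      (by linarith) h1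
    linarith
  have hcu : Real.cos α ≤ √2 / 2 := by
    rw [← Real.cos_pi_div_four]
    exact Real.cos_le_cos_of_nonneg_of_le_pi (by positivity) (by linarith) h0
  have hcp : 0 < Real.cos α := by linarith
  refine (norm_Dser_sub_Lser_le hk hsp hcp hq).trans_lt ?_
  have hP : 0 < kap k * (2 * Real.sin α) ^ (k + 1) := by have := kap_pos k; positivity
  refine mul_lt_of_lt_one_right hP ?_
  have b1 : ((2 * Real.cos α) ^ (k + 1))⁻¹ ≤ (3.9 : ℝ)⁻¹ := by
    refine inv_anti₀ (by norm_num) ?_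
    have hB := one_add_pow_ge_sq (w := 1.64 * δ) (by positivity) (k + 1)
    push_cast at hB
    have hw : 1.71 ≤ ((k : ℝ) + 1) * (1.64 * δ) := by nlinarith
    have hw2 : 2.92 ≤ (((k : ℝ) + 1) * (1.64 * δ)) ^ 2 := by nlinarith
    have e : ((k : ℝ) + 1) * ((k : ℝ) + 1 - 1) / 2 * (1.64 * δ) ^ 2
      = (k / ((k : ℝ) + 1)) / 2 * (((k : ℝ) + 1) * (1.64 * δ)) ^ 2 := by
      field_simp; ring
    have hk7 : 6 / 7 ≤ k / ((k : ℝ) + 1) := by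
      rw [div_le_div_iff₀ (by norm_num) (by positivity)]; linarith
    have : 6 / 7 / 2 * 2.92 ≤ (k / ((k : ℝ) + 1)) / 2 * (((k : ℝ) + 1) * (1.64 * δ)) ^ 2 := by
      gcongr
    calc (3.9 : ℝ) ≤ (1 + 1.64 * δ) ^ (k + 1) := by
          refine le_trans ?_ hB
          rw [e]
          linarith
      _ ≤ _ := by gcongr
  have b2 : (2 ^ (k - 5) * (Real.cos α ^ 4 * Real.sin α ^ 2))⁻¹ ≤ (3 / 32 : ℝ)⁻¹ := by
    refine inv_anti₀ (by norm_num) ?_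
    have hA1 : 1 / 4 ≤ Real.cos α ^ 2 := by nlinarith
    have hA2 : Real.cos α ^ 2 ≤ 1 / 2 := by
      have := Real.sq_sqrt (show (0 : ℝ) ≤ 2 by norm_num)
      nlinarith
    have hB : Real.sin α ^ 2 = 1 - Real.cos α ^ 2 := Real.sin_sq α
    have e4 : Real.cos α ^ 4 = (Real.cos α ^ 2) ^ 2 := by ring
    have : 3 / 64 ≤ Real.cos α ^ 4 * Real.sin α ^ 2 := by
      rw [hB, e4]
      set A := Real.cos α ^ 2
      nlinarith [mul_nonneg (sub_nonneg.2 hA1) (sub_nonneg.2 hA2),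
        mul_nonneg (mul_nonneg (sub_nonneg.2 hA1) (sub_nonneg.2 hA2)) (by linarith : 0 ≤ A)]
    calc (3 / 32 : ℝ) = 2 ^ 1 * (3 / 64) := by norm_num
      _ ≤ _ := by
        gcongr
        · norm_num
        · omega
  have : (3.9 : ℝ)⁻¹ < 0.257 := by norm_num
  have : (3 / 32 : ℝ)⁻¹ < 10.67 := by norm_num
  nlinarith

lemma Dser_ofReal_im (p j : ℕ) (x : ℝ) : (Dser p j (x : ℂ)).im = 0 := by
  have : Dser p j (x : ℂ) = ((∑' n : ℕ, (n : ℝ) ^ j * (∑ d ∈ n.divisors, (d : ℝ) ^ p) * x ^ n : ℝ) : ℂ) := by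
    rw [Complex.ofReal_tsum, Dser, pser]
    refine tsum_congr fun n => ?_
    rw [divSum]
    push_cast
    rfl
  rw [this, Complex.ofReal_im]

/-- The derivative of the Eisenstein series at `1/2 + i cot α / 2`, up to a nonzero factor. -/
noncomputable def gR (k : ℕ) (α : ℝ) : ℝ := (Dser (k - 1) 1 (-(rad α : ℂ))).re

lemma Dser_neg_rad (k : ℕ) (α : ℝ) : Dser (k - 1) 1 (-(rad α : ℂ)) = (gR k α : ℂ) := by
  have := Dser_ofReal_im (k - 1) 1 (-rad α)
  push_cast at this
  exact Complex.ext (by rw [gR, Complex.ofReal_re]) (by rw [this, Complex.ofReal_im])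

lemma rad_pos (α : ℝ) : 0 < rad α := Real.exp_pos _

lemma rad_lt_one {α : ℝ} (h0 : 0 < α) (h1 : α < Real.pi / 2) : rad α < 1 := by
  rw [rad, Real.exp_lt_one_iff]
  have hs := Real.sin_pos_of_pos_of_lt_pi h0 (by linarith [Real.pi_pos])
  have hc := Real.cos_pos_of_mem_Ioo ⟨by linarith [Real.pi_pos], h1⟩
  have := Real.pi_pos
  have : 0 < Real.pi * (Real.cos α / Real.sin α) := by positivity
  linarith

lemma rad_lt_rad {α β : ℝ} (h0 : 0 < α) (hab : α < β) (h1 : β < Real.pi / 2) : rad α < rad β := by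
  rw [rad, rad, Real.exp_lt_exp]
  have hp := Real.pi_pos
  have hs := Real.sin_pos_of_pos_of_lt_pi h0 (by linarith)
  have hs' := Real.sin_pos_of_pos_of_lt_pi (h0.trans hab) (by linarith)
  refine neg_lt_neg (mul_lt_mul_of_pos_left ?_ hp)
  rw [div_lt_div_iff₀ hs' hs]
  have : 0 < Real.sin (β - α) := Real.sin_pos_of_pos_of_lt_pi (by linarith) (by linarith)
  rw [Real.sin_sub] at this
  linarith

lemma continuousOn_gR (k : ℕ) : ContinuousOn (gR k) (Set.Ioo 0 (Real.pi / 2)) := by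
  have h1 : ContinuousOn (Dser (k - 1) 1) (Metric.ball 0 1) :=
    (polyGrowth_Dser (k - 1) 1).differentiableOn.continuousOn
  refine Complex.continuous_re.comp_continuousOn (h1.comp ?_ ?_)
  · have : ContinuousOn rad (Set.Ioo 0 (Real.pi / 2)) := by
      unfold rad
      refine Real.continuous_exp.comp_continuousOn (ContinuousOn.neg (continuousOn_const.mul
        (Real.continuous_cos.continuousOn.div Real.continuous_sin.continuousOn fun x hx => ?_)))
      exact (Real.sin_pos_of_pos_of_lt_pi hx.1 (by linarith [hx.2, Real.pi_pos])).ne'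
    exact (Complex.continuous_ofReal.comp_continuousOn this).neg
  · intro x hx
    have := rad_lt_one hx.1 hx.2
    rw [mem_ball_zero_iff, norm_neg, Complex.norm_real, Real.norm_of_nonneg (rad_pos x).le]
    exact this

/-- The sample points `jπ/(k+1)`. -/
noncomputable def samp (k j : ℕ) : ℝ := j * Real.pi / (k + 1 : ℕ)

lemma samp_pos {k j : ℕ} (hj : 1 ≤ j) : 0 < samp k j := by
  have : (0 : ℝ) < j := by exact_mod_cast hj
  have := Real.pi_pos
  unfold samp; positivity

lemma samp_lt_samp (k : ℕ) {i j : ℕ} (h : i < j) : samp k i < samp k j := by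
  have : (i : ℝ) < j := by exact_mod_cast h
  have := Real.pi_pos
  unfold samp
  gcongr

lemma samp_lt_pi_div_two {k j : ℕ} (h : 2 * j ≤ k) : samp k j < Real.pi / 2 := by
  have : 2 * (j : ℝ) ≤ k := by exact_mod_cast h
  have := Real.pi_pos
  unfold samp
  rw [div_lt_div_iff₀ (by positivity) (by norm_num)]
  push_cast
  nlinarith

lemma samp_sin_pos {k j : ℕ} (hj : 1 ≤ j) (h : 2 * j ≤ k) : 0 < Real.sin (samp k j) :=
  Real.sin_pos_of_pos_of_lt_pi (samp_pos hj) (by linarith [samp_lt_pi_div_two h, Real.pi_pos])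

lemma samp_cos_pos {k j : ℕ} (h : 2 * j ≤ k) : 0 < Real.cos (samp k j) := by
  have : 0 ≤ samp k j := by have := Real.pi_pos; unfold samp; positivity
  exact Real.cos_pos_of_mem_Ioo ⟨by linarith [Real.pi_pos], samp_lt_pi_div_two h⟩

lemma norm_Dser_sub_Lser_lt_samp {k j : ℕ} (hk : 6 ≤ k) (hj : 1 ≤ j) (h : 3 * j ≤ k) {q : ℂ}
    (hq : ‖q‖ = rad (samp k j)) :
    ‖Dser (k - 1) 1 q - Lser k q‖ < kap k * (2 * Real.sin (samp k j)) ^ (k + 1) := by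
  have hp := Real.pi_pos
  have hk6 : (6 : ℝ) ≤ k := by exact_mod_cast hk
  rcases le_total (samp k j) (Real.pi / 4) with h4 | h4
  · refine norm_Dser_sub_Lser_lt_of_le hk (samp_pos hj) h4 ?_ hq
    have h1 : samp k 1 ≤ samp k j := by
      rcases hj.eq_or_lt with rfl | hj
      · rfl
      · exact (samp_lt_samp k hj).le
    have h2 : Real.sin (samp k 1) ≤ Real.sin (samp k j) :=
      Real.sin_le_sin_of_le_of_le_pi_div_two (by linarith [samp_pos (k := k) le_rfl])
        (by linarith) h1
    refine le_trans ?_ h2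
    have h3 := Real.sin_gt_sub_cube (samp_pos (k := k) le_rfl)
    refine le_trans ?_ h3.le
    have e : samp k 1 = Real.pi / ((k : ℝ) + 1) := by rw [samp]; push_cast; ring
    set x := samp k 1
    have hx0 : 0 < x := samp_pos le_rfl
    have hx : x ≤ 0.45 := by
      rw [e, div_le_iff₀ (by positivity)]
      nlinarith [Real.pi_lt_d2]
    have e2 : 2.9 / ((k : ℝ) + 1) = 2.9 / Real.pi * x := by rw [e]; field_simp
    have : 2.9 / Real.pi ≤ 0.9236 := by
      rw [div_le_iff₀ hp]; nlinarith [Real.pi_gt_d2]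
    rw [e2]
    nlinarith [mul_le_mul_of_nonneg_right this hx0.le, mul_le_mul hx hx hx0.le (by norm_num),
      mul_nonneg hx0.le (sub_nonneg.2 (mul_le_mul hx hx hx0.le (by norm_num)))]
  · refine norm_Dser_sub_Lser_lt_of_ge hk h4 ?_ hq
    have : 3 * (j : ℝ) ≤ k := by exact_mod_cast h
    rw [samp]
    push_cast
    rw [div_sub_div _ _ (by norm_num) (by positivity), div_le_div_iff₀ (by positivity) (by positivity)]
    nlinarith [mul_nonneg (sub_nonneg.2 this) (mul_nonneg hp.le (sq_nonneg ((k : ℝ) + 1)))]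

lemma gR_samp_sign {k j : ℕ} (hk : 6 ≤ k) (hj : 1 ≤ j) (h : 3 * j ≤ k) :
    0 < (-1) ^ j * gR k (samp k j) := by
  have h2 : 2 * j ≤ k := by omega
  obtain ⟨l, hl, hlb⟩ := Lser_sample (k := k) (by omega) (samp_sin_pos hj h2) (samp_cos_pos h2)
    (j := j) rfl
  have hn : ‖(-(rad (samp k j)) : ℂ)‖ = rad (samp k j) := by
    rw [norm_neg, Complex.norm_real, Real.norm_of_nonneg (rad_pos _).le]
  have herr := norm_Dser_sub_Lser_lt_samp hk hj h hn
  rw [hl, Dser_neg_rad, ← Complex.ofReal_sub, Complex.norm_real, Real.norm_eq_abs] at herr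
  have e : |(-1) ^ j * (gR k (samp k j) - l)| = |gR k (samp k j) - l| := by
    rw [abs_mul, abs_pow, abs_neg, abs_one, one_pow, one_mul]
  rw [← e] at herr
  have h3 := (abs_lt.1 herr).1
  linarith

lemma exists_Qpoly_prod {k : ℕ} (hk : Even k) (hk6 : 6 ≤ k) : ∃ R : Finset ℝ, R.card = k + 1 ∧
    (∀ y ∈ R, |y| ≤ 1) ∧ (∀ j, 1 ≤ j → 2 * j ≤ k → (R.filter (fun y =>
      (1 - rad (samp k j)) / (1 + rad (samp k j)) < y)).card ≤ j) ∧
      ∃ c, Qpoly k = C c * ∏ y ∈ R, (X - C y) := by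
  obtain ⟨n, hn⟩ := hk
  have hr1 : ∀ j, 1 ≤ j → 2 * j ≤ k → rad (samp k j) < 1 := fun j h1 h2 =>
    rad_lt_one (samp_pos h1) (samp_lt_pi_div_two h2)
  have H := Qpoly_eq_prod (k := k) (n := n) (by omega) (by omega)
    (fun j => (1 - rad (samp k j)) / (1 + rad (samp k j)))
  refine Exists.imp (fun R hR => ⟨hR.1, hR.2.1, fun j hj hj' => hR.2.2.1 j hj (by omega),
    hR.2.2.2⟩) (H ?_ ?_ ?_ ?_)
  · intro i j hi hij hj
    have := rad_lt_rad (samp_pos hi) (samp_lt_samp k hij) (samp_lt_pi_div_two (by omega))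
    have := rad_pos (samp k i)
    have := rad_pos (samp k j)
    rw [div_lt_div_iff₀ (by positivity) (by positivity)]
    nlinarith
  · intro j hj hj'
    have := hr1 j hj (by omega)
    have := rad_pos (samp k j)
    exact div_pos (by linarith) (by linarith)
  · intro j hj hj'
    have := rad_pos (samp k j)
    rw [div_lt_one (by linarith)]
    linarith
  · intro j hj hj'
    have hj2 : 2 * j ≤ k := by omega
    have hs := samp_sin_pos hj hj2
    obtain ⟨l, hl, hlb⟩ := Lser_sample (k := k) (by omega) hs (samp_cos_pos hj2) (j := j) rfl
    have hq : ‖(-(rad (samp k j)) : ℂ)‖ < 1 := by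
      rw [norm_neg, Complex.norm_real, Real.norm_of_nonneg (rad_pos _).le]
      exact hr1 j hj hj2
    rw [Lser_eq_Qpoly k hq] at hl
    have e : (1 + -(rad (samp k j) : ℂ)) / (1 - -(rad (samp k j) : ℂ))
        = (((1 - rad (samp k j)) / (1 + rad (samp k j)) : ℝ) : ℂ) := by
      push_cast; ring
    rw [e] at hl
    have e2 : (Qpoly k).eval ((1 - rad (samp k j)) / (1 + rad (samp k j))) = l := by
      have h3 : (aeval (((1 - rad (samp k j)) / (1 + rad (samp k j)) : ℝ) : ℂ)) (Qpoly k)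
        = (((Qpoly k).eval ((1 - rad (samp k j)) / (1 + rad (samp k j))) : ℝ) : ℂ) := by
        rw [show (((1 - rad (samp k j)) / (1 + rad (samp k j)) : ℝ) : ℂ)
          = algebraMap ℝ ℂ ((1 - rad (samp k j)) / (1 + rad (samp k j))) from rfl,
          aeval_algebraMap_apply, coe_aeval_eq_eval]
        rfl
      rw [h3] at hl
      exact_mod_cast hl
    rw [e2]
    refine lt_of_lt_of_le ?_ hlb
    have := kap_pos k
    positivity

lemma card_zeros_le_samp {k j : ℕ} (hk : Even k) (hk6 : 6 ≤ k) (hj : 1 ≤ j) (h : 3 * j ≤ k)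
    (Z : Finset ℝ) (hZ : ∀ α ∈ Z, 0 < α ∧ α < samp k j ∧ gR k α = 0) : Z.card + 1 ≤ j := by
  obtain ⟨R, hR, hR1, hRf, c, hQ⟩ := exists_Qpoly_prod hk hk6
  have h2 : 2 * j ≤ k := by omega
  have hlt2 := samp_lt_pi_div_two h2
  set r := rad (samp k j) with hr
  have hr0 : 0 < r := rad_pos _
  have hr1 : r < 1 := rad_lt_one (samp_pos hj) hlt2
  have hs := samp_sin_pos hj h2
  obtain ⟨l, hl, hlb⟩ := Lser_sample (k := k) (by omega) hs (samp_cos_pos h2) (j := j) rfl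
  have hP : 0 < kap k * (2 * Real.sin (samp k j)) ^ (k + 1) := by
    have := kap_pos k
    positivity
  have hlabs : kap k * (2 * Real.sin (samp k j)) ^ (k + 1) ≤ ‖Lser k (-(r : ℂ))‖ := by
    rw [hl, Complex.norm_real, Real.norm_eq_abs]
    refine hlb.trans ((le_abs_self _).trans (le_of_eq ?_))
    rw [abs_mul, abs_pow, abs_neg, abs_one, one_pow, one_mul]
  have hL0 : Lser k (-(r : ℂ)) ≠ 0 := norm_pos_iff.1 (hP.trans_le hlabs)
  obtain ⟨A, v, hA, hv, hv0, hLA⟩ := exists_Lser_factor hR hR1 hQ hr0 hr1 hL0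
  have hinj : Set.InjOn (fun α => -rad α) (Z : Set ℝ) := by
    intro x hx y hy hxy
    have hx' := hZ x hx
    have hy' := hZ y hy
    have hxy' : rad x = rad y := neg_injective hxy
    rcases lt_trichotomy x y with hlt | heq | hlt
    · exact absurd hxy' (rad_lt_rad hx'.1 hlt (by linarith)).ne
    · exact heq
    · exact absurd hxy' (rad_lt_rad hy'.1 hlt (by linarith)).ne'
  have h0 : (0 : ℝ) ∉ Z.image (fun α => -rad α) := by
    intro h0
    obtain ⟨x, -, hx⟩ := Finset.mem_image.1 h0
    have := rad_pos x
    linarith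
  have hcard := card_zeros_le_of_norm_sub_lt (g := Dser (k - 1) 1) (v := v) hr0 hr1
    (polyGrowth_Dser (k - 1) 1).differentiableOn hv hv0 A
    (insert 0 (Z.image (fun α => -rad α))) ?_ ?_ ?_
  · rw [Finset.card_insert_of_notMem h0, Finset.card_image_of_injOn hinj] at hcard
    exact hcard.trans (hA.trans (hRf j hj h2))
  · intro z hz
    rcases Finset.mem_insert.1 hz with rfl | hz
    · simpa using hr0
    · obtain ⟨x, hx, rfl⟩ := Finset.mem_image.1 hz
      have hx' := hZ x hx
      rw [abs_neg, abs_of_pos (rad_pos x)]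
      exact rad_lt_rad hx'.1 hx'.2.1 hlt2
  · intro z hz
    rcases Finset.mem_insert.1 hz with rfl | hz
    · rw [Dser, pser]
      have : ∀ n : ℕ, (n : ℂ) ^ 1 * divSum (k - 1) n * ((0 : ℝ) : ℂ) ^ n = 0 := by
        intro n
        rcases eq_or_ne n 0 with rfl | hn
        · simp
        · simp [hn]
      simp_rw [this]
      exact tsum_zero
    · obtain ⟨x, hx, rfl⟩ := Finset.mem_image.1 hz
      push_cast
      rw [Dser_neg_rad, (hZ x hx).2.2, Complex.ofReal_zero]
  · intro q hq
    have hq1 : ‖q‖ < 1 := hq ▸ hr1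
    rw [← hLA q hq1]
    exact (norm_Dser_sub_Lser_lt_samp hk6 hj h hq).trans_le
      (hlabs.trans (norm_Lser_neg_le hR hR1 hQ hr0.le hr1 hq))

lemma exists_gR_eq_zero {k : ℕ} {a b : ℝ} (ha : 0 < a) (hab : a < b) (hb : b < Real.pi / 2)
    (h : gR k a * gR k b < 0) : ∃ c, a < c ∧ c < b ∧ gR k c = 0 := by
  have hcont : ContinuousOn (gR k) (Set.Icc a b) := (continuousOn_gR k).mono fun x hx =>
    ⟨ha.trans_le hx.1, hx.2.trans_lt hb⟩
  rcases lt_trichotomy (gR k a) 0 with h1 | h1 | h1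
  · have h2 : 0 < gR k b := by nlinarith
    obtain ⟨c, hc, hc0⟩ := intermediate_value_Ioo hab.le hcont ⟨h1, h2⟩
    exact ⟨c, hc.1, hc.2, hc0⟩
  · rw [h1, zero_mul] at h; exact absurd h (lt_irrefl _)
  · have h2 : gR k b < 0 := by nlinarith
    obtain ⟨c, hc, hc0⟩ := intermediate_value_Ioo' hab.le hcont ⟨h2, h1⟩
    exact ⟨c, hc.1, hc.2, hc0⟩

/-- The zeros of `gR k` in `(0, a)`. -/
def Zset (k : ℕ) (a : ℝ) : Set ℝ := {α | 0 < α ∧ α < a ∧ gR k α = 0}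

lemma Zset_mono (k : ℕ) {a b : ℝ} (h : a ≤ b) : Zset k a ⊆ Zset k b :=
  fun _ hx => ⟨hx.1, hx.2.1.trans_le h, hx.2.2⟩

lemma finite_and_ncard_le_of_forall_finset {s : Set ℝ} {n : ℕ}
    (h : ∀ Z : Finset ℝ, (Z : Set ℝ) ⊆ s → Z.card ≤ n) : s.Finite ∧ s.ncard ≤ n := by
  have hf : s.Finite := by
    by_contra hs
    obtain ⟨t, ht, htc⟩ := Set.Infinite.exists_subset_card_eq hs (n + 1)
    have := h t ht
    omega
  refine ⟨hf, ?_⟩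
  rw [Set.ncard_eq_toFinset_card s hf]
  exact h _ (by simp)

lemma ncard_Zset_lt {k : ℕ} {a b c : ℝ} (hf : (Zset k b).Finite) (hab : a ≤ c) (hcb : c < b)
    (h0 : 0 < c) (hc : gR k c = 0) : (Zset k a).ncard < (Zset k b).ncard := by
  refine Set.ncard_lt_ncard ?_ hf
  refine ⟨Zset_mono k (hab.trans hcb.le), fun hsub => ?_⟩
  exact absurd (hsub ⟨h0, hcb, hc⟩).2.1 (not_lt.2 hab)

lemma Zset_samp {k j : ℕ} (hk : Even k) (hk6 : 6 ≤ k) (hj : 1 ≤ j) (h : 3 * j ≤ k) :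
    (Zset k (samp k j)).Finite ∧ (Zset k (samp k j)).ncard + 1 = j := by
  have hup : ∀ i, 1 ≤ i → 3 * i ≤ k →
      (Zset k (samp k i)).Finite ∧ (Zset k (samp k i)).ncard ≤ i - 1 := fun i hi hi' =>
    finite_and_ncard_le_of_forall_finset fun Z hZ => by
      have := card_zeros_le_samp hk hk6 hi hi' Z fun α hα => hZ hα
      omega
  refine ⟨(hup j hj h).1, ?_⟩
  have hge : j ≤ (Zset k (samp k j)).ncard + 1 := by
    induction j, hj using Nat.le_induction with
    | base => omega
    | succ j hj ih =>
      have ih := ih (by omega)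
      have s1 := gR_samp_sign hk6 hj (by omega : 3 * j ≤ k)
      have s2 := gR_samp_sign hk6 (by omega) h
      have hj1 := samp_lt_samp k (Nat.lt_succ_self j)
      have hp : gR k (samp k j) * gR k (samp k (j + 1)) < 0 := by
        have := mul_pos s1 s2
        rw [pow_succ] at this
        have e : ((-1 : ℝ) ^ j) * (-1) ^ j = 1 := by rw [← mul_pow]; norm_num
        nlinarith
      obtain ⟨c, hc1, hc2, hc3⟩ := exists_gR_eq_zero (samp_pos hj) hj1
        (samp_lt_pi_div_two (by omega)) hp
      have := ncard_Zset_lt (hup (j + 1) (by omega) h).1 hc1.le hc2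
        ((samp_pos hj).trans hc1) hc3
      omega
  have := (hup j hj h).2
  omega

/-- Adjacent sample points enclose exactly one zero. -/
lemma Zset_between {k j : ℕ} {b : ℝ} (hk : Even k) (hk6 : 6 ≤ k) (hj : 1 ≤ j) (h : 3 * (j + 1) ≤ k)
    (hb : samp k j < b) (hb' : b < samp k (j + 1)) (hs : 0 < (-1) ^ j * gR k b) :
    (Zset k b).Finite ∧ (Zset k b).ncard + 1 = j := by
  obtain ⟨f1, c1⟩ := Zset_samp hk hk6 hj (by omega)
  obtain ⟨f2, c2⟩ := Zset_samp hk hk6 (by omega) h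
  have hlt := samp_lt_pi_div_two (k := k) (j := j + 1) (by omega)
  have s2 := gR_samp_sign hk6 (by omega) h
  have hp : gR k b * gR k (samp k (j + 1)) < 0 := by
    have := mul_pos hs s2
    rw [pow_succ] at this
    have e : ((-1 : ℝ) ^ j) * (-1) ^ j = 1 := by rw [← mul_pow]; norm_num
    nlinarith
  have hb0 := (samp_pos hj).trans hb
  obtain ⟨c, hc1, hc2, hc3⟩ := exists_gR_eq_zero hb0 hb' hlt hp
  have h1 := ncard_Zset_lt f2 hc1.le hc2 (hb0.trans hc1) hc3
  have f3 := f2.subset (Zset_mono k hb'.le)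
  have h2 := Set.ncard_le_ncard (Zset_mono k hb.le) f3
  exact ⟨f3, by omega⟩

lemma Zset_between_of_eq_zero {k j : ℕ} {b : ℝ} (hk : Even k) (hk6 : 6 ≤ k) (hj : 1 ≤ j)
    (h : 3 * (j + 1) ≤ k) (hb : samp k j < b) (hb' : b < samp k (j + 1)) (hs : gR k b = 0) :
    (Zset k b).Finite ∧ (Zset k b).ncard + 1 = j := by
  obtain ⟨f1, c1⟩ := Zset_samp hk hk6 hj (by omega)
  obtain ⟨f2, c2⟩ := Zset_samp hk hk6 (by omega) h
  have hb0 := (samp_pos hj).trans hb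
  have h1 := ncard_Zset_lt f2 le_rfl hb' hb0 hs
  have f3 := f2.subset (Zset_mono k hb'.le)
  have h2 := Set.ncard_le_ncard (Zset_mono k hb.le) f3
  exact ⟨f3, by omega⟩

lemma Zset_between' {k j : ℕ} {b : ℝ} (hk : Even k) (hk6 : 6 ≤ k) (hj : 1 ≤ j) (h : 3 * (j + 1) ≤ k)
    (hb : samp k j < b) (hb' : b < samp k (j + 1)) (hs : 0 < (-1) ^ (j + 1) * gR k b) :
    (Zset k b).Finite ∧ (Zset k b).ncard = j := by
  obtain ⟨f1, c1⟩ := Zset_samp hk hk6 hj (by omega)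
  obtain ⟨f2, c2⟩ := Zset_samp hk hk6 (by omega) h
  have hlt := samp_lt_pi_div_two (k := k) (j := j + 1) (by omega)
  have s2 := gR_samp_sign hk6 hj (by omega : 3 * j ≤ k)
  have hp : gR k (samp k j) * gR k b < 0 := by
    have := mul_pos hs s2
    rw [pow_succ] at this
    have e : ((-1 : ℝ) ^ j) * (-1) ^ j = 1 := by rw [← mul_pow]; norm_num
    nlinarith
  obtain ⟨c, hc1, hc2, hc3⟩ := exists_gR_eq_zero (samp_pos hj) hb (hb'.trans hlt) hp
  have f3 := f2.subset (Zset_mono k hb'.le)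
  have h1 := ncard_Zset_lt f3 hc1.le hc2 ((samp_pos hj).trans hc1) hc3
  have h2 := Set.ncard_le_ncard (Zset_mono k hb'.le) f2
  exact ⟨f3, by omega⟩

lemma wpt_pi_div_six : wpt (Real.pi / 6) = 1 / 2 - (√3 / 2 : ℝ) * Complex.I := by
  rw [wpt, Real.sin_pi_div_six, Real.cos_pi_div_six]
  push_cast
  ring

lemma norm_Jsum_pi_div_six_sub_one_le {k : ℕ} (hk : 6 ≤ k) :
    ‖Jsum k (Real.pi / 6) - 1‖ ≤ 1 / 4 := by
  have hw : 0 < (wpt (Real.pi / 6)).re := wpt_re_pos (by rw [Real.sin_pi_div_six]; norm_num)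
  have h := (half_le_re_tsum_inv_pow k (by omega) hw).1.hasSum
  have h2 := (hasSum_nat_add_iff' 1).mpr h
  have e : Jsum k (Real.pi / 6) - 1 = (∑' n : ℕ, ((1 + n * wpt (Real.pi / 6)) ^ (k + 1))⁻¹)
      - ∑ i ∈ Finset.range 1, ((1 + (i : ℂ) * wpt (Real.pi / 6)) ^ (k + 1))⁻¹ := by
    simp [Jsum]
  rw [e, ← h2.tsum_eq]
  have hB := hasSum_inv_succ_mul 0
  have e4 : (1 : ℝ) / (2 * (((0 : ℕ) : ℝ) + 1) * ((0 : ℕ) + 2)) = 1 / 4 := by norm_num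
  rw [e4] at hB
  refine tsum_of_norm_bounded hB fun n => ?_
  rw [norm_inv, norm_pow, one_div]
  have hn0 : (0 : ℝ) ≤ n := n.cast_nonneg
  have hsq : ‖1 + ((n + 1 : ℕ) : ℂ) * wpt (Real.pi / 6)‖ ^ 2 = (n : ℝ) ^ 2 + 3 * n + 3 := by
    have e1 : 1 + ((n + 1 : ℕ) : ℂ) * wpt (Real.pi / 6)
        = ((1 + (n + 1) / 2 : ℝ) : ℂ) + ((-(n + 1) * (√3 / 2) : ℝ) : ℂ) * Complex.I := by
      rw [wpt_pi_div_six]; push_cast; ring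
    rw [e1, Complex.norm_add_mul_I, Real.sq_sqrt (by positivity)]
    have := Real.sq_sqrt (show (0 : ℝ) ≤ 3 by norm_num)
    nlinarith
  set y := ‖1 + ((n + 1 : ℕ) : ℂ) * wpt (Real.pi / 6)‖
  have hy1 : 1 ≤ y := by
    have : 0 ≤ y := norm_nonneg _
    nlinarith
  refine inv_anti₀ (by positivity) ?_
  push_cast
  calc _ ≤ ((n : ℝ) ^ 2 + 3 * n + 3) * ((n : ℝ) ^ 2 + 3 * n + 3) * 1 := by nlinarith
    _ ≤ ((n : ℝ) ^ 2 + 3 * n + 3) * ((n : ℝ) ^ 2 + 3 * n + 3) * ((n : ℝ) ^ 2 + 3 * n + 3) := by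
        gcongr; nlinarith
    _ = y ^ 6 := by rw [← hsq]; ring
    _ ≤ y ^ (k + 1) := pow_le_pow_right₀ hy1 (by omega)

lemma gR_pi_div_six_sign {k j : ℕ} (hk : 6 ≤ k)
    (hcos : (-1) ^ j * Real.cos ((k + 1 : ℕ) * (Real.pi / 6)) = √3 / 2) :
    0 < (-1) ^ j * gR k (Real.pi / 6) := by
  have hp := Real.pi_pos
  have hs : Real.sin (Real.pi / 6) = 1 / 2 := Real.sin_pi_div_six
  have hsp : 0 < Real.sin (Real.pi / 6) := by rw [hs]; norm_num
  have hcp : 0 < Real.cos (Real.pi / 6) := by rw [Real.cos_pi_div_six]; positivity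
  have hL := Lser_neg_rad (k := k) (by omega) hsp hcp
  have hk6 : (6 : ℝ) ≤ k := by exact_mod_cast hk
  have hn : ‖(-(rad (Real.pi / 6)) : ℂ)‖ = rad (Real.pi / 6) := by
    rw [norm_neg, Complex.norm_real, Real.norm_of_nonneg (rad_pos _).le]
  have herr := norm_Dser_sub_Lser_lt_of_le hk (by positivity) (by linarith) (by
    rw [hs, div_le_div_iff₀ (by positivity) (by norm_num)]; linarith) hn
  rw [hL, Dser_neg_rad, ← Complex.ofReal_sub, Complex.norm_real, Real.norm_eq_abs, hs] at herr
  have hJ := norm_Jsum_pi_div_six_sub_one_le hk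
  set θ : ℝ := (k + 1 : ℕ) * (Real.pi / 6) with hθ
  have hJre : (-1) ^ j * (Complex.exp ((θ : ℝ) * Complex.I) * Jsum k (Real.pi / 6)).re
      ≥ √3 / 2 - 1 / 4 := by
    have e : Complex.exp ((θ : ℝ) * Complex.I) * Jsum k (Real.pi / 6)
      = Complex.exp ((θ : ℝ) * Complex.I)
        + Complex.exp ((θ : ℝ) * Complex.I) * (Jsum k (Real.pi / 6) - 1) := by ring
    rw [e, Complex.add_re, Complex.exp_ofReal_mul_I_re, mul_add, hcos]
    have h1 : |(-1) ^ j * (Complex.exp ((θ : ℝ) * Complex.I) * (Jsum k (Real.pi / 6) - 1)).re|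
        ≤ 1 / 4 := by
      rw [abs_mul, abs_pow, abs_neg, abs_one, one_pow, one_mul]
      refine (Complex.abs_re_le_norm _).trans ?_
      rw [norm_mul, Complex.norm_exp_ofReal_mul_I, one_mul]
      exact hJ
    have := (abs_le.1 h1).1
    linarith
  have h3 : (1.7 : ℝ) ≤ √3 := Real.le_sqrt_of_sq_le (by norm_num)
  set x := (Complex.exp ((θ : ℝ) * Complex.I) * Jsum k (Real.pi / 6)).re
  have hk0 := kap_pos k
  have e1 : (2 * (1 / 2) : ℝ) = 1 := by norm_num
  rw [e1, one_pow, mul_one] at herr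
  have e : |(-1) ^ j * (gR k (Real.pi / 6) - 2 * kap k * x)| = |gR k (Real.pi / 6) - 2 * kap k * x| := by
    rw [abs_mul, abs_pow, abs_neg, abs_one, one_pow, one_mul]
  rw [← e] at herr
  have h4 := (abs_lt.1 herr).1
  have h5 : 2 * kap k * ((-1) ^ j * x) ≥ 2 * kap k * (1 / 2) := by
    gcongr; linarith
  linarith

lemma neg_one_pow_mul_self (j : ℕ) : ((-1 : ℝ) ^ j) * (-1) ^ j = 1 := by
  rw [← mul_pow]; norm_num

lemma Zset_pi_div_six_of_mod_zero {k m : ℕ} (hm : 1 ≤ m) (hk : k = 6 * m) :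
    (Zset k (Real.pi / 6)).Finite ∧ (Zset k (Real.pi / 6)).ncard + 1 = m ∧
      gR k (Real.pi / 6) ≠ 0 := by
  have hp := Real.pi_pos
  have hs : 0 < (-1) ^ m * gR k (Real.pi / 6) := by
    refine gR_pi_div_six_sign (by omega) ?_
    have e : ((k + 1 : ℕ) : ℝ) * (Real.pi / 6) = Real.pi / 6 + m * Real.pi := by
      rw [hk]; push_cast; ring
    rw [e, Real.cos_add_nat_mul_pi, Real.cos_pi_div_six, ← mul_assoc, neg_one_pow_mul_self, one_mul]
  have hm' : (1 : ℝ) ≤ m := by exact_mod_cast hm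
  obtain ⟨h1, h2⟩ := Zset_between (k := k) (j := m) (b := Real.pi / 6) ⟨3 * m, by omega⟩ (by omega) hm (by omega)
    (by rw [samp, hk]; push_cast; rw [div_lt_div_iff₀ (by positivity) (by norm_num)]; nlinarith)
    (by rw [samp, hk]; push_cast; rw [div_lt_div_iff₀ (by norm_num) (by positivity)]; nlinarith) hs
  exact ⟨h1, h2, fun h => by rw [h, mul_zero] at hs; exact lt_irrefl _ hs⟩

lemma Zset_pi_div_six_of_mod_two {k m : ℕ} (hm : 1 ≤ m) (hk : k = 6 * m + 2)
    (h0 : gR k (Real.pi / 6) = 0) :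
    (Zset k (Real.pi / 6)).Finite ∧ (Zset k (Real.pi / 6)).ncard + 1 = m := by
  have hp := Real.pi_pos
  have hm' : (1 : ℝ) ≤ m := by exact_mod_cast hm
  exact Zset_between_of_eq_zero (k := k) (j := m) (b := Real.pi / 6) ⟨3 * m + 1, by omega⟩ (by omega) hm (by omega)
    (by rw [samp, hk]; push_cast; rw [div_lt_div_iff₀ (by positivity) (by norm_num)]; nlinarith)
    (by rw [samp, hk]; push_cast; rw [div_lt_div_iff₀ (by norm_num) (by positivity)]; nlinarith) h0

lemma Zset_pi_div_six_of_mod_four {k m : ℕ} (hm : 1 ≤ m) (hk : k = 6 * m + 4) :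
    (Zset k (Real.pi / 6)).Finite ∧ (Zset k (Real.pi / 6)).ncard = m ∧
      gR k (Real.pi / 6) ≠ 0 := by
  have hp := Real.pi_pos
  have hs : 0 < (-1) ^ (m + 1) * gR k (Real.pi / 6) := by
    refine gR_pi_div_six_sign (by omega) ?_
    have e : ((k + 1 : ℕ) : ℝ) * (Real.pi / 6) = -(Real.pi / 6) + (m + 1 : ℕ) * Real.pi := by
      rw [hk]; push_cast; ring
    rw [e, Real.cos_add_nat_mul_pi, Real.cos_neg, Real.cos_pi_div_six, ← mul_assoc,
      neg_one_pow_mul_self, one_mul]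
  have hm' : (1 : ℝ) ≤ m := by exact_mod_cast hm
  obtain ⟨h1, h2⟩ := Zset_between' (k := k) (j := m) (b := Real.pi / 6) ⟨3 * m + 2, by omega⟩ (by omega) hm (by omega)
    (by rw [samp, hk]; push_cast; rw [div_lt_div_iff₀ (by positivity) (by norm_num)]; nlinarith)
    (by rw [samp, hk]; push_cast; rw [div_lt_div_iff₀ (by norm_num) (by positivity)]; nlinarith) hs
  exact ⟨h1, h2, fun h => by rw [h, mul_zero] at hs; exact lt_irrefl _ hs⟩

lemma Ek_eq_Dser (k : ℕ) (z : ℂ) : Ek k z = 1 - (2 * (k : ℂ) / ((bernoulli k : ℚ) : ℂ)) *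
    Dser (k - 1) 0 (Complex.exp (2 * Real.pi * Complex.I * z)) := by
  simp only [Ek, Dser, pser, divSum, pow_zero, one_mul]

lemma Ek_eq_E {k : ℕ} (hk : 3 ≤ k) (hke : Even k) (z : UpperHalfPlane) :
    Ek k z = ModularForm.E hk z := by
  rw [EisensteinSeries.q_expansion_bernoulli hk hke z, Ek]
  congr 2
  have hs : Summable fun n : ℕ => (∑ d ∈ n.divisors, (d : ℂ) ^ (k - 1)) *
      Complex.exp (2 * Real.pi * Complex.I * z) ^ n :=
    (polyGrowth_divSum (k - 1)).summable (norm_cexp_lt_one z.im_pos)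
  rw [← tsum_zero_pnat_eq_tsum_nat hs]
  simp only [Nat.divisors_zero, Finset.sum_empty, zero_mul, zero_add]
  refine tsum_congr fun n => ?_
  rw [ArithmeticFunction.sigma_apply, zpow_natCast]
  push_cast
  rfl

/-- Modularity of the Eisenstein series. -/
lemma Ek_modular {k : ℕ} (hk : 3 ≤ k) (hke : Even k) (a b c d : ℤ) (hdet : a * d - b * c = 1)
    {z : ℂ} (hz : 0 < z.im) :
    Ek k ((a * z + b) / (c * z + d)) = (c * z + d) ^ k * Ek k z := by
  let γ : Matrix.SpecialLinearGroup (Fin 2) ℤ := ⟨!![a, b; c, d], by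
    rw [Matrix.det_fin_two_of]; exact hdet⟩
  have h := SlashInvariantForm.slash_action_eqn' (ModularForm.E hk)
    (γ := (γ : GL (Fin 2) ℝ)) (MonoidHom.mem_range.2 ⟨γ, rfl⟩) ⟨z, hz⟩
  have e1 : ((((γ : GL (Fin 2) ℝ) • (⟨z, hz⟩ : UpperHalfPlane)) : UpperHalfPlane) : ℂ)
      = (a * z + b) / (c * z + d) := by
    have := UpperHalfPlane.coe_specialLinearGroup_apply γ (⟨z, hz⟩ : UpperHalfPlane)
    exact this.trans (by simp [γ])
  rw [← Ek_eq_E hk hke, ← Ek_eq_E hk hke, e1] at h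
  have e2 : (γ : GL (Fin 2) ℝ) 1 0 = (c : ℝ) := rfl
  have e3 : (γ : GL (Fin 2) ℝ) 1 1 = (d : ℝ) := rfl
  rw [h, e2, e3]
  simp

lemma hasDerivAt_Ek (k : ℕ) {z : ℂ} (hz : 0 < z.im) :
    HasDerivAt (Ek k) (-(2 * (k : ℂ) / ((bernoulli k : ℚ) : ℂ)) * (2 * Real.pi * Complex.I *
      Dser (k - 1) 1 (Complex.exp (2 * Real.pi * Complex.I * z)))) z := by
  have h := Dser_hasDerivAt_exp (k - 1) 0 (norm_cexp_lt_one hz)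
  have h2 := ((h.const_mul (2 * (k : ℂ) / ((bernoulli k : ℚ) : ℂ))).const_sub 1)
  rw [show Ek k = fun z => _ from funext (Ek_eq_Dser k)]
  refine h2.congr_deriv ?_
  ring

lemma deriv_Ek_modular {k : ℕ} (hk : 3 ≤ k) (hke : Even k) (a b c d : ℤ) (hdet : a * d - b * c = 1)
    {z : ℂ} (hz : 0 < z.im) (hcd : (c * z + d) ≠ 0) (hw : 0 < ((a * z + b) / (c * z + d)).im) :
    deriv (Ek k) ((a * z + b) / (c * z + d)) = (c * z + d) ^ 2 *
      (k * c * (c * z + d) ^ (k - 1) * Ek k z + (c * z + d) ^ k * deriv (Ek k) z) := by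
  have h1 : HasDerivAt (fun z : ℂ => (a * z + b) / (c * z + d)) (1 / (c * z + d) ^ 2) z := by
    have hn : HasDerivAt (fun z : ℂ => (a * z + b)) a z := by
      simpa using ((hasDerivAt_id z).const_mul (a : ℂ)).add_const (b : ℂ)
    have hd : HasDerivAt (fun z : ℂ => (c * z + d)) c z := by
      simpa using ((hasDerivAt_id z).const_mul (c : ℂ)).add_const (d : ℂ)
    refine (hn.div hd hcd).congr_deriv ?_
    have hdet' : (a : ℂ) * d - b * c = 1 := by exact_mod_cast hdet
    congr 1
    linear_combination hdet'
  have h2 := (hasDerivAt_Ek k hw).comp z h1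
  have hd : HasDerivAt (fun z : ℂ => (c * z + d) ^ k) (k * (c * z + d) ^ (k - 1) * c) z := by
    have hd : HasDerivAt (fun z : ℂ => (c * z + d)) c z := by
      simpa using ((hasDerivAt_id z).const_mul (c : ℂ)).add_const (d : ℂ)
    exact hd.pow k
  have h3 := hd.mul (hasDerivAt_Ek k hz)
  have heq : (fun z : ℂ => Ek k ((a * z + b) / (c * z + d))) =ᶠ[𝓝 z]
      fun z => (c * z + d) ^ k * Ek k z := by
    filter_upwards [(isOpen_lt continuous_const Complex.continuous_im).mem_nhds hz] with w hw
    exact Ek_modular hk hke a b c d hdet hw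
  have h4 := (h3.congr_of_eventuallyEq heq).unique h2
  rw [← (hasDerivAt_Ek k hw).deriv, ← (hasDerivAt_Ek k hz).deriv] at h4
  have : deriv (Ek k) ((a * z + b) / (c * z + d)) = (c * z + d) ^ 2 *
      (deriv (Ek k) ((a * z + b) / (c * z + d)) * (1 / (c * z + d) ^ 2)) := by
    generalize deriv (Ek k) ((a * z + b) / (c * z + d)) = y
    rw [mul_left_comm, mul_one_div_cancel (pow_ne_zero 2 hcd), mul_one]
  rw [this, ← h4]
  ring

/-- The value `ζ(k)`. -/
noncomputable def zr (k : ℕ) : ℝ := ∑' n : ℕ, 1 / (n : ℝ) ^ k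

lemma one_le_zr {k : ℕ} (hk : 2 ≤ k) : 1 ≤ zr k := by
  have hs : Summable fun n : ℕ => 1 / (n : ℝ) ^ k := Real.summable_one_div_nat_pow.2 (by omega)
  have := hs.le_tsum 1 (fun j _ => by positivity)
  simpa [zr] using this

lemma zr_anti {j k : ℕ} (hj : 2 ≤ j) (hjk : j ≤ k) : zr k ≤ zr j := by
  refine Summable.tsum_le_tsum (fun n => ?_) (Real.summable_one_div_nat_pow.2 (by omega))
    (Real.summable_one_div_nat_pow.2 (by omega))
  rcases Nat.eq_zero_or_pos n with rfl | hn
  · simp [show j ≠ 0 by omega, show k ≠ 0 by omega]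
  · have : (1 : ℝ) ≤ n := by exact_mod_cast hn
    gcongr

lemma zr_four_lt : zr 4 < 1.0824 := by
  rw [zr, hasSum_zeta_four.tsum_eq]
  have h := Real.pi_lt_d4
  have h0 := Real.pi_pos
  have : Real.pi ^ 4 < 3.1416 ^ 4 := by gcongr
  rw [div_lt_iff₀ (by norm_num)]
  refine this.trans (by norm_num)

noncomputable def eisCoeff (k : ℕ) : ℝ := (-1) ^ (k / 2) * (2 * Real.pi) ^ k / (k - 1).factorial

lemma eisCoeff_ne_zero (k : ℕ) : eisCoeff k ≠ 0 := by
  unfold eisCoeff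
  positivity

lemma zr_mul_two_mul_div_bernoulli {k : ℕ} (hk : 2 ≤ k) (hke : Even k) :
    (bernoulli k : ℝ) ≠ 0 ∧ zr k * (2 * k / (bernoulli k : ℝ)) = -eisCoeff k := by
  obtain ⟨n, rfl⟩ := hke
  rw [← two_mul] at *
  have hn : n ≠ 0 := by omega
  have h : zr (2 * n) = _ := (hasSum_zeta_nat hn).tsum_eq
  have h1 := one_le_zr hk
  have hB : (bernoulli (2 * n) : ℝ) ≠ 0 := by
    intro h0
    rw [h, h0] at h1
    norm_num at h1
  refine ⟨hB, ?_⟩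
  rw [h, eisCoeff]
  have hf : ((2 * n).factorial : ℝ) = (2 * n : ℕ) * (2 * n - 1).factorial := by
    rw [← Nat.cast_mul, Nat.mul_factorial_pred (by omega)]
  have hp : (2 * Real.pi) ^ (2 * n) = 2 * 2 ^ (2 * n - 1) * Real.pi ^ (2 * n) := by
    rw [mul_pow, ← pow_succ', show 2 * n - 1 + 1 = 2 * n by omega]
  rw [hf, hp, show 2 * n / 2 = n by omega]
  have : ((2 * n - 1).factorial : ℝ) ≠ 0 := by positivity
  have : (n : ℝ) ≠ 0 := by positivity
  push_cast
  field_simp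
  ring

/-- The nome at the point `1/2 + i τ`. -/
noncomputable def nome (τ : ℝ) : ℝ := -Real.exp (-(2 * Real.pi * τ))

lemma cexp_half_add (τ : ℝ) :
    Complex.exp (2 * Real.pi * Complex.I * (1 / 2 + τ * Complex.I)) = (nome τ : ℂ) := by
  rw [nome, show 2 * Real.pi * Complex.I * (1 / 2 + τ * Complex.I)
    = Real.pi * Complex.I + ((-(2 * Real.pi * τ) : ℝ) : ℂ) by
      push_cast; linear_combination (2 * Real.pi * τ : ℂ) * Complex.I_sq]
  rw [Complex.exp_add, Complex.exp_pi_mul_I]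
  push_cast
  ring

/-- Real values of the divisor series at a point of the line `Re z = 1/2`. -/
noncomputable def DR (k j : ℕ) (τ : ℝ) : ℝ := (Dser (k - 1) j (nome τ : ℂ)).re

lemma Dser_nome (k j : ℕ) (τ : ℝ) : Dser (k - 1) j (nome τ : ℂ) = (DR k j τ : ℂ) := by
  apply Complex.ext
  · simp [DR]
  · simpa using Dser_ofReal_im _ _ _

/-- `ζ(k) (E_k + (i τ / k) E_k')` at `1/2 + i τ`. -/
noncomputable def GR (k : ℕ) (τ : ℝ) : ℝ :=
  zr k + eisCoeff k * (DR k 0 τ - 2 * Real.pi * τ / k * DR k 1 τ)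

lemma half_add_im (τ : ℝ) : ((1 / 2 : ℂ) + τ * Complex.I).im = τ := by simp

lemma hasDerivAt_DR (k j : ℕ) {τ : ℝ} (hτ : 0 < τ) :
    HasDerivAt (DR k j) (-(2 * Real.pi) * DR k (j + 1) τ) τ := by
  have h := Dser_hasDerivAt_exp (k - 1) j
    (norm_cexp_lt_one (z := 1 / 2 + τ * Complex.I) (by rw [half_add_im]; exact hτ))
  have hl : HasDerivAt (fun t : ℝ => (1 / 2 : ℂ) + t * Complex.I) Complex.I τ := by
    simpa using ((Complex.ofRealCLM.hasDerivAt (x := τ)).mul_const Complex.I).const_add (1 / 2 : ℂ)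
  have h2 := h.comp τ hl
  have h3 : HasDerivAt (fun t : ℝ => (Dser (k - 1) j (nome t : ℂ)))
      (((-(2 * Real.pi) * DR k (j + 1) τ : ℝ)) : ℂ) τ := by
    have e : (fun t : ℝ => (Dser (k - 1) j (nome t : ℂ))) = (fun w : ℂ => Dser (k - 1) j
        (Complex.exp (2 * Real.pi * Complex.I * w))) ∘ fun t : ℝ => (1 / 2 : ℂ) + t * Complex.I := by
      funext t
      simp only [Function.comp, cexp_half_add]
    rw [e]
    refine h2.congr_deriv ?_
    rw [cexp_half_add, Dser_nome]
    push_cast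
    linear_combination (2 * Real.pi * DR k (j + 1) τ : ℂ) * Complex.I_sq
  exact (Complex.reCLM.hasFDerivAt.comp_hasDerivAt τ h3).congr_deriv (by simp)

noncomputable def GR' (k : ℕ) (τ : ℝ) : ℝ :=
  -(2 * Real.pi) * eisCoeff k * ((1 + 1 / k) * DR k 1 τ - 2 * Real.pi * τ / k * DR k 2 τ)

lemma hasDerivAt_GR (k : ℕ) {τ : ℝ} (hτ : 0 < τ) : HasDerivAt (GR k) (GR' k τ) τ := by
  have h0 := hasDerivAt_DR k 0 hτ
  have h1 := hasDerivAt_DR k 1 hτ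
  have hl : HasDerivAt (fun t : ℝ => 2 * Real.pi * t / k) (2 * Real.pi / k) τ := by
    simpa using ((hasDerivAt_id τ).const_mul (2 * Real.pi)).div_const (k : ℝ)
  refine (((h0.sub (hl.mul h1)).const_mul (eisCoeff k)).const_add (zr k)).congr_deriv ?_
  rw [GR']
  ring

lemma Ek_half_add {k : ℕ} (hk : 4 ≤ k) (hke : Even k) (τ : ℝ) :
    zr k * Ek k (1 / 2 + τ * Complex.I) = ((zr k + eisCoeff k * DR k 0 τ : ℝ) : ℂ) := by
  have h := (zr_mul_two_mul_div_bernoulli (by omega) hke).2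
  have h' : (zr k : ℂ) * (2 * k / ((bernoulli k : ℚ) : ℂ)) = -eisCoeff k := by
    have := congrArg (fun x : ℝ => (x : ℂ)) h
    push_cast at this
    exact this
  rw [Ek_eq_Dser, cexp_half_add, Dser_nome]
  push_cast
  linear_combination (-(DR k 0 τ : ℂ)) * h'

lemma deriv_Ek_half_add {k : ℕ} (hk : 4 ≤ k) (hke : Even k) {τ : ℝ} (hτ : 0 < τ) :
    zr k * deriv (Ek k) (1 / 2 + τ * Complex.I)
      = 2 * Real.pi * eisCoeff k * DR k 1 τ * Complex.I := by
  have h := (zr_mul_two_mul_div_bernoulli (by omega) hke).2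
  have h' : (zr k : ℂ) * (2 * k / ((bernoulli k : ℚ) : ℂ)) = -eisCoeff k := by
    have := congrArg (fun x : ℝ => (x : ℂ)) h
    push_cast at this
    exact this
  rw [(hasDerivAt_Ek k (by rw [half_add_im]; exact hτ)).deriv, cexp_half_add, Dser_nome]
  linear_combination (-(2 * Real.pi * Complex.I * DR k 1 τ : ℂ)) * h'

lemma deriv_Ek_eq_zero_iff {k : ℕ} (hk : 4 ≤ k) (hke : Even k) {τ : ℝ} (hτ : 0 < τ) :
    deriv (Ek k) (1 / 2 + τ * Complex.I) = 0 ↔ DR k 1 τ = 0 := by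
  have h := deriv_Ek_half_add hk hke hτ
  have hz : (zr k : ℂ) ≠ 0 := by
    have := one_le_zr (k := k) (by omega)
    exact_mod_cast (by linarith : zr k ≠ 0)
  have he : (eisCoeff k : ℂ) ≠ 0 := by exact_mod_cast eisCoeff_ne_zero k
  have hp : (Real.pi : ℂ) ≠ 0 := by exact_mod_cast Real.pi_ne_zero
  constructor
  · intro h0
    rw [h0, mul_zero] at h
    simpa [he, hp] using h.symm
  · intro h0
    rw [h0] at h
    simpa [hz] using h

/-- The zeros of the derivative at height `1/(4τ)` are detected by `GR` at height `τ`. -/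
lemma DR_eq_zero_iff_GR {k : ℕ} (hk : 4 ≤ k) (hke : Even k) {τ : ℝ} (hτ : 0 < τ) :
    DR k 1 (1 / (4 * τ)) = 0 ↔ GR k τ = 0 := by
  rw [← deriv_Ek_eq_zero_iff hk hke (by positivity)]
  have hτ' : (τ : ℂ) ≠ 0 := by exact_mod_cast hτ.ne'
  have hI := Complex.I_ne_zero
  have hden : ((2 : ℤ) : ℂ) * (1 / 2 + τ * Complex.I) + ((-1 : ℤ) : ℂ) = 2 * τ * Complex.I := by
    push_cast; ring
  have hw : (((1 : ℤ) : ℂ) * (1 / 2 + τ * Complex.I) + ((-1 : ℤ) : ℂ)) /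
      (((2 : ℤ) : ℂ) * (1 / 2 + τ * Complex.I) + ((-1 : ℤ) : ℂ))
      = 1 / 2 + ((1 / (4 * τ) : ℝ) : ℂ) * Complex.I := by
    rw [hden]
    push_cast
    field_simp
    linear_combination (-4 : ℂ) * Complex.I_sq
  have h := deriv_Ek_modular (k := k) (by omega) hke 1 (-1) 2 (-1) (by norm_num)
    (z := 1 / 2 + τ * Complex.I) (by rw [half_add_im]; exact hτ)
    (by rw [hden]; simp [hτ'])
    (by rw [hw, half_add_im]; positivity)
  rw [hw, hden] at h
  have hz : (zr k : ℂ) ≠ 0 := by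
    have := one_le_zr (k := k) (by omega)
    exact_mod_cast (by linarith : zr k ≠ 0)
  have hk0 : (k : ℂ) ≠ 0 := by exact_mod_cast (by omega : k ≠ 0)
  have hpow : (2 * τ * Complex.I) ^ k = (2 * τ * Complex.I) ^ (k - 1) * (2 * τ * Complex.I) := by
    rw [← pow_succ, show k - 1 + 1 = k by omega]
  have key : zr k * deriv (Ek k) (1 / 2 + ((1 / (4 * τ) : ℝ) : ℂ) * Complex.I)
      = (2 * τ * Complex.I) ^ (k + 1) * (2 * k) * GR k τ := by
    rw [h, show (2 * τ * Complex.I) ^ (k + 1)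
      = (2 * τ * Complex.I) ^ 2 * (2 * τ * Complex.I) ^ (k - 1) by
        rw [← pow_add]; congr 1; omega, hpow, GR]
    have h1 := Ek_half_add hk hke τ
    have h2 := deriv_Ek_half_add hk hke hτ
    push_cast at h1 ⊢
    have e : 2 * (k : ℂ) * (zr k + eisCoeff k * (DR k 0 τ - 2 * Real.pi * τ / k * DR k 1 τ))
      = 2 * k * (zr k + eisCoeff k * DR k 0 τ) - 4 * Real.pi * τ * eisCoeff k * DR k 1 τ := by
      field_simp
      ring
    linear_combination (2 * τ * Complex.I) ^ 2 * (2 * τ * Complex.I) ^ (k - 1) * (-e) + (2 * τ * Complex.I) ^ 2 * (2 * τ * Complex.I) ^ (k - 1) * (2 * k * h1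
      + 2 * τ * Complex.I * h2 + 4 * τ * Real.pi * eisCoeff k * DR k 1 τ * Complex.I_sq)
  constructor
  · intro h0
    rw [h0, mul_zero] at key
    simpa [hτ', hk0] using key.symm
  · intro h0
    rw [h0] at key
    simpa [hz] using key

lemma gR_eq_DR {k : ℕ} (α : ℝ) : gR k α = DR k 1 (Real.cos α / (2 * Real.sin α)) := by
  rw [gR, DR]
  congr 3
  rw [nome, rad, show 2 * Real.pi * (Real.cos α / (2 * Real.sin α))
    = Real.pi * (Real.cos α / Real.sin α) by ring]
  push_cast
  rfl

lemma gR_eq_zero_iff_GR {k : ℕ} (hk : 4 ≤ k) (hke : Even k) {α : ℝ} (h0 : 0 < α)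
    (h1 : α < Real.pi / 2) : gR k α = 0 ↔ GR k (Real.tan α / 2) = 0 := by
  have ht := Real.tan_pos_of_pos_of_lt_pi_div_two h0 h1
  rw [← DR_eq_zero_iff_GR hk hke (by positivity), gR_eq_DR]
  have : 1 / (4 * (Real.tan α / 2)) = Real.cos α / (2 * Real.sin α) := by
    rw [Real.tan_eq_sin_div_cos]
    have := (Real.sin_pos_of_pos_of_lt_pi h0 (by linarith)).ne'
    have := (Real.cos_pos_of_mem_Ioo ⟨by linarith, h1⟩).ne'
    field_simp
    norm_num
  rw [this]

lemma sixth_root_pow_ne_one {u : ℂ} (hu : u ^ 2 - u + 1 = 0) {n : ℕ} (hn : n % 6 = 2 ∨ n % 6 = 4) :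
    u ^ n ≠ 1 := by
  have h3 : u ^ 3 = -1 := by linear_combination (u + 1) * hu
  have h6 : u ^ 6 = 1 := by linear_combination (u ^ 3 - 1) * h3
  have hn' : u ^ n = u ^ (n % 6) := by
    conv_lhs => rw [← Nat.div_add_mod n 6, pow_add, pow_mul, h6, one_pow, one_mul]
  rw [hn']
  rcases hn with h | h <;> rw [h] <;> intro h1
  · have h2 : u = 2 := by linear_combination h1 - hu
    rw [h2] at hu
    norm_num at hu
  · have h2 : u = -1 := by linear_combination -h1 + u * h3
    rw [h2] at hu
    norm_num at hu

lemma rho_sq : ((1 / 2 : ℂ) + ((√3 / 2 : ℝ) : ℂ) * Complex.I) ^ 2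
    = (1 / 2 : ℂ) + ((√3 / 2 : ℝ) : ℂ) * Complex.I - 1 := by
  have h : ((√3 : ℝ) : ℂ) ^ 2 = 3 := by
    rw [← Complex.ofReal_pow, Real.sq_sqrt (by norm_num)]; norm_num
  push_cast
  linear_combination (((√3 : ℝ) : ℂ) ^ 2 / 4) * Complex.I_sq - h / 4

lemma Ek_rho_eq_zero {k : ℕ} (hk : 4 ≤ k) (h : k % 6 = 2 ∨ k % 6 = 4) :
    Ek k (1 / 2 + ((√3 / 2 : ℝ) : ℂ) * Complex.I) = 0 := by
  have hke : Even k := Nat.even_iff.2 (by omega)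
  have hρ := rho_sq
  have him := half_add_im (√3 / 2)
  set ρ : ℂ := 1 / 2 + ((√3 / 2 : ℝ) : ℂ) * Complex.I with hρd
  have hne : 1 - ρ ≠ 0 := by
    intro h0
    have : ρ = 1 := by linear_combination -h0
    rw [this] at hρ
    norm_num at hρ
  have hu : (1 - ρ) ^ 2 - (1 - ρ) + 1 = 0 := by linear_combination hρ
  have hm := Ek_modular (k := k) (by omega) hke 0 1 (-1) 1 (by norm_num) (z := ρ)
    (by rw [him]; positivity)
  push_cast at hm
  rw [show (-1 * ρ + 1 : ℂ) = 1 - ρ by ring, show (0 * ρ + 1 : ℂ) / (1 - ρ) = ρ by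
    rw [div_eq_iff hne]; linear_combination hρ] at hm
  have h1 := sixth_root_pow_ne_one hu h
  by_contra h0
  apply h1
  have : ((1 - ρ) ^ k - 1) * Ek k ρ = 0 := by linear_combination -hm
  rcases mul_eq_zero.1 this with h' | h'
  · linear_combination h'
  · exact absurd h' h0

lemma deriv_Ek_rho_eq_zero {k : ℕ} (hk : 4 ≤ k) (h : k % 6 = 2) :
    deriv (Ek k) (1 / 2 + ((√3 / 2 : ℝ) : ℂ) * Complex.I) = 0 := by
  have hke : Even k := Nat.even_iff.2 (by omega)
  have hE := Ek_rho_eq_zero hk (Or.inl h)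
  have hρ := rho_sq
  have him := half_add_im (√3 / 2)
  set ρ : ℂ := 1 / 2 + ((√3 / 2 : ℝ) : ℂ) * Complex.I with hρd
  have hne : 1 - ρ ≠ 0 := by
    intro h0
    have : ρ = 1 := by linear_combination -h0
    rw [this] at hρ
    norm_num at hρ
  have hu : (1 - ρ) ^ 2 - (1 - ρ) + 1 = 0 := by linear_combination hρ
  have e1 : (((-1 : ℤ) : ℂ) * ρ + ((1 : ℤ) : ℂ)) = 1 - ρ := by push_cast; ring
  have e2 : (((0 : ℤ) : ℂ) * ρ + ((1 : ℤ) : ℂ)) / (((-1 : ℤ) : ℂ) * ρ + ((1 : ℤ) : ℂ)) = ρ := by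
    rw [e1, div_eq_iff hne]; push_cast; linear_combination hρ
  have hm := deriv_Ek_modular (k := k) (by omega) hke 0 1 (-1) 1 (by norm_num) (z := ρ)
    (by rw [him]; positivity) (by rw [e1]; exact hne) (by rw [e2, him]; positivity)
  rw [e2, e1, hE] at hm
  have h1 := sixth_root_pow_ne_one hu (n := k + 2) (by omega)
  by_contra h0
  apply h1
  have : ((1 - ρ) ^ (k + 2) - 1) * deriv (Ek k) ρ = 0 := by
    rw [pow_add]
    linear_combination -hm
  rcases mul_eq_zero.1 this with h' | h'
  · linear_combination h'
  · exact absurd h' h0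

lemma GR_rho {k : ℕ} (hk : 4 ≤ k) (h : k % 6 = 2 ∨ k % 6 = 4) :
    GR k (√3 / 2) = -(eisCoeff k * (Real.pi * √3 / k * DR k 1 (√3 / 2))) := by
  have hke : Even k := Nat.even_iff.2 (by omega)
  have h1 := Ek_half_add hk hke (√3 / 2)
  rw [Ek_rho_eq_zero hk h, mul_zero] at h1
  have h2 : zr k + eisCoeff k * DR k 0 (√3 / 2) = 0 := by exact_mod_cast h1.symm
  rw [GR]
  linear_combination h2

lemma DR_rho {k : ℕ} (hk : 4 ≤ k) (h : k % 6 = 2) : DR k 1 (√3 / 2) = 0 :=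
  (deriv_Ek_eq_zero_iff hk (Nat.even_iff.2 (by omega)) (by positivity)).1
    (deriv_Ek_rho_eq_zero hk h)

lemma GR_rho_eq_zero {k : ℕ} (hk : 4 ≤ k) (h : k % 6 = 2) : GR k (√3 / 2) = 0 := by
  rw [GR_rho hk (Or.inl h), DR_rho hk h]
  simp

lemma hasSum_int_even_inv_sq : HasSum (fun n : ℤ => 1 / (2 * (n : ℝ)) ^ 2) (Real.pi ^ 2 / 12) := by
  have h := hasSum_int_inv_sq.mul_left (1 / 4)
  rw [show Real.pi ^ 2 / 12 = 1 / 4 * (Real.pi ^ 2 / 3) by ring]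
  refine h.congr_fun fun n => ?_
  rw [mul_pow, one_div_mul_one_div]
  norm_num

lemma hasSum_int_even_add_odd {f : ℤ → ℝ} {a b : ℝ} (he : HasSum (fun n : ℤ => f (2 * n)) a)
    (ho : HasSum (fun n : ℤ => f (2 * n + 1)) b) : HasSum f (a + b) := by
  have hinj := mul_right_injective₀ (two_ne_zero' ℤ)
  replace ho := ((add_left_injective 1).comp hinj).hasSum_range_iff.2 ho
  refine (hinj.hasSum_range_iff.2 he).add_isCompl ?_ ho
  have e1 : Set.range (fun n : ℤ => 2 * n) = {n | Even n} := by
    ext n; simp [even_iff_two_dvd, dvd_def]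
  have e2 : Set.range ((fun x : ℤ => x + 1) ∘ fun n => 2 * n) = {n | Odd n} := by
    ext n; simp [Odd, eq_comm]
  rw [e1, e2]
  exact Int.isCompl_even_odd

lemma hasSum_int_odd_inv_sq :
    HasSum (fun n : ℤ => 1 / (2 * (n : ℝ) + 1) ^ 2) (Real.pi ^ 2 / 4) := by
  have h := hasSum_int_inv_sq
  have hs : Summable fun n : ℤ => 1 / (((2 * n + 1 : ℤ) : ℝ)) ^ 2 :=
    h.summable.comp_injective (i := fun n : ℤ => 2 * n + 1) fun a b hab => by
      simpa using hab
  have he : HasSum (fun n : ℤ => 1 / (((2 * n : ℤ) : ℝ)) ^ 2) (Real.pi ^ 2 / 12) := by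
    simpa using hasSum_int_even_inv_sq
  have h2 := hasSum_int_even_add_odd (f := fun n : ℤ => 1 / (n : ℝ) ^ 2) he hs.hasSum
  have h3 := h2.unique h
  have h4 := hs.hasSum
  rw [show ∑' n : ℤ, 1 / (((2 * n + 1 : ℤ) : ℝ)) ^ 2 = Real.pi ^ 2 / 4 by linarith] at h4
  simpa using h4

lemma hasSum_inv_sq_of_even (l : ℤ) :
    HasSum (fun n : ℤ => 1 / (2 * (l : ℝ) + 2 * n) ^ 2) (Real.pi ^ 2 / 12) := by
  have := (Equiv.addLeft l).hasSum_iff.2 hasSum_int_even_inv_sq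
  refine this.congr_fun fun n => ?_
  simp only [Function.comp, Equiv.coe_addLeft]
  push_cast
  ring

lemma hasSum_inv_sq_of_odd (l : ℤ) :
    HasSum (fun n : ℤ => 1 / (2 * (l : ℝ) + 1 + 2 * n) ^ 2) (Real.pi ^ 2 / 4) := by
  have := (Equiv.addLeft l).hasSum_iff.2 hasSum_int_odd_inv_sq
  refine this.congr_fun fun n => ?_
  simp only [Function.comp, Equiv.coe_addLeft]
  push_cast
  ring

lemma exists_hasSum_inv_sq (m : ℕ) :
    ∃ y ≤ Real.pi ^ 2 / 4, HasSum (fun n : ℤ => 1 / ((m : ℝ) + 2 * n) ^ 2) y := by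
  rcases Nat.even_or_odd' m with ⟨l, rfl | rfl⟩
  · refine ⟨_, ?_, by simpa using hasSum_inv_sq_of_even l⟩
    nlinarith [Real.pi_pos]
  · exact ⟨_, le_rfl, by simpa using hasSum_inv_sq_of_odd l⟩

lemma norm_hasSum_sub_two_le {F : ℕ+ → ℤ → ℂ} {S : ℕ+ → ℂ} {T : ℂ} {D : ℝ} (hD : 0 ≤ D)
    (hF : ∀ (m : ℕ+) (n : ℤ), ¬ (m = 1 ∧ (n = 0 ∨ n = -1)) →
      ‖F m n‖ ≤ D * (1 / (((m : ℕ) : ℝ) + 2 * n) ^ 2 * (1 / ((m : ℕ) : ℝ) ^ 4)))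
    (hS : ∀ m, HasSum (F m) (S m)) (hT : HasSum S T) :
    ‖T - (F 1 0 + F 1 (-1))‖ ≤ 0.568 * D := by
  have h1 : ‖S 1 - (F 1 0 + F 1 (-1))‖ ≤ D * (Real.pi ^ 2 / 4 - 2) := by
    have hu := ((hS 1).update 0 0).update (-1) 0
    have hb := (((hasSum_inv_sq_of_odd 0).update 0 0).update (-1) 0).mul_left D
    have := tsum_of_norm_bounded hb (f := Function.update (Function.update (F 1) 0 0) (-1) 0) ?_
    · rw [hu.tsum_eq] at this
      refine le_of_eq_of_le ?_ (this.trans (le_of_eq ?_))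
      · congr 1
        simp [Function.update]
        ring
      · simp [Function.update]
        norm_num
        left
        ring
    · intro n
      by_cases h1 : n = -1
      · subst h1; simp
      by_cases h0 : n = 0
      · subst h0; simp
      · rw [Function.update_of_ne h1, Function.update_of_ne h0, Function.update_of_ne h1,
          Function.update_of_ne h0]
        simpa using hF 1 n (by simp [h0, h1])
  have hgen : ∀ m : ℕ+, m ≠ 1 → ∀ y, HasSum (fun n : ℤ => 1 / (((m : ℕ) : ℝ) + 2 * n) ^ 2) y →
      ‖S m‖ ≤ D * (y * (1 / ((m : ℕ) : ℝ) ^ 4)) := by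
    intro m hm y hy
    rw [← (hS m).tsum_eq]
    exact tsum_of_norm_bounded ((hy.mul_right _).mul_left D) fun n => hF m n (by simp [hm])
  have hz : HasSum (fun m : ℕ+ => Real.pi ^ 2 / 4 * (1 / ((m : ℕ) : ℝ) ^ 4))
      (Real.pi ^ 2 / 4 * (Real.pi ^ 4 / 90)) := by
    refine HasSum.mul_left _ ?_
    have h := (hasSum_nat_add_iff' 1).2 hasSum_zeta_four
    rw [← Equiv.pnatEquivNat.symm.hasSum_iff]
    simp only [Finset.range_one, Finset.sum_singleton, Nat.cast_zero] at h
    norm_num at h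
    refine h.congr_fun fun n => ?_
    simp
  have hb := ((hz.update 1 (Real.pi ^ 2 / 4 - 2)).update 2
    (Real.pi ^ 2 / 12 * (1 / 16))).mul_left D
  have hu := hT.update 1 (S 1 - (F 1 0 + F 1 (-1)))
  have := tsum_of_norm_bounded hb (f := Function.update S 1 (S 1 - (F 1 0 + F 1 (-1)))) ?_
  · rw [hu.tsum_eq] at this
    have e : S 1 - (F 1 0 + F 1 (-1)) - S 1 + T = T - (F 1 0 + F 1 (-1)) := by ring
    rw [e] at this
    refine this.trans ?_
    rw [mul_comm]
    refine mul_le_mul_of_nonneg_right ?_ hD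
    have h21 : (2 : ℕ+) ≠ 1 := by decide
    rw [Function.update_of_ne h21]
    norm_num
    have hp : Real.pi ^ 2 < 9.8698 := by
      have := Real.pi_lt_d6
      have h0 := Real.pi_pos
      have : Real.pi ^ 2 < 3.141593 ^ 2 := by gcongr
      refine this.trans (by norm_num)
    have hp' : 9.8695 < Real.pi ^ 2 := by
      have := Real.pi_gt_d6
      have : 3.141592 ^ 2 < Real.pi ^ 2 := by gcongr
      refine lt_trans (by norm_num) this
    generalize hP : Real.pi ^ 2 = P at *
    have : Real.pi ^ 4 = P ^ 2 := by rw [← hP]; ring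
    rw [this]
    nlinarith [mul_pos (sub_pos.2 hp) (sub_pos.2 hp'), pow_pos (by linarith : (0:ℝ) < P) 2]
  · intro m
    by_cases hm1 : m = 1
    · subst hm1
      have h21 : (1 : ℕ+) ≠ 2 := by decide
      rw [Function.update_self, Function.update_of_ne h21, Function.update_self]
      exact h1
    rw [Function.update_of_ne hm1]
    by_cases hm2 : m = 2
    · subst hm2
      rw [Function.update_self]
      have := hgen 2 hm1 _ (by simpa using hasSum_inv_sq_of_even 1)
      norm_num at this ⊢
      linarith
    · rw [Function.update_of_ne hm2, Function.update_of_ne hm1]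
      obtain ⟨y, hy, hsy⟩ := exists_hasSum_inv_sq m
      refine (hgen m hm1 y hsy).trans ?_
      gcongr

lemma weighted_amgm {a b : ℕ} (ha : 0 < a) (hb : 0 < b) {x y : ℝ} (hx : 0 ≤ x) (hy : 0 ≤ y) :
    (x / a) ^ a * (y / b) ^ b ≤ ((x + y) / (a + b)) ^ (a + b) := by
  have ha' : (0 : ℝ) < a := by exact_mod_cast ha
  have hb' : (0 : ℝ) < b := by exact_mod_cast hb
  have h := Real.geom_mean_le_arith_mean2_weighted (w₁ := a / (a + b)) (w₂ := b / (a + b))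
    (p₁ := x / a) (p₂ := y / b) (by positivity) (by positivity) (by positivity) (by positivity)
    (by field_simp)
  have h2 := pow_le_pow_left₀ (by positivity) h (a + b)
  refine le_of_eq_of_le ?_ (h2.trans (le_of_eq ?_))
  · rw [mul_pow, ← Real.rpow_natCast, ← Real.rpow_natCast, ← Real.rpow_natCast, ← Real.rpow_natCast,
      ← Real.rpow_mul (by positivity), ← Real.rpow_mul (by positivity)]
    push_cast
    congr 2 <;> field_simp
  · congr 1
    field_simp

lemma lattice_pow_seven {R A μ : ℝ} (hR : 0 ≤ R)
    (h : 4 * R ^ 2 = A ^ 2 + μ ^ 2) : 10.9 * (A ^ 3 * μ ^ 4) ≤ 128 * R ^ 7 := by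
  have h1 := weighted_amgm (a := 3) (b := 4) (by norm_num) (by norm_num) (sq_nonneg A) (sq_nonneg μ)
  rw [← h] at h1
  refine le_of_sq_le_sq ?_ (by positivity)
  norm_num [div_pow, mul_pow] at h1
  have e : (128 * R ^ 7) ^ 2 = 16384 * (R ^ 2) ^ 7 := by ring
  have e2 : (10.9 * (A ^ 3 * μ ^ 4)) ^ 2 = 118.81 * ((A ^ 2) ^ 3 * (μ ^ 2) ^ 4) := by ring
  rw [e, e2]
  have : 0 ≤ (A ^ 2) ^ 3 * (μ ^ 2) ^ 4 := by positivity
  nlinarith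

lemma lattice_pow_eight {R A μ : ℝ}
    (h : 4 * R ^ 2 = A ^ 2 + μ ^ 2) : 14.1 * (A ^ 3 * μ ^ 5) ≤ 256 * R ^ 8 := by
  have h1 := weighted_amgm (a := 3) (b := 5) (by norm_num) (by norm_num) (sq_nonneg A) (sq_nonneg μ)
  rw [← h] at h1
  refine le_of_sq_le_sq ?_ (by positivity)
  norm_num [div_pow, mul_pow] at h1
  have e : (256 * R ^ 8) ^ 2 = 65536 * (R ^ 2) ^ 8 := by ring
  have e2 : (14.1 * (A ^ 3 * μ ^ 5)) ^ 2 = 198.81 * ((A ^ 2) ^ 3 * (μ ^ 2) ^ 5) := by ring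
  rw [e, e2]
  have : 0 ≤ (A ^ 2) ^ 3 * (μ ^ 2) ^ 5 := by positivity
  nlinarith

lemma norm_lattice_sq (m n T : ℝ) :
    4 * ‖(m : ℂ) * (1 / 2 + ((T / 2 : ℝ) : ℂ) * Complex.I) + n‖ ^ 2 = |m + 2 * n| ^ 2
      + (m * T) ^ 2 := by
  rw [Complex.sq_norm, Complex.normSq_apply, sq_abs]
  simp
  ring

/-- Away from the two shortest vectors, a lattice vector off the imaginary axis is long. -/
lemma lattice_sq_ge {m : ℕ+} {n : ℤ} (h : ¬ (m = 1 ∧ (n = 0 ∨ n = -1))) {T t M : ℝ} (ht : 0 ≤ t)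
    (htT : t ≤ T) (h1 : M ≤ 1 + t ^ 2) (h2 : 4 * M ≤ 9 + t ^ 2) (h3 : 4 * M ≤ 1 + 9 * t ^ 2)
    (ha : (m : ℤ) + 2 * n ≠ 0) :
    4 * M ≤ |((m : ℕ) : ℝ) + 2 * n| ^ 2 + (((m : ℕ) : ℝ) * T) ^ 2 := by
  have htT2 : t ^ 2 ≤ T ^ 2 := by gcongr
  rw [sq_abs, mul_pow]
  have hcast : ((m : ℕ) : ℝ) + 2 * n = (((m : ℤ) + 2 * n : ℤ) : ℝ) := by push_cast; ring
  rw [hcast]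
  have hT2 : 0 ≤ t ^ 2 := sq_nonneg t
  have hsq : ∀ c : ℤ, 0 < c → (c ≤ (m : ℤ) + 2 * n ∨ (m : ℤ) + 2 * n ≤ -c) →
      (c : ℝ) ^ 2 ≤ (((m : ℤ) + 2 * n : ℤ) : ℝ) ^ 2 := by
    intro c hc hh
    have : c ^ 2 ≤ ((m : ℤ) + 2 * n) ^ 2 := by
      rcases hh with hh | hh <;> nlinarith
    exact_mod_cast this
  have hm0 : 0 < (m : ℕ) := m.pos
  rcases (by omega : (m : ℕ) = 1 ∨ (m : ℕ) = 2 ∨ 3 ≤ (m : ℕ)) with hm | hm | hm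
  · have hn : n ≠ 0 ∧ n ≠ -1 := by
      have : m = 1 := PNat.coe_injective hm
      tauto
    have := hsq 3 (by norm_num) (by omega)
    rw [hm] at this ⊢
    push_cast at this ⊢
    linarith
  · have := hsq 2 (by norm_num) (by omega)
    rw [hm] at this ⊢
    push_cast at this ⊢
    linarith
  · have := hsq 1 (by norm_num) (by omega)
    have h3' : (3 : ℝ) ≤ (m : ℕ) := by exact_mod_cast hm
    have h9 : (9 : ℝ) ≤ ((m : ℕ) : ℝ) ^ 2 := by nlinarith
    have : 9 * t ^ 2 ≤ ((m : ℕ) : ℝ) ^ 2 * T ^ 2 := by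
      apply mul_le_mul h9 htT2 hT2 (by positivity)
    push_cast at *
    linarith

lemma lattice_term_le {p : ℕ} {m : ℕ+} {n : ℤ} (h : ¬ (m = 1 ∧ (n = 0 ∨ n = -1))) {T t M : ℝ}
    (ht : 0 < t) (htT : t ≤ T) (hM : 0 < M) (h1 : M ≤ 1 + t ^ 2) (h2 : 4 * M ≤ 9 + t ^ 2)
    (h3 : 4 * M ≤ 1 + 9 * t ^ 2) :
    ‖(((m : ℕ) : ℂ) / 2 + n) * ((((m : ℕ) : ℂ) * (1 / 2 + ((T / 2 : ℝ) : ℂ) * Complex.I) + n)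
        ^ (7 + 2 * p))⁻¹‖
      ≤ 5.872 / (t ^ 4 * M ^ p) * (1 / (((m : ℕ) : ℝ) + 2 * n) ^ 2 * (1 / ((m : ℕ) : ℝ) ^ 4)) := by
  have hN := norm_lattice_sq ((m : ℕ) : ℝ) n T
  have ea : ‖((m : ℕ) : ℂ) / 2 + n‖ = |((m : ℕ) : ℝ) + 2 * n| / 2 := by
    rw [show ((m : ℕ) : ℂ) / 2 + n = (((((m : ℕ) : ℝ) + 2 * n) / 2 : ℝ) : ℂ) by push_cast; ring,
      Complex.norm_real, Real.norm_eq_abs, abs_div, abs_two]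
  rw [norm_mul, norm_inv, norm_pow, ea]
  by_cases ha : (m : ℤ) + 2 * n = 0
  · have : ((m : ℕ) : ℝ) + 2 * n = 0 := by exact_mod_cast ha
    simp [this]
  have hlow := lattice_sq_ge h ht.le htT h1 h2 h3 ha
  have hA : 0 < |((m : ℕ) : ℝ) + 2 * n| := by
    apply abs_pos.2
    exact_mod_cast ha
  push_cast at hN
  rw [← sq_abs (((m : ℕ) : ℝ) + 2 * n)]
  set R := ‖((m : ℕ) : ℂ) * (1 / 2 + ((T / 2 : ℝ) : ℂ) * Complex.I) + n‖ with hR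
  push_cast at hR
  rw [← hR] at hN
  have hR0 : 0 ≤ R := norm_nonneg _
  have h7 := lattice_pow_seven hR0 hN
  have hRM : M ≤ R ^ 2 := by linarith
  set A := |((m : ℕ) : ℝ) + 2 * n|
  have hm : (0 : ℝ) < (m : ℕ) := by exact_mod_cast m.pos
  set μ := ((m : ℕ) : ℝ)
  have hT : 0 < T := by linarith
  have hmul : A ^ 3 * (μ * t) ^ 4 ≤ A ^ 3 * (μ * T) ^ 4 := by gcongr
  have hpow : M ^ p ≤ (R ^ 2) ^ p := by gcongr
  have hprod : 10.9 * (A ^ 3 * (μ * t) ^ 4) / 128 * M ^ p ≤ R ^ (7 + 2 * p) := by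
    rw [pow_add, pow_mul]
    apply mul_le_mul _ hpow (by positivity) (by positivity)
    linarith
  have hpos : 0 < 10.9 * (A ^ 3 * (μ * t) ^ 4) / 128 * M ^ p := by positivity
  calc A / 2 * (R ^ (7 + 2 * p))⁻¹ ≤ A / 2 * (10.9 * (A ^ 3 * (μ * t) ^ 4) / 128 * M ^ p)⁻¹ := by
        gcongr
    _ = 64 / 10.9 / (t ^ 4 * M ^ p) * (1 / A ^ 2 * (1 / μ ^ 4)) := by
        field_simp
        norm_num
    _ ≤ _ := by
        gcongr
        norm_num

lemma lattice_deriv_term_le {p : ℕ} {m : ℕ+} {n : ℤ} (h : ¬ (m = 1 ∧ (n = 0 ∨ n = -1)))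
    {T t M : ℝ} (ht : 0 < t) (htT : t ≤ T) (hM : 0 < M) (h1 : M ≤ 1 + t ^ 2)
    (h2 : 4 * M ≤ 9 + t ^ 2) (h3 : 4 * M ≤ 1 + 9 * t ^ 2) :
    ‖((m : ℕ) : ℂ) * (((m : ℕ) : ℂ) / 2 + n) * ((((m : ℕ) : ℂ) *
        (1 / 2 + ((T / 2 : ℝ) : ℂ) * Complex.I) + n) ^ (8 + 2 * p))⁻¹‖
      ≤ 9.08 / (t ^ 5 * M ^ p) * (1 / (((m : ℕ) : ℝ) + 2 * n) ^ 2 * (1 / ((m : ℕ) : ℝ) ^ 4)) := by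
  have hN := norm_lattice_sq ((m : ℕ) : ℝ) n T
  have ea : ‖((m : ℕ) : ℂ) / 2 + n‖ = |((m : ℕ) : ℝ) + 2 * n| / 2 := by
    rw [show ((m : ℕ) : ℂ) / 2 + n = (((((m : ℕ) : ℝ) + 2 * n) / 2 : ℝ) : ℂ) by push_cast; ring,
      Complex.norm_real, Real.norm_eq_abs, abs_div, abs_two]
  rw [norm_mul, norm_mul, norm_inv, norm_pow, ea, Complex.norm_natCast]
  by_cases ha : (m : ℤ) + 2 * n = 0
  · have : ((m : ℕ) : ℝ) + 2 * n = 0 := by exact_mod_cast ha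
    simp [this]
  have hlow := lattice_sq_ge h ht.le htT h1 h2 h3 ha
  have hA : 0 < |((m : ℕ) : ℝ) + 2 * n| := by
    apply abs_pos.2
    exact_mod_cast ha
  push_cast at hN
  rw [← sq_abs (((m : ℕ) : ℝ) + 2 * n)]
  set R := ‖((m : ℕ) : ℂ) * (1 / 2 + ((T / 2 : ℝ) : ℂ) * Complex.I) + n‖ with hR
  push_cast at hR
  rw [← hR] at hN
  have hR0 : 0 ≤ R := norm_nonneg _
  have h8 := lattice_pow_eight hN
  have hRM : M ≤ R ^ 2 := by linarith
  set A := |((m : ℕ) : ℝ) + 2 * n|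
  have hm : (0 : ℝ) < (m : ℕ) := by exact_mod_cast m.pos
  set μ := ((m : ℕ) : ℝ)
  have hT : 0 < T := by linarith
  have hmul : A ^ 3 * (μ * t) ^ 5 ≤ A ^ 3 * (μ * T) ^ 5 := by gcongr
  have hpow : M ^ p ≤ (R ^ 2) ^ p := by gcongr
  have hprod : 14.1 * (A ^ 3 * (μ * t) ^ 5) / 256 * M ^ p ≤ R ^ (8 + 2 * p) := by
    rw [pow_add, pow_mul]
    apply mul_le_mul _ hpow (by positivity) (by positivity)
    linarith
  have hpos : 0 < 14.1 * (A ^ 3 * (μ * t) ^ 5) / 256 * M ^ p := by positivity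
  calc μ * (A / 2) * (R ^ (8 + 2 * p))⁻¹
      ≤ μ * (A / 2) * (14.1 * (A ^ 3 * (μ * t) ^ 5) / 256 * M ^ p)⁻¹ := by
        gcongr
    _ = 128 / 14.1 / (t ^ 5 * M ^ p) * (1 / A ^ 2 * (1 / μ ^ 4)) := by
        field_simp
        norm_num
    _ ≤ _ := by
        gcongr
        norm_num

lemma neg_two_pi_I_pow {k : ℕ} (hke : Even k) :
    (-2 * Real.pi * Complex.I) ^ k = (-1) ^ (k / 2) * (2 * Real.pi : ℂ) ^ k := by
  obtain ⟨n, rfl⟩ := hke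
  rw [← two_mul, show 2 * n / 2 = n by omega, pow_mul, pow_mul, ← mul_pow]
  congr 1
  linear_combination (4 * Real.pi ^ 2 : ℂ) * Complex.I_sq

lemma eisCoeff_mul_factorial {k : ℕ} (hke : Even k) :
    (eisCoeff k : ℂ) * (k - 1).factorial = (-2 * Real.pi * Complex.I) ^ k := by
  rw [neg_two_pi_I_pow hke, eisCoeff]
  push_cast
  have : ((k - 1).factorial : ℂ) ≠ 0 := by exact_mod_cast (k - 1).factorial_ne_zero
  field_simp

lemma lattice_ne_zero {τ : ℝ} (hτ : 0 < τ) (m : ℕ+) (n : ℤ) :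
    ((m : ℕ) : ℂ) * (1 / 2 + τ * Complex.I) + n ≠ 0 := by
  intro h
  have := congrArg Complex.im h
  simp at this
  exact hτ.ne' this

/-- Partial Lipschitz sums along the rows of the lattice. -/
lemma hasSum_row {k j : ℕ} (hk : 2 ≤ k) (hke : Even k) {τ : ℝ} (hτ : 0 < τ) (m : ℕ+) :
    HasSum (fun n : ℤ => ((k - 1 + j).factorial : ℂ) / (k - 1).factorial
        / (-2 * Real.pi * Complex.I) ^ j *
        ((((m : ℕ) : ℂ) * (1 / 2 + τ * Complex.I) + n) ^ (k + j))⁻¹)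
      (eisCoeff k * Lser (k - 1 + j) ((nome τ : ℂ) ^ (m : ℕ))) := by
  have him : 0 < (((m : ℕ) : ℂ) * (1 / 2 + τ * Complex.I)).im := by
    have : (0 : ℝ) < (m : ℕ) := by exact_mod_cast m.pos
    simp only [Complex.mul_im, Complex.natCast_re, Complex.natCast_im, zero_mul, add_zero]
    rw [half_add_im]
    positivity
  have h := (hasSum_lipschitz (k := k - 1 + j) (by omega) him).mul_left (eisCoeff k : ℂ)
  have hq : Complex.exp (2 * Real.pi * Complex.I * (((m : ℕ) : ℂ) * (1 / 2 + τ * Complex.I)))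
      = (nome τ : ℂ) ^ (m : ℕ) := by
    rw [← cexp_half_add, ← Complex.exp_nat_mul]
    congr 1
    ring
  rw [hq] at h
  refine h.congr_fun fun n => ?_
  have hf : ((k - 1).factorial : ℂ) ≠ 0 := by exact_mod_cast (k - 1).factorial_ne_zero
  have hp : (-2 * Real.pi * Complex.I : ℂ) ≠ 0 := by
    simp [Real.pi_ne_zero]
  have hw := lattice_ne_zero hτ m n
  have hc := eisCoeff_mul_factorial hke
  rw [show k - 1 + j + 1 = k + j by omega]
  have hc' : (eisCoeff k : ℂ) = (-2 * Real.pi * Complex.I) ^ k / (k - 1).factorial := by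
    rw [← hc]; field_simp
  rw [hc']
  generalize (-2 * Real.pi * Complex.I : ℂ) = P at *
  generalize ((m : ℕ) : ℂ) * (1 / 2 + τ * Complex.I) + n = W at *
  rw [mul_pow, pow_add P]
  field_simp

lemma norm_nome_lt_one {τ : ℝ} (hτ : 0 < τ) : ‖(nome τ : ℂ)‖ < 1 := by
  rw [← cexp_half_add]
  exact norm_cexp_lt_one (by rw [half_add_im]; exact hτ)

lemma hasSum_columns (k j : ℕ) (hk : 2 ≤ k) {τ : ℝ} (hτ : 0 < τ) :
    HasSum (fun m : ℕ+ => ((m : ℕ) : ℂ) ^ j * Lser (k - 1 + j) ((nome τ : ℂ) ^ (m : ℕ)))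
      (DR k j τ : ℂ) := by
  rw [← Dser_nome]
  exact hasSum_Lser_Dser (k - 1) j (by omega) (norm_nome_lt_one hτ)

lemma factorial_ratio {k : ℕ} (hk : 2 ≤ k) :
    ((k - 1 + 1).factorial : ℂ) / (k - 1).factorial = k ∧
    ((k - 1 + 2).factorial : ℂ) / (k - 1).factorial = k * (k + 1) := by
  obtain ⟨l, rfl⟩ : ∃ l, k = l + 1 := ⟨k - 1, by omega⟩
  have : (l.factorial : ℂ) ≠ 0 := by exact_mod_cast l.factorial_ne_zero
  simp only [Nat.add_sub_cancel, Nat.factorial_succ]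
  push_cast
  constructor <;> field_simp

lemma exists_lattice_GR {k : ℕ} (hk : 2 ≤ k) (hke : Even k) {τ : ℝ} (hτ : 0 < τ) :
    ∃ S : ℕ+ → ℂ, (∀ m : ℕ+, HasSum (fun n : ℤ => (((m : ℕ) : ℂ) / 2 + n) *
      ((((m : ℕ) : ℂ) * (1 / 2 + τ * Complex.I) + n) ^ (k + 1))⁻¹) (S m)) ∧
      HasSum S ((GR k τ - zr k : ℝ) : ℂ) := by
  have hk0 : (k : ℂ) ≠ 0 := by exact_mod_cast (by omega : k ≠ 0)
  have hπ : (Real.pi : ℂ) ≠ 0 := by exact_mod_cast Real.pi_ne_zero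
  have hf : ((k - 1).factorial : ℂ) ≠ 0 := by exact_mod_cast (k - 1).factorial_ne_zero
  have h0 := hasSum_columns k 0 hk hτ
  have h1 := hasSum_columns k 1 hk hτ
  refine ⟨fun m => eisCoeff k * (((m : ℕ) : ℂ) ^ 0 * Lser (k - 1 + 0) ((nome τ : ℂ) ^ (m : ℕ))
    - 2 * Real.pi * τ / k * (((m : ℕ) : ℂ) ^ 1 * Lser (k - 1 + 1) ((nome τ : ℂ) ^ (m : ℕ)))),
    fun m => ?_, ?_⟩
  · have r0 := hasSum_row (j := 0) hk hke hτ m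
    have r1 := hasSum_row (j := 1) hk hke hτ m
    have h := r0.sub (r1.mul_left (2 * Real.pi * τ / k * ((m : ℕ) : ℂ)))
    rw [(factorial_ratio hk).1] at h
    beta_reduce
    rw [show ∀ x y : ℂ, eisCoeff k * (((m : ℕ) : ℂ) ^ 0 * x
      - 2 * Real.pi * τ / k * (((m : ℕ) : ℂ) ^ 1 * y)) = eisCoeff k * x
        - 2 * Real.pi * τ / k * ((m : ℕ) : ℂ) * (eisCoeff k * y) by intro x y; ring]
    refine h.congr_fun fun n => ?_
    have hw := lattice_ne_zero hτ m n
    have e : ((m : ℕ) : ℂ) / 2 + n = (((m : ℕ) : ℂ) * (1 / 2 + τ * Complex.I) + n)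
        - (m : ℕ) * τ * Complex.I := by ring
    rw [e]
    generalize ((m : ℕ) : ℂ) * (1 / 2 + τ * Complex.I) + n = W at *
    have hI := Complex.I_ne_zero
    simp only [add_zero, pow_zero, pow_one, div_one, div_self hf, one_mul]
    rw [pow_succ]
    field_simp
    linear_combination (-(((m : ℕ) : ℂ) * τ)) * Complex.I_sq
  · have h := (h0.sub (h1.mul_left (2 * Real.pi * τ / k : ℂ))).mul_left (eisCoeff k : ℂ)
    rw [show ((GR k τ - zr k : ℝ) : ℂ) = eisCoeff k * (DR k 0 τ - 2 * Real.pi * τ / k * DR k 1 τ) by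
      rw [GR]; push_cast; ring]
    exact h

lemma exists_lattice_GR' {k : ℕ} (hk : 2 ≤ k) (hke : Even k) {τ : ℝ} (hτ : 0 < τ) :
    ∃ S : ℕ+ → ℂ, (∀ m : ℕ+, HasSum (fun n : ℤ => ((m : ℕ) : ℂ) * (((m : ℕ) : ℂ) / 2 + n) *
      ((((m : ℕ) : ℂ) * (1 / 2 + τ * Complex.I) + n) ^ (k + 2))⁻¹) (S m)) ∧
      HasSum S (Complex.I * (GR' k τ / (k + 1) : ℝ)) := by
  have hk0 : (k : ℂ) ≠ 0 := by exact_mod_cast (by omega : k ≠ 0)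
  have hk1 : (k + 1 : ℂ) ≠ 0 := by exact_mod_cast (by omega : k + 1 ≠ 0)
  have hπ : (Real.pi : ℂ) ≠ 0 := by exact_mod_cast Real.pi_ne_zero
  have h1 := hasSum_columns k 1 hk hτ
  have h2 := hasSum_columns k 2 hk hτ
  refine ⟨fun m => (-(2 * Real.pi) * Complex.I * eisCoeff k) *
    (1 / k * (((m : ℕ) : ℂ) ^ 1 * Lser (k - 1 + 1) ((nome τ : ℂ) ^ (m : ℕ)))
    - 2 * Real.pi * τ / (k * (k + 1)) *
      (((m : ℕ) : ℂ) ^ 2 * Lser (k - 1 + 2) ((nome τ : ℂ) ^ (m : ℕ)))),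
    fun m => ?_, ?_⟩
  · have r1 := hasSum_row (j := 1) hk hke hτ m
    have r2 := hasSum_row (j := 2) hk hke hτ m
    have h := ((r1.mul_left (1 / k * ((m : ℕ) : ℂ))).sub
      (r2.mul_left (2 * Real.pi * τ / (k * (k + 1)) * ((m : ℕ) : ℂ) ^ 2))).mul_left
        (-(2 * Real.pi) * Complex.I)
    rw [(factorial_ratio hk).1, (factorial_ratio hk).2] at h
    beta_reduce
    rw [show ∀ x y : ℂ, (-(2 * Real.pi) * Complex.I * eisCoeff k) * (1 / k * (((m : ℕ) : ℂ) ^ 1 * x)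
      - 2 * Real.pi * τ / (k * (k + 1)) * (((m : ℕ) : ℂ) ^ 2 * y))
        = (-(2 * Real.pi) * Complex.I) * (1 / k * ((m : ℕ) : ℂ) * (eisCoeff k * x)
        - 2 * Real.pi * τ / (k * (k + 1)) * ((m : ℕ) : ℂ) ^ 2 * (eisCoeff k * y)) by
          intro x y; ring]
    refine h.congr_fun fun n => ?_
    have hw := lattice_ne_zero hτ m n
    have e : ((m : ℕ) : ℂ) / 2 + n = (((m : ℕ) : ℂ) * (1 / 2 + τ * Complex.I) + n)
        - (m : ℕ) * τ * Complex.I := by ring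
    rw [e]
    generalize ((m : ℕ) : ℂ) * (1 / 2 + τ * Complex.I) + n = W at *
    have hI := Complex.I_ne_zero
    rw [show k + 2 = k + 1 + 1 from rfl, pow_succ W (k + 1), pow_one, mul_pow, mul_pow,
      Complex.I_sq]
    field_simp
    ring
  · have h := ((h1.mul_left (1 / k : ℂ)).sub (h2.mul_left
      (2 * Real.pi * τ / (k * (k + 1)) : ℂ))).mul_left (-(2 * Real.pi) * Complex.I * eisCoeff k)
    rw [show (Complex.I * ((GR' k τ / (k + 1) : ℝ) : ℂ)) = (-(2 * Real.pi) * Complex.I * eisCoeff k)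
      * (1 / k * DR k 1 τ - 2 * Real.pi * τ / (k * (k + 1)) * DR k 2 τ) by
      rw [GR']; push_cast; field_simp]
    exact h

lemma inv_half_add_tan {α : ℝ} (hc : Real.cos α ≠ 0) :
    ((1 / 2 : ℂ) + ((Real.tan α / 2 : ℝ) : ℂ) * Complex.I)⁻¹
      = ((2 * Real.cos α : ℝ) : ℂ) * Complex.exp (-(α * Complex.I)) := by
  rw [inv_eq_iff_eq_inv, mul_inv, ← Complex.exp_neg, neg_neg, Complex.exp_mul_I, Real.tan_eq_sin_div_cos]
  have : Complex.cos α ≠ 0 := by exact_mod_cast hc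
  push_cast
  field_simp

lemma inv_half_add_tan_sub_one {α : ℝ} (hc : Real.cos α ≠ 0) :
    ((1 / 2 : ℂ) + ((Real.tan α / 2 : ℝ) : ℂ) * Complex.I - 1)⁻¹
      = -(((2 * Real.cos α : ℝ) : ℂ) * Complex.exp (α * Complex.I)) := by
  rw [inv_eq_iff_eq_inv, inv_neg, mul_inv, ← Complex.exp_neg, ← neg_mul (α : ℂ), Complex.exp_mul_I,
    Complex.cos_neg, Complex.sin_neg, Real.tan_eq_sin_div_cos]
  have : Complex.cos α ≠ 0 := by exact_mod_cast hc
  push_cast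
  field_simp
  ring

lemma main_term_GR {s : ℕ} (hs : Odd s) {α : ℝ} (hc : Real.cos α ≠ 0) :
    (1 / 2 : ℂ) * (((1 / 2 : ℂ) + ((Real.tan α / 2 : ℝ) : ℂ) * Complex.I) ^ s)⁻¹ +
      (1 / 2 - 1 : ℂ) * (((1 / 2 : ℂ) + ((Real.tan α / 2 : ℝ) : ℂ) * Complex.I - 1) ^ s)⁻¹
      = (((2 * Real.cos α) ^ s * Real.cos (s * α) : ℝ) : ℂ) := by
  rw [← inv_pow, ← inv_pow, inv_half_add_tan hc, inv_half_add_tan_sub_one hc, hs.neg_pow, mul_pow,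
    mul_pow, ← Complex.exp_nat_mul, ← Complex.exp_nat_mul]
  push_cast
  generalize Complex.cos α = c
  rw [Complex.cos, show (s : ℂ) * α * Complex.I = s * (α * Complex.I) by ring,
    show -((s : ℂ) * α) * Complex.I = s * -(α * Complex.I) by ring]
  ring

lemma main_term_GR' {s : ℕ} (hs : Even s) {α : ℝ} (hc : Real.cos α ≠ 0) :
    (1 / 2 : ℂ) * (((1 / 2 : ℂ) + ((Real.tan α / 2 : ℝ) : ℂ) * Complex.I) ^ s)⁻¹ +
      (1 / 2 - 1 : ℂ) * (((1 / 2 : ℂ) + ((Real.tan α / 2 : ℝ) : ℂ) * Complex.I - 1) ^ s)⁻¹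
      = Complex.I * ((-((2 * Real.cos α) ^ s * Real.sin (s * α)) : ℝ) : ℂ) := by
  rw [← inv_pow, ← inv_pow, inv_half_add_tan hc, inv_half_add_tan_sub_one hc, hs.neg_pow, mul_pow,
    mul_pow, ← Complex.exp_nat_mul, ← Complex.exp_nat_mul]
  push_cast
  rw [Complex.sin, show (s : ℂ) * α * Complex.I = s * (α * Complex.I) by ring,
    show -((s : ℂ) * α) * Complex.I = s * -(α * Complex.I) by ring]
  linear_combination (1 / 2 * (2 * Complex.cos α) ^ s *
    (Complex.exp (s * -(α * Complex.I)) - Complex.exp (s * (α * Complex.I)))) * Complex.I_sq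

lemma GR_approx {k p : ℕ} (hk : k = 6 + 2 * p) {α : ℝ} (h0 : 0 < α) (h1 : α < Real.pi / 2)
    {t M : ℝ} (ht : 0 < t) (htT : t ≤ Real.tan α) (hM : 0 < M) (hM1 : M ≤ 1 + t ^ 2)
    (hM2 : 4 * M ≤ 9 + t ^ 2) (hM3 : 4 * M ≤ 1 + 9 * t ^ 2) :
    |GR k (Real.tan α / 2) - (zr k + (2 * Real.cos α) ^ (k + 1) * Real.cos ((k + 1) * α))|
      ≤ 3.34 / (t ^ 4 * M ^ p) := by
  have hc := (Real.cos_pos_of_mem_Ioo ⟨by linarith, h1⟩).ne'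
  obtain ⟨S, hS, hT⟩ := exists_lattice_GR (k := k) (by omega) (Nat.even_iff.2 (by omega))
    (τ := Real.tan α / 2) (by linarith)
  have h := norm_hasSum_sub_two_le (D := 5.872 / (t ^ 4 * M ^ p)) (by positivity)
    (fun m n hmn => by
      rw [show k + 1 = 7 + 2 * p by omega]
      exact lattice_term_le hmn ht htT hM hM1 hM2 hM3) hS hT
  have hm := main_term_GR (s := k + 1) (Nat.odd_iff.2 (by omega)) hc
  have e : ((GR k (Real.tan α / 2) - zr k : ℝ) : ℂ)
      - ((2 * Real.cos α) ^ (k + 1) * Real.cos ((k + 1 : ℕ) * α) : ℝ)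
      = ((GR k (Real.tan α / 2) - (zr k + (2 * Real.cos α) ^ (k + 1) * Real.cos ((k + 1) * α)) : ℝ)
        : ℂ) := by
    push_cast
    ring
  rw [← hm] at e
  rw [← Real.norm_eq_abs, ← Complex.norm_real, ← e]
  refine le_of_eq_of_le ?_ (h.trans ?_)
  · congr 2
    simp [sub_eq_add_neg]
  · rw [← mul_div_assoc]
    gcongr
    norm_num

lemma GR'_approx {k p : ℕ} (hk : k = 6 + 2 * p) {α : ℝ} (h0 : 0 < α) (h1 : α < Real.pi / 2)
    {t M : ℝ} (ht : 0 < t) (htT : t ≤ Real.tan α) (hM : 0 < M) (hM1 : M ≤ 1 + t ^ 2)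
    (hM2 : 4 * M ≤ 9 + t ^ 2) (hM3 : 4 * M ≤ 1 + 9 * t ^ 2) :
    |GR' k (Real.tan α / 2) / (k + 1) + (2 * Real.cos α) ^ (k + 2) * Real.sin ((k + 2) * α)|
      ≤ 5.17 / (t ^ 5 * M ^ p) := by
  have hc := (Real.cos_pos_of_mem_Ioo ⟨by linarith, h1⟩).ne'
  obtain ⟨S, hS, hT⟩ := exists_lattice_GR' (k := k) (by omega) (Nat.even_iff.2 (by omega))
    (τ := Real.tan α / 2) (by linarith)
  have h := norm_hasSum_sub_two_le (D := 9.08 / (t ^ 5 * M ^ p)) (by positivity)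
    (fun m n hmn => by
      rw [show k + 2 = 8 + 2 * p by omega]
      exact lattice_deriv_term_le hmn ht htT hM hM1 hM2 hM3) hS hT
  have hm := main_term_GR' (s := k + 2) (Nat.even_iff.2 (by omega)) hc
  have e : Complex.I * ((GR' k (Real.tan α / 2) / (k + 1) : ℝ) : ℂ)
      - Complex.I * ((-((2 * Real.cos α) ^ (k + 2) * Real.sin ((k + 2 : ℕ) * α)) : ℝ) : ℂ)
      = Complex.I * ((GR' k (Real.tan α / 2) / (k + 1)
        + (2 * Real.cos α) ^ (k + 2) * Real.sin ((k + 2) * α) : ℝ) : ℂ) := by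
    push_cast
    ring
  rw [← hm] at e
  have hI (x : ℝ) : |x| = ‖Complex.I * (x : ℂ)‖ := by simp
  rw [hI, ← e]
  refine le_of_eq_of_le ?_ (h.trans ?_)
  · congr 2
    simp [sub_eq_add_neg]
  · rw [← mul_div_assoc]
    gcongr
    norm_num

lemma le_tan_of_two_cos_le {α : ℝ} (h0 : 0 < α) (h1 : α < Real.pi / 2) {C t : ℝ}
    (hC : 2 * Real.cos α ≤ C) (h : C ^ 2 * (1 + t ^ 2) ≤ 4) : t ≤ Real.tan α := by
  have hc := Real.cos_pos_of_mem_Ioo ⟨by linarith, h1⟩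
  refine le_of_sq_le_sq ?_ (Real.tan_pos_of_pos_of_lt_pi_div_two h0 h1).le
  have h2 : Real.tan α ^ 2 = (1 - Real.cos α ^ 2) / Real.cos α ^ 2 := by
    rw [Real.tan_eq_sin_div_cos, div_pow, Real.sin_sq]
  rw [h2, le_div_iff₀ (by positivity)]
  have : (2 * Real.cos α) ^ 2 * (1 + t ^ 2) ≤ 4 := le_trans (by gcongr) h
  linarith

lemma GR_approx_of_two_cos_le {k p n : ℕ} (hk : k = 6 + 2 * p) (hn : n ≤ p) {α : ℝ} (h0 : 0 < α)
    (h1 : α < Real.pi / 2) {C t M : ℝ} (hC : 2 * Real.cos α ≤ C) (ht : 0 < t)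
    (hCt : C ^ 2 * (1 + t ^ 2) ≤ 4) (hM : 1 ≤ M) (hM1 : M ≤ 1 + t ^ 2)
    (hM2 : 4 * M ≤ 9 + t ^ 2) (hM3 : 4 * M ≤ 1 + 9 * t ^ 2) :
    |GR k (Real.tan α / 2) - (zr k + (2 * Real.cos α) ^ (k + 1) * Real.cos ((k + 1) * α))|
      ≤ 3.34 / (t ^ 4 * M ^ n) := by
  refine (GR_approx hk h0 h1 ht (le_tan_of_two_cos_le h0 h1 hC hCt) (by linarith) hM1 hM2 hM3).trans
    ?_
  have : M ^ n ≤ M ^ p := pow_le_pow_right₀ hM hn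
  gcongr

lemma GR'_approx_of_two_cos_le {k p n : ℕ} (hk : k = 6 + 2 * p) (hn : n ≤ p) {α : ℝ} (h0 : 0 < α)
    (h1 : α < Real.pi / 2) {C t M : ℝ} (hC : 2 * Real.cos α ≤ C) (ht : 0 < t)
    (hCt : C ^ 2 * (1 + t ^ 2) ≤ 4) (hM : 1 ≤ M) (hM1 : M ≤ 1 + t ^ 2)
    (hM2 : 4 * M ≤ 9 + t ^ 2) (hM3 : 4 * M ≤ 1 + 9 * t ^ 2) :
    |GR' k (Real.tan α / 2) / (k + 1) + (2 * Real.cos α) ^ (k + 2) * Real.sin ((k + 2) * α)|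
      ≤ 5.17 / (t ^ 5 * M ^ n) := by
  refine (GR'_approx hk h0 h1 ht (le_tan_of_two_cos_le h0 h1 hC hCt) (by linarith) hM1 hM2
    hM3).trans ?_
  have : M ^ n ≤ M ^ p := pow_le_pow_right₀ hM hn
  gcongr

lemma two_cos_le {α δ : ℝ} (hδ0 : 0 ≤ δ) (hδ : δ ≤ 0.35) (hα : Real.pi / 3 - δ ≤ α)
    (h1 : α < Real.pi / 2) : 2 * Real.cos α ≤ 1 + 1.7321 * δ - 0.49 * δ ^ 2 := by
  have hpi := Real.pi_gt_three
  have h := Real.cos_le_cos_of_nonneg_of_le_pi (x := Real.pi / 3 - δ) (y := α) (by linarith)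
    (by linarith) hα
  have e : 2 * Real.cos (Real.pi / 3 - δ) = Real.cos δ + √3 * Real.sin δ := by
    rw [Real.cos_sub, Real.cos_pi_div_three, Real.sin_pi_div_three]; ring
  have hc := (abs_le.1 (Real.cos_bound (x := δ) (by rw [abs_of_nonneg hδ0]; linarith))).2
  rw [abs_of_nonneg hδ0] at hc
  have h3 : √3 ≤ 1.7321 := Real.sqrt_le_iff.2 (by norm_num)
  have hs : √3 * Real.sin δ ≤ 1.7321 * δ :=
    mul_le_mul h3 (Real.sin_le hδ0) (Real.sin_nonneg_of_nonneg_of_le_pi hδ0 (by linarith))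
      (by norm_num)
  have h4 : δ ^ 4 ≤ 0.1225 * δ ^ 2 := by nlinarith [mul_nonneg (sq_nonneg δ) (by nlinarith : 0 ≤ 0.1225 - δ ^ 2)]
  nlinarith [sq_nonneg δ]

lemma two_cos_le_one {α : ℝ} (h0 : Real.pi / 3 ≤ α) (h1 : α < Real.pi / 2) :
    2 * Real.cos α ≤ 1 := by
  have := two_cos_le (δ := 0) le_rfl (by norm_num) (by linarith) h1
  linarith

lemma one_le_two_cos {α : ℝ} (h0 : 0 ≤ α) (h1 : α ≤ Real.pi / 3) : 1 ≤ 2 * Real.cos α := by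
  have hpi := Real.pi_gt_three
  have h := Real.cos_le_cos_of_nonneg_of_le_pi h0 (by linarith) h1
  rw [Real.cos_pi_div_three] at h
  linarith

lemma pow_two_cos_ge {s n : ℕ} (hn : 1 ≤ n) (hs : n ≤ s) {α v : ℝ} (h0 : 0 ≤ α) (hv0 : 0 < v)
    (hvn : v ≤ 0.15 * n) (hv : v ≤ s * (Real.pi / 3 - α)) :
    1 + 1.64 * v + (1 - 1 / n) / 2 * (1.64 * v) ^ 2 ≤ (2 * Real.cos α) ^ s := by
  have hpi := Real.pi_gt_three
  have hn' : (1 : ℝ) ≤ n := by exact_mod_cast hn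
  have hs' : (n : ℝ) ≤ s := by exact_mod_cast hs
  have hsp : (0 : ℝ) < s := by linarith
  have hδ : v / s ≤ 0.15 := by rw [div_le_iff₀ hsp]; linarith
  have hδα : v / s ≤ Real.pi / 3 - α := by rw [div_le_iff₀ hsp]; linarith
  have h := Real.cos_le_cos_of_nonneg_of_le_pi (x := α) (y := Real.pi / 3 - v / s) h0
    (by have : 0 < v / s := by positivity
        linarith) (by linarith)
  have hc := two_cos_ge (δ := v / s) (by positivity) hδ
  have hB := one_add_pow_ge_sq (w := 1.64 * (v / s)) (by positivity) s
  have e : s * ((s : ℝ) - 1) / 2 * (1.64 * (v / s)) ^ 2 = (1 - 1 / s) / 2 * (1.64 * v) ^ 2 := by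
    field_simp
  have e2 : s * (1.64 * (v / s)) = 1.64 * v := by field_simp
  rw [e, e2] at hB
  calc _ ≤ 1 + 1.64 * v + (1 - 1 / s) / 2 * (1.64 * v) ^ 2 := by gcongr
    _ ≤ _ := hB
    _ ≤ _ := by gcongr; linarith

lemma pow_two_cos_le {s : ℕ} {α φ : ℝ} (h1 : α < Real.pi / 2) (hφ0 : 0 < φ)
    (hφs : φ ≤ 0.3 * s) (hφ : φ ≤ s * (α - Real.pi / 3)) :
    (2 * Real.cos α) ^ s ≤ (1 + 1.7 * φ)⁻¹ := by
  have hpi := Real.pi_gt_three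
  have hsp : (0 : ℝ) < s := by
    rcases Nat.eq_zero_or_pos s with rfl | h
    · norm_num at hφs; linarith
    · exact_mod_cast h
  set δ := φ / s with hδd
  have hδ0 : 0 < δ := by positivity
  have hδ : δ ≤ 0.3 := by rw [hδd, div_le_iff₀ hsp]; linarith
  have hδα : δ ≤ α - Real.pi / 3 := by rw [hδd, div_le_iff₀ hsp]; linarith
  have h := Real.cos_le_cos_of_nonneg_of_le_pi (x := Real.pi / 3 + δ) (y := α) (by linarith)
    (by linarith) (by linarith)
  have e : 2 * Real.cos (Real.pi / 3 + δ) = Real.cos δ - √3 * Real.sin δ := by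
    rw [Real.cos_add, Real.cos_pi_div_three, Real.sin_pi_div_three]; ring
  have h3 : (1.732 : ℝ) ≤ √3 := Real.le_sqrt_of_sq_le (by norm_num)
  have hs := Real.sin_gt_sub_cube hδ0
  have hd : 0 ≤ 0.09 - δ ^ 2 := by nlinarith
  have h4 : 1.732 * (δ - δ ^ 3 / 6) ≤ √3 * Real.sin δ :=
    mul_le_mul h3 hs.le (by nlinarith [mul_nonneg hδ0.le hd]) (by positivity)
  have h5 : 2 * Real.cos α ≤ 1 - 1.7 * δ := by
    nlinarith [mul_nonneg hδ0.le hd, Real.cos_le_one δ]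
  have hc := Real.cos_pos_of_mem_Ioo (x := α) ⟨by linarith, h1⟩
  have h6 : 2 * Real.cos α ≤ (1 + 1.7 * δ)⁻¹ := by
    rw [le_inv_comm₀ (by positivity) (by positivity), ← one_div, le_div_iff₀ (by positivity)]
    nlinarith
  calc (2 * Real.cos α) ^ s ≤ ((1 + 1.7 * δ)⁻¹) ^ s := by gcongr
    _ = ((1 + 1.7 * δ) ^ s)⁻¹ := inv_pow _ _
    _ ≤ _ := by
      refine inv_anti₀ (by positivity) ?_
      have := one_add_mul_le_pow (a := 1.7 * δ) (by linarith) s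
      have e : s * (1.7 * δ) = 1.7 * φ := by rw [hδd]; field_simp
      linarith

lemma half_le_sin {x : ℝ} (h0 : Real.pi / 6 ≤ x) (h1 : x ≤ 5 * Real.pi / 6) :
    1 / 2 ≤ Real.sin x := by
  have hpi := Real.pi_pos
  rcases le_total x (Real.pi / 2) with h | h
  · rw [← Real.sin_pi_div_six]
    exact Real.sin_le_sin_of_le_of_le_pi_div_two (by linarith) h h0
  · rw [← Real.sin_pi_div_six, ← Real.sin_pi_sub x]
    exact Real.sin_le_sin_of_le_of_le_pi_div_two (by linarith) (by linarith) (by linarith)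

lemma zr_le_of_eight_le {k : ℕ} (hk : 8 ≤ k) : zr k ≤ 1.0052 := by
  refine (zr_anti (by norm_num) hk).trans ?_
  have h4 : Summable fun n : ℕ => 1 / (n : ℝ) ^ 4 := Real.summable_one_div_nat_pow.2 (by norm_num)
  have h : zr 8 ≤ ∑' n : ℕ, (1 / 16 * (1 / (n : ℝ) ^ 4) + if n = 1 then 15 / 16 else 0) := by
    refine Summable.tsum_le_tsum (fun n => ?_) (Real.summable_one_div_nat_pow.2 (by norm_num))
      ((h4.mul_left _).add (hasSum_ite_eq 1 _).summable)
    rcases Nat.lt_or_ge n 2 with h | h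
    · interval_cases n <;> norm_num
    · rw [if_neg (by omega)]
      have h2 : (2 : ℝ) ≤ n := by exact_mod_cast h
      have : (2 : ℝ) ^ 4 ≤ (n : ℝ) ^ 4 := by gcongr
      rw [show (n : ℝ) ^ 8 = n ^ 4 * n ^ 4 by ring, add_zero, ← one_div_mul_one_div]
      gcongr
      norm_num at this ⊢
      exact this
  rw [Summable.tsum_add (h4.mul_left _) (hasSum_ite_eq 1 _).summable, tsum_mul_left, tsum_ite_eq] at h
  have := zr_four_lt
  rw [zr] at this
  linarith

lemma hasDerivAt_GR_tan (k : ℕ) {α : ℝ} (h0 : 0 < α) (h1 : α < Real.pi / 2) :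
    HasDerivAt (fun α => GR k (Real.tan α / 2))
      (GR' k (Real.tan α / 2) * (1 / Real.cos α ^ 2 / 2)) α := by
  have ht := Real.tan_pos_of_pos_of_lt_pi_div_two h0 h1
  have hc := Real.cos_pos_of_mem_Ioo (x := α) ⟨by linarith, h1⟩
  exact (hasDerivAt_GR k (by positivity)).comp α ((Real.hasDerivAt_tan hc.ne').div_const 2)

lemma strictMonoOn_GR_tan {k : ℕ} {a b : ℝ} (ha : 0 < a) (hb : b < Real.pi / 2)
    (h : ∀ α ∈ Set.Icc a b, 0 < GR' k (Real.tan α / 2)) :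
    StrictMonoOn (fun α => GR k (Real.tan α / 2)) (Set.Icc a b) := by
  refine strictMonoOn_of_deriv_pos (convex_Icc a b) (fun x hx =>
    (hasDerivAt_GR_tan k (ha.trans_le hx.1) (hx.2.trans_lt hb)).continuousAt.continuousWithinAt)
    fun x hx => ?_
  rw [interior_Icc] at hx
  have hx' := Set.Ioo_subset_Icc_self hx
  have hc := Real.cos_pos_of_mem_Ioo (x := x) ⟨by linarith [hx.1, Real.pi_pos], hx.2.trans hb⟩
  rw [(hasDerivAt_GR_tan k (ha.trans hx.1) (hx.2.trans hb)).deriv]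
  have := h x hx'
  positivity

lemma strictAntiOn_GR_tan {k : ℕ} {a b : ℝ} (ha : 0 < a) (hb : b < Real.pi / 2)
    (h : ∀ α ∈ Set.Icc a b, GR' k (Real.tan α / 2) < 0) :
    StrictAntiOn (fun α => GR k (Real.tan α / 2)) (Set.Icc a b) := by
  refine strictAntiOn_of_deriv_neg (convex_Icc a b) (fun x hx =>
    (hasDerivAt_GR_tan k (ha.trans_le hx.1) (hx.2.trans_lt hb)).continuousAt.continuousWithinAt)
    fun x hx => ?_
  rw [interior_Icc] at hx
  have hx' := Set.Ioo_subset_Icc_self hx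
  have hc := Real.cos_pos_of_mem_Ioo (x := x) ⟨by linarith [hx.1, Real.pi_pos], hx.2.trans hb⟩
  rw [(hasDerivAt_GR_tan k (ha.trans hx.1) (hx.2.trans hb)).deriv]
  have := h x hx'
  exact mul_neg_of_neg_of_pos this (by positivity)

lemma continuousOn_GR_tan (k : ℕ) {a b : ℝ} (ha : 0 < a) (hb : b < Real.pi / 2) :
    ContinuousOn (fun α => GR k (Real.tan α / 2)) (Set.Icc a b) := fun _ hx =>
  (hasDerivAt_GR_tan k (ha.trans_le hx.1) (hx.2.trans_lt hb)).continuousAt.continuousWithinAt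

lemma exists_unique_zero_of_strictMonoOn {F : ℝ → ℝ} {a b : ℝ} (hab : a ≤ b)
    (hF : ContinuousOn F (Set.Icc a b)) (hm : StrictMonoOn F (Set.Icc a b)) (ha : F a < 0)
    (hb : 0 < F b) : ∃ x, a < x ∧ x < b ∧ ∀ y ∈ Set.Icc a b, F y = 0 ↔ y = x := by
  obtain ⟨x, hx, hx0⟩ := intermediate_value_Icc hab hF ⟨ha.le, hb.le⟩
  refine ⟨x, lt_of_le_of_ne hx.1 ?_, lt_of_le_of_ne hx.2 ?_, fun y hy => ⟨fun h => ?_, ?_⟩⟩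
  · rintro rfl; linarith
  · rintro rfl; linarith
  · exact hm.injOn hy hx (h.trans hx0.symm)
  · rintro rfl; exact hx0

lemma cos_nat_two_pi_add {x y : ℝ} (m : ℕ) (h : x = m * (2 * Real.pi) + y) :
    Real.cos x = Real.cos y := by
  rw [h, add_comm, Real.cos_add_nat_mul_two_pi]

lemma sin_nat_two_pi_add {x y : ℝ} (m : ℕ) (h : x = m * (2 * Real.pi) + y) :
    Real.sin x = Real.sin y := by
  rw [h, add_comm, Real.sin_add_nat_mul_two_pi]

lemma GR_tan_pos_of_pi_div_three_le {k : ℕ} (hk : 6 ≤ k) (hke : Even k) {α : ℝ}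
    (h0 : Real.pi / 3 ≤ α) (h1 : α < Real.pi / 2)
    (h : 1 / 2 ≤ ((k : ℝ) + 1) * (α - Real.pi / 3) ∨ 0 ≤ Real.cos ((k + 1) * α)) :
    0 < GR k (Real.tan α / 2) := by
  have hpi := Real.pi_gt_three
  have hk' : (6 : ℝ) ≤ k := by exact_mod_cast hk
  have hc := Real.cos_pos_of_mem_Ioo (x := α) ⟨by linarith, h1⟩
  have hz := one_le_zr (k := k) (by omega)
  have hA := (abs_le.1 (GR_approx_of_two_cos_le (k := k) (p := (k - 6) / 2) (n := 0)
    (by obtain ⟨r, rfl⟩ := hke; omega) (by omega) (by linarith) h1 (t := 1.7) (M := 1)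
    (two_cos_le_one h0 h1) (by norm_num) (by norm_num) (by norm_num) (by norm_num) (by norm_num)
    (by norm_num))).1
  norm_num at hA
  rcases h with h | h
  · have hp := pow_two_cos_le (s := k + 1) (φ := 1 / 2) h1 (by norm_num)
      (by push_cast; linarith) (by push_cast; exact h)
    norm_num at hp
    have : -(2 * Real.cos α) ^ (k + 1) ≤ (2 * Real.cos α) ^ (k + 1) * Real.cos ((k + 1) * α) := by
      have := Real.neg_one_le_cos ((k + 1) * α)
      have hq : 0 < (2 * Real.cos α) ^ (k + 1) := by positivity
      nlinarith
    linarith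
  · have : 0 ≤ (2 * Real.cos α) ^ (k + 1) * Real.cos ((k + 1) * α) := by positivity
    linarith

lemma gR_ne_zero_of_mod_zero {k m : ℕ} (hm : 1 ≤ m) (hk : k = 6 * m) {α : ℝ}
    (h0 : samp k (2 * m) ≤ α) (h1 : α < Real.pi / 2) : gR k α ≠ 0 := by
  have hpi := Real.pi_gt_three
  have hpi4 := Real.pi_lt_d2
  have hα : 0 < α := (samp_pos (by omega)).trans_le h0
  have hke : Even k := Nat.even_iff.2 (by omega)
  rw [Ne, gR_eq_zero_iff_GR (by omega) hke hα h1]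
  refine ne_of_gt ?_
  have hkr : (k : ℝ) = 6 * m := by rw [hk]; push_cast; ring
  have hm' : (1 : ℝ) ≤ m := by exact_mod_cast hm
  have hcos := cos_nat_two_pi_add (x := (k + 1) * α) (y := (k + 1) * α - m * (2 * Real.pi)) m (by ring)
  have hθ : 0 ≤ (k + 1) * α - m * (2 * Real.pi) := by
    rw [samp, div_le_iff₀ (by positivity)] at h0
    push_cast at h0
    linarith
  rcases le_total α (Real.pi / 3) with h | h
  · have hA := (abs_le.1 (GR_approx_of_two_cos_le (k := k) (p := (k - 6) / 2) (n := 0)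
      (by omega) (by omega) hα h1 (t := 1.25) (M := 1)
      (two_cos_le (δ := 0.15) (by norm_num) (by norm_num) (by nlinarith) h1)
      (by norm_num) (by norm_num) (by norm_num) (by norm_num) (by norm_num) (by norm_num))).1
    norm_num at hA
    have hz := one_le_zr (k := k) (by omega)
    have hc2 : 1 / 2 ≤ Real.cos ((k + 1) * α) := by
      rw [hcos, ← Real.cos_pi_div_three]
      exact Real.cos_le_cos_of_nonneg_of_le_pi hθ (by linarith) (by rw [hkr]; nlinarith)
    have hp : 1 ≤ (2 * Real.cos α) ^ (k + 1) := one_le_pow₀ (one_le_two_cos hα.le h)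
    nlinarith
  · refine GR_tan_pos_of_pi_div_three_le (by omega) hke h h1 ?_
    rcases le_total (1 / 2) (((k : ℝ) + 1) * (α - Real.pi / 3)) with h' | h'
    · exact Or.inl h'
    · refine Or.inr ?_
      rw [hcos]
      exact Real.cos_nonneg_of_neg_pi_div_two_le_of_le (by linarith) (by rw [hkr] at h' ⊢; nlinarith)

lemma exists_zero_of_mod_four {k m : ℕ} (hm : 1 ≤ m) (hk : k = 6 * m + 4) :
    ∃ β, samp k (2 * m + 1) < β ∧ β < Real.pi / 3 ∧
      ∀ α, samp k (2 * m + 1) ≤ α → α < Real.pi / 2 → (gR k α = 0 ↔ α = β) := by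
  have hpi := Real.pi_gt_three
  have hpi4 := Real.pi_lt_d2
  have hke : Even k := Nat.even_iff.2 (by omega)
  have hkr : (k : ℝ) = 6 * m + 4 := by rw [hk]; push_cast; ring
  have hm' : (1 : ℝ) ≤ m := by exact_mod_cast hm
  set a := samp k (2 * m + 1) with ha
  have ha0 : 0 < a := samp_pos (by omega)
  have has : (k + 1) * a = (2 * m + 1) * Real.pi := by
    rw [ha, samp]; push_cast; field_simp
  set b := Real.pi / 3 - Real.pi / (6 * (k + 1)) with hb
  have hbs : (k + 1) * b = (k + 1) * (Real.pi / 3) - Real.pi / 6 := by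
    rw [hb]; field_simp
  have hk1 : (0 : ℝ) < k + 1 := by positivity
  have hab : a ≤ b := by
    refine le_of_mul_le_mul_left ?_ hk1
    rw [has, hbs, hkr]; nlinarith
  have hb3 : b < Real.pi / 3 := by
    have : 0 < Real.pi / (6 * (k + 1)) := by positivity
    linarith
  have hcos (α : ℝ) : Real.cos ((k + 1) * α) = Real.cos ((k + 1) * (Real.pi / 3 - α) + Real.pi / 3) := by
    rw [← Real.cos_neg ((k + 1) * (Real.pi / 3 - α) + Real.pi / 3)]
    exact cos_nat_two_pi_add (m + 1) (by rw [hkr]; push_cast; ring)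
  have hsin (α : ℝ) : Real.sin ((k + 2) * α) = -Real.sin ((k + 2) * (Real.pi / 3 - α)) := by
    rw [← Real.sin_neg ((k + 2) * (Real.pi / 3 - α))]
    exact sin_nat_two_pi_add (m + 1) (by rw [hkr]; push_cast; ring)
  have hC : ∀ α, a ≤ α → α < Real.pi / 2 →
      2 * Real.cos α ≤ 1 + 1.7321 * 0.191 - 0.49 * 0.191 ^ 2 := fun α h0 h1 => by
    refine two_cos_le (by norm_num) (by norm_num) (le_trans ?_ h0) h1
    refine le_of_mul_le_mul_left ?_ hk1
    rw [has, hkr]; nlinarith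
  have hGa : ∀ α, a ≤ α → α < Real.pi / 2 →
      |GR k (Real.tan α / 2) - (zr k + (2 * Real.cos α) ^ (k + 1) * Real.cos ((k + 1) * α))| ≤ 0.37 :=
    fun α h0 h1 => by
    refine (GR_approx_of_two_cos_le (k := k) (p := (k - 6) / 2) (n := 2)
      (by omega) (by omega) (ha0.trans_le h0) h1 (t := 1.145) (M := 2.3) (hC α h0 h1)
      (by norm_num) (by norm_num) (by norm_num) (by norm_num) (by norm_num) (by norm_num)).trans ?_
    norm_num
  have hGa' : ∀ α, a ≤ α → α < Real.pi / 2 →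
      |GR' k (Real.tan α / 2) / (k + 1) + (2 * Real.cos α) ^ (k + 2) * Real.sin ((k + 2) * α)|
       ≤ 0.5 :=
    fun α h0 h1 => by
    refine (GR'_approx_of_two_cos_le (k := k) (p := (k - 6) / 2) (n := 2)
      (by omega) (by omega) (ha0.trans_le h0) h1 (t := 1.145) (M := 2.3) (hC α h0 h1)
      (by norm_num) (by norm_num) (by norm_num) (by norm_num) (by norm_num) (by norm_num)).trans ?_
    norm_num
  have hpow : ∀ α, a ≤ α → α ≤ b → 2.1 ≤ (2 * Real.cos α) ^ (k + 1) := fun α h0 h1 => by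
    refine le_trans ?_ (pow_two_cos_ge (s := k + 1) (n := 11) (v := 0.5) (by norm_num) (by omega)
      (ha0.le.trans h0) (by norm_num) (by norm_num) ?_)
    · norm_num
    · push_cast
      have := mul_le_mul_of_nonneg_left h1 hk1.le
      rw [hbs] at this
      linarith
  have hpos : ∀ α, b ≤ α → α < Real.pi / 2 → 0 < GR k (Real.tan α / 2) := fun α h0 h1 => by
    have hbα := mul_le_mul_of_nonneg_left h0 hk1.le
    rw [hbs] at hbα
    have hcosn : ((k : ℝ) + 1) * (α - Real.pi / 3) ≤ 1 / 2 → 0 ≤ Real.cos ((k + 1) * α) := fun h' => by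
      rw [hcos]
      exact Real.cos_nonneg_of_neg_pi_div_two_le_of_le (by linarith) (by linarith)
    rcases le_total α (Real.pi / 3) with h | h
    · have hA := (abs_le.1 (hGa α (hab.trans h0) h1)).1
      have hz := one_le_zr (k := k) (by omega)
      have hcn := hcosn (by nlinarith)
      have hc := Real.cos_pos_of_mem_Ioo (x := α) ⟨by linarith, h1⟩
      have : 0 ≤ (2 * Real.cos α) ^ (k + 1) * Real.cos ((k + 1) * α) := by positivity
      linarith
    · refine GR_tan_pos_of_pi_div_three_le (by omega) hke h h1 ?_
      rcases le_total (1 / 2) (((k : ℝ) + 1) * (α - Real.pi / 3)) with h' | h'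
      · exact Or.inl h'
      · exact Or.inr (hcosn h')
  have hmono : StrictMonoOn (fun α => GR k (Real.tan α / 2)) (Set.Icc a b) := by
    refine strictMonoOn_GR_tan ha0 (by linarith) fun α hα => ?_
    have h2 : α < Real.pi / 2 := by linarith [hα.2]
    have hA := (abs_le.1 (hGa' α hα.1 h2)).1
    have h3 := hpow α hα.1 hα.2
    have h4 : (2 * Real.cos α) ^ (k + 1) ≤ (2 * Real.cos α) ^ (k + 2) :=
      pow_le_pow_right₀ (one_le_two_cos (by linarith [hα.1]) (by linarith [hα.2])) (by omega)
    have hbα := mul_le_mul_of_nonneg_left hα.2 hk1.le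
    have haα := mul_le_mul_of_nonneg_left hα.1 hk1.le
    rw [hbs] at hbα
    rw [has] at haα
    have h5 : 1 / 2 ≤ Real.sin ((k + 2) * (Real.pi / 3 - α)) := by
      refine half_le_sin (by linarith [hα.2]) ?_
      have : (k + 1) * (Real.pi / 3 - α) ≤ 2 * Real.pi / 3 := by rw [hkr] at haα ⊢; linarith
      have h6 : (k + 1) * (Real.pi / 3 - α) ≤ (k + 1) * (Real.pi / 6) := by
        rw [hkr] at this ⊢; nlinarith
      have := le_of_mul_le_mul_left h6 hk1
      linarith
    rw [hsin] at hA
    have h6 : 0 < GR' k (Real.tan α / 2) / (k + 1) := by nlinarith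
    exact (div_pos_iff_of_pos_right hk1).1 h6
  have hneg : GR k (Real.tan a / 2) < 0 := by
    have hA := (abs_le.1 (hGa a le_rfl (by linarith))).2
    have h3 := hpow a le_rfl hab
    have hz : zr k ≤ 1.0824 := (zr_anti (by norm_num) (by omega)).trans zr_four_lt.le
    have : Real.cos ((k + 1) * a) = -1 := by
      rw [has, cos_nat_two_pi_add m (y := Real.pi) (by ring), Real.cos_pi]
    rw [this] at hA
    linarith
  obtain ⟨x, hax, hxb, hx⟩ := exists_unique_zero_of_strictMonoOn hab
    (continuousOn_GR_tan k ha0 (by linarith)) hmono hneg (hpos b le_rfl (by linarith))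
  refine ⟨x, hax, hxb.trans hb3, fun α h0 h1 => ?_⟩
  rw [gR_eq_zero_iff_GR (by omega) hke (ha0.trans_le h0) h1]
  rcases le_total α b with h | h
  · exact hx α ⟨h0, h⟩
  · refine iff_of_false (hpos α h h1).ne' ?_
    rintro rfl
    linarith

lemma cos_of_mod_two {k m : ℕ} (hk : k = 6 * m + 2) (α : ℝ) :
    Real.cos ((k + 1) * α) = -Real.cos ((k + 1) * (Real.pi / 3 - α)) := by
  have hkr : (k : ℝ) = 6 * m + 2 := by rw [hk]; push_cast; ring
  rw [← Real.cos_pi_sub]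
  exact cos_nat_two_pi_add m (by rw [hkr]; ring)

lemma sin_of_mod_two {k m : ℕ} (hk : k = 6 * m + 2) (α : ℝ) :
    Real.sin ((k + 2) * α) = Real.sin ((k + 1) * (Real.pi / 3 - α) - α) := by
  have hkr : (k : ℝ) = 6 * m + 2 := by rw [hk]; push_cast; ring
  rw [← Real.sin_pi_sub (_ - α)]
  exact sin_nat_two_pi_add m (by rw [hkr]; ring)

lemma two_cos_le_of_nine_le {k : ℕ} (hk : 8 ≤ k) {α b : ℝ} (h1 : α < Real.pi / 2)
    (hb0 : 0 ≤ b) (hb : b ≤ 3.15) (hv : ((k : ℝ) + 1) * (Real.pi / 3 - α) ≤ b) :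
    2 * Real.cos α ≤ 1 + 1.7321 * (b / 9) - 0.49 * (b / 9) ^ 2 := by
  have hk' : (8 : ℝ) ≤ k := by exact_mod_cast hk
  refine two_cos_le (by positivity) (by linarith) ?_ h1
  have h : ((k : ℝ) + 1) * (Real.pi / 3 - α) ≤ (k + 1) * (b / 9) := by
    refine hv.trans ?_
    nlinarith
  linarith [le_of_mul_le_mul_left h (by positivity)]

lemma GR_approx_of_mod_two {k m : ℕ} (hm : 1 ≤ m) (hk : k = 6 * m + 2) {α : ℝ} (h0 : 0 < α)
    (h1 : α < Real.pi / 2) {b t M ε : ℝ} (hb0 : 0 ≤ b) (hb : b ≤ 3.15)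
    (hv : ((k : ℝ) + 1) * (Real.pi / 3 - α) ≤ b) (ht : 0 < t)
    (hCt : (1 + 1.7321 * (b / 9) - 0.49 * (b / 9) ^ 2) ^ 2 * (1 + t ^ 2) ≤ 4) (hM : 1 ≤ M)
    (hM1 : M ≤ 1 + t ^ 2) (hM2 : 4 * M ≤ 9 + t ^ 2) (hM3 : 4 * M ≤ 1 + 9 * t ^ 2)
    (hε : 3.34 / (t ^ 4 * M) ≤ ε) :
    |GR k (Real.tan α / 2) -
      (zr k - (2 * Real.cos α) ^ (k + 1) * Real.cos ((k + 1) * (Real.pi / 3 - α)))| ≤ ε := by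
  have h := GR_approx_of_two_cos_le (k := k) (p := (k - 6) / 2) (n := 1) (by omega) (by omega) h0 h1
    (two_cos_le_of_nine_le (by omega) h1 hb0 hb hv) ht hCt hM hM1 hM2 hM3
  rw [pow_one, cos_of_mod_two hk, mul_neg, ← sub_eq_add_neg] at h
  exact h.trans hε

lemma GR'_approx_of_mod_two {k m : ℕ} (hm : 1 ≤ m) (hk : k = 6 * m + 2) {α : ℝ} (h0 : 0 < α)
    (h1 : α < Real.pi / 2) {b t M ε : ℝ} (hb0 : 0 ≤ b) (hb : b ≤ 3.15)
    (hv : ((k : ℝ) + 1) * (Real.pi / 3 - α) ≤ b) (ht : 0 < t)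
    (hCt : (1 + 1.7321 * (b / 9) - 0.49 * (b / 9) ^ 2) ^ 2 * (1 + t ^ 2) ≤ 4) (hM : 1 ≤ M)
    (hM1 : M ≤ 1 + t ^ 2) (hM2 : 4 * M ≤ 9 + t ^ 2) (hM3 : 4 * M ≤ 1 + 9 * t ^ 2)
    (hε : 5.17 / (t ^ 5 * M) ≤ ε) :
    |GR' k (Real.tan α / 2) / (k + 1) +
      (2 * Real.cos α) ^ (k + 2) * Real.sin ((k + 1) * (Real.pi / 3 - α) - α)| ≤ ε := by
  have h := GR'_approx_of_two_cos_le (k := k) (p := (k - 6) / 2) (n := 1) (by omega) (by omega) h0 h1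
    (two_cos_le_of_nine_le (by omega) h1 hb0 hb hv) ht hCt hM hM1 hM2 hM3
  rw [pow_one, sin_of_mod_two hk] at h
  exact h.trans hε

lemma pow_two_cos_ge_of_nine_le {k : ℕ} (hk : 8 ≤ k) {α a : ℝ} (h0 : 0 ≤ α) (ha0 : 0 < a)
    (ha : a ≤ 1.35) (hv : a ≤ ((k : ℝ) + 1) * (Real.pi / 3 - α)) :
    1 + 1.64 * a + 4 / 9 * (1.64 * a) ^ 2 ≤ (2 * Real.cos α) ^ (k + 1) := by
  have := pow_two_cos_ge (s := k + 1) (n := 9) (v := a) (by norm_num) (by omega) h0 ha0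
    (by norm_num; linarith) (by push_cast; exact hv)
  norm_num at this ⊢
  exact this

lemma GR_neg_of_mod_two {k m : ℕ} (hm : 1 ≤ m) (hk : k = 6 * m + 2) {α : ℝ} (h0 : 0 < α)
    (h1 : α < Real.pi / 2) (hv0 : 0.25 ≤ ((k : ℝ) + 1) * (Real.pi / 3 - α))
    (hv1 : ((k : ℝ) + 1) * (Real.pi / 3 - α) ≤ 1.2) : GR k (Real.tan α / 2) < 0 := by
  have hpi := Real.pi_gt_three
  have hz := zr_le_of_eight_le (k := k) (by omega)
  have key : ∀ a b t M q : ℝ, 0 < a → a ≤ 1.35 → 0 ≤ b → b ≤ 1.2 →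
      a ≤ ((k : ℝ) + 1) * (Real.pi / 3 - α) → ((k : ℝ) + 1) * (Real.pi / 3 - α) ≤ b →
      0 < t → (1 + 1.7321 * (b / 9) - 0.49 * (b / 9) ^ 2) ^ 2 * (1 + t ^ 2) ≤ 4 → 1 ≤ M →
      M ≤ 1 + t ^ 2 → 4 * M ≤ 9 + t ^ 2 → 4 * M ≤ 1 + 9 * t ^ 2 → 0 ≤ q → q ≤ Real.cos b →
      1.0052 + 3.34 / (t ^ 4 * M) < (1 + 1.64 * a + 4 / 9 * (1.64 * a) ^ 2) * q →
      GR k (Real.tan α / 2) < 0 := by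
    intro a b t M q ha0 ha hb0 hb hav hvb ht hCt hM hM1 hM2 hM3 hq0 hq hlt
    have hA := (abs_le.1 (GR_approx_of_mod_two hm hk h0 h1 hb0 (by linarith) hvb ht hCt hM hM1 hM2
      hM3 le_rfl)).2
    have hp := pow_two_cos_ge_of_nine_le (k := k) (by omega) h0.le ha0 ha hav
    have hc : q ≤ Real.cos ((k + 1) * (Real.pi / 3 - α)) :=
      hq.trans (Real.cos_le_cos_of_nonneg_of_le_pi (by linarith) (by linarith) hvb)
    have := mul_le_mul hp hc hq0 ((by positivity : (0 : ℝ) ≤ _).trans hp)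
    linarith
  have hcos (b : ℝ) := Real.one_sub_sq_div_two_le_cos (x := b)
  rcases le_total (((k : ℝ) + 1) * (Real.pi / 3 - α)) 0.5 with h | h
  · exact key 0.25 0.5 1.52 2.8 0.875 (by norm_num) (by norm_num) (by norm_num) (by norm_num) hv0 h
      (by norm_num) (by norm_num) (by norm_num) (by norm_num) (by norm_num) (by norm_num)
      (by norm_num) (by have := hcos 0.5; norm_num at this ⊢; linarith) (by norm_num)
  rcases le_total (((k : ℝ) + 1) * (Real.pi / 3 - α)) 0.8 with h' | h'
  · exact key 0.5 0.8 1.42 2.75 0.68 (by norm_num) (by norm_num) (by norm_num) (by norm_num) h h'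
      (by norm_num) (by norm_num) (by norm_num) (by norm_num) (by norm_num) (by norm_num)
      (by norm_num) (by have := hcos 0.8; norm_num at this ⊢; linarith) (by norm_num)
  rcases le_total (((k : ℝ) + 1) * (Real.pi / 3 - α)) 1 with h1 | h1
  · exact key 0.8 1 1.355 2.7 0.5 (by norm_num) (by norm_num) (by norm_num) (by norm_num) h' h1
      (by norm_num) (by norm_num) (by norm_num) (by norm_num) (by norm_num) (by norm_num)
      (by norm_num) (by have := hcos 1; norm_num at this ⊢; linarith) (by norm_num)
  rcases le_total (((k : ℝ) + 1) * (Real.pi / 3 - α)) 1.1 with h2 | h2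
  · exact key 1 1.1 1.325 2.68 0.395 (by norm_num) (by norm_num) (by norm_num) (by norm_num) h1 h2
      (by norm_num) (by norm_num) (by norm_num) (by norm_num) (by norm_num) (by norm_num)
      (by norm_num) (by have := hcos 1.1; norm_num at this ⊢; linarith) (by norm_num)
  · refine key 1.1 1.2 1.294 2.66 0.358 (by norm_num) (by norm_num) (by norm_num) (by norm_num) h2 hv1
      (by norm_num) (by norm_num) (by norm_num) (by norm_num) (by norm_num) (by norm_num)
      (by norm_num) ?_ (by norm_num)
    have c1 := hcos 0.3
    have c2 := Real.cos_two_mul 0.3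
    have c3 := Real.cos_two_mul (2 * 0.3)
    rw [show (1.2 : ℝ) = 2 * (2 * 0.3) by norm_num]
    have c4 : 0.824 ≤ Real.cos (2 * 0.3) := by rw [c2]; nlinarith
    rw [c3]; nlinarith

lemma GR_pos_of_mod_two {k m : ℕ} (hm : 1 ≤ m) (hk : k = 6 * m + 2) {α : ℝ} (h0 : 0 < α)
    (h1 : α < Real.pi / 2) (hv0 : Real.pi / 2 ≤ ((k : ℝ) + 1) * (Real.pi / 3 - α))
    (hv1 : ((k : ℝ) + 1) * (Real.pi / 3 - α) ≤ Real.pi) : 0 < GR k (Real.tan α / 2) := by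
  have hpi := Real.pi_gt_d4
  have hpi' := Real.pi_lt_d4
  have hz := one_le_zr (k := k) (by omega)
  have hp := pow_two_cos_ge_of_nine_le (k := k) (a := 1.35) (by omega) h0.le (by norm_num)
    (by norm_num) (by linarith)
  have key : ∀ a b t M : ℝ, 0 ≤ a → a ≤ 1 → b ≤ 3.1416 →
      a ≤ ((k : ℝ) + 1) * (Real.pi / 3 - α) - Real.pi / 2 → ((k : ℝ) + 1) * (Real.pi / 3 - α) ≤ b →
      0 < t → (1 + 1.7321 * (b / 9) - 0.49 * (b / 9) ^ 2) ^ 2 * (1 + t ^ 2) ≤ 4 → 1 ≤ M →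
      M ≤ 1 + t ^ 2 → 4 * M ≤ 9 + t ^ 2 → 4 * M ≤ 1 + 9 * t ^ 2 →
      3.34 / (t ^ 4 * M) < 1 + (1 + 1.64 * 1.35 + 4 / 9 * (1.64 * 1.35) ^ 2) * (a - a ^ 3 / 6) →
      0 < GR k (Real.tan α / 2) := by
    intro a b t M ha0 ha1 hb hav hvb ht hCt hM hM1 hM2 hM3 hlt
    have hA := (abs_le.1 (GR_approx_of_mod_two hm hk h0 h1 (by linarith) (by linarith) hvb ht hCt hM
      hM1 hM2 hM3 le_rfl)).1
    have hc : a - a ^ 3 / 6 ≤ -Real.cos ((k + 1) * (Real.pi / 3 - α)) := by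
      have e : -Real.cos ((k + 1) * (Real.pi / 3 - α))
          = Real.sin ((k + 1) * (Real.pi / 3 - α) - Real.pi / 2) := by
        rw [Real.sin_sub_pi_div_two]
      rw [e]
      refine le_trans ?_ (Real.sin_le_sin_of_le_of_le_pi_div_two (by linarith) (by linarith) hav)
      rcases ha0.eq_or_lt with rfl | h
      · simp
      · exact (Real.sin_gt_sub_cube h).le
    have := mul_le_mul hp hc (by nlinarith [pow_le_pow_left₀ ha0 ha1 2]) ((by positivity : (0 : ℝ) ≤ _).trans hp)
    linarith
  rcases le_total (((k : ℝ) + 1) * (Real.pi / 3 - α)) 1.7 with h | h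
  · exact key 0 1.7 1.15 2.3 (by norm_num) (by norm_num) (by norm_num) (by linarith) h
      (by norm_num) (by norm_num) (by norm_num) (by norm_num) (by norm_num) (by norm_num)
      (by norm_num)
  rcases le_total (((k : ℝ) + 1) * (Real.pi / 3 - α)) 2.3 with h' | h'
  · exact key 0.1291 2.3 1.005 2.01 (by norm_num) (by norm_num) (by norm_num) (by linarith) h'
      (by norm_num) (by norm_num) (by norm_num) (by norm_num) (by norm_num) (by norm_num)
      (by norm_num)
  · exact key 0.729 3.1416 0.822 1.675 (by norm_num) (by norm_num) (by norm_num) (by linarith)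
      (by linarith)
      (by norm_num) (by norm_num) (by norm_num) (by norm_num) (by norm_num) (by norm_num)
      (by norm_num)

lemma GR'_neg_of_mod_two {k m : ℕ} (hm : 1 ≤ m) (hk : k = 6 * m + 2) {α : ℝ} (h0 : 0 < α)
    (h1 : α < Real.pi / 2) (hv0 : 1.2 ≤ ((k : ℝ) + 1) * (Real.pi / 3 - α))
    (hv1 : ((k : ℝ) + 1) * (Real.pi / 3 - α) ≤ Real.pi / 2) : GR' k (Real.tan α / 2) < 0 := by
  have hpi := Real.pi_gt_d4
  have hpi' := Real.pi_lt_d4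
  have hk8 : (8 : ℝ) ≤ k := by rw [hk]; push_cast; have : (1 : ℝ) ≤ m := by exact_mod_cast hm
                               linarith
  have hα3 : α ≤ Real.pi / 3 := by nlinarith
  have hα6 : Real.pi / 3 - α ≤ Real.pi / 3 := by linarith
  have hpow : (2 * Real.cos α) ^ (k + 1) ≤ (2 * Real.cos α) ^ (k + 2) :=
    pow_le_pow_right₀ (one_le_two_cos h0.le hα3) (by omega)
  have key : ∀ a b t M : ℝ, 1.2 ≤ a → a ≤ 1.35 → b ≤ 1.571 →
      a ≤ ((k : ℝ) + 1) * (Real.pi / 3 - α) → ((k : ℝ) + 1) * (Real.pi / 3 - α) ≤ b →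
      0 < t → (1 + 1.7321 * (b / 9) - 0.49 * (b / 9) ^ 2) ^ 2 * (1 + t ^ 2) ≤ 4 → 1 ≤ M →
      M ≤ 1 + t ^ 2 → 4 * M ≤ 9 + t ^ 2 → 4 * M ≤ 1 + 9 * t ^ 2 →
      5.17 / (t ^ 5 * M) < (1 + 1.64 * a + 4 / 9 * (1.64 * a) ^ 2) *
        ((a - 1.0472) - (a - 1.0472) ^ 3 / 6) →
      GR' k (Real.tan α / 2) < 0 := by
    intro a b t M ha0 ha1 hb hav hvb ht hCt hM hM1 hM2 hM3 hlt
    have hA := (abs_le.1 (GR'_approx_of_mod_two hm hk h0 h1 (by linarith) (by linarith) hvb ht hCt hM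
      hM1 hM2 hM3 le_rfl)).2
    have hp := pow_two_cos_ge_of_nine_le (k := k) (by omega) h0.le (by linarith) ha1 hav
    have hc : (a - 1.0472) - (a - 1.0472) ^ 3 / 6 ≤
        Real.sin ((k + 1) * (Real.pi / 3 - α) - α) := by
      refine (Real.sin_gt_sub_cube (x := a - 1.0472) (by linarith)).le.trans
        (Real.sin_le_sin_of_le_of_le_pi_div_two (by linarith) (by linarith) (by linarith))
    have hs : 0 ≤ (a - 1.0472) - (a - 1.0472) ^ 3 / 6 := by
      have : 0 ≤ a - 1.0472 := by linarith
      nlinarith [pow_le_pow_left₀ this (by linarith : a - 1.0472 ≤ 1) 2]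
    have := mul_le_mul (hp.trans hpow) hc hs ((by positivity : (0 : ℝ) ≤ _).trans (hp.trans hpow))
    have h6 : GR' k (Real.tan α / 2) / (k + 1) < 0 := by linarith
    rwa [div_lt_iff₀ (by positivity), zero_mul] at h6
  rcases le_total (((k : ℝ) + 1) * (Real.pi / 3 - α)) 1.3 with h | h
  · exact key 1.2 1.3 1.265 2.6 (by norm_num) (by norm_num) (by norm_num) hv0 h
      (by norm_num) (by norm_num) (by norm_num) (by norm_num) (by norm_num) (by norm_num)
      (by norm_num)
  · exact key 1.3 1.571 1.187 2.4 (by norm_num) (by norm_num) (by norm_num) h (by linarith)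
      (by norm_num) (by norm_num) (by norm_num) (by norm_num) (by norm_num) (by norm_num)
      (by norm_num)

lemma GR'_pos_of_mod_two {k m : ℕ} (hm : 1 ≤ m) (hk : k = 6 * m + 2) {α : ℝ} (h0 : 0 < α)
    (h1 : α < Real.pi / 2) (hv0 : -0.25 ≤ ((k : ℝ) + 1) * (Real.pi / 3 - α))
    (hv1 : ((k : ℝ) + 1) * (Real.pi / 3 - α) ≤ 0.25) : 0 < GR' k (Real.tan α / 2) := by
  have hpi := Real.pi_gt_d4
  have hpi' := Real.pi_lt_d4
  have hk8 : (8 : ℝ) ≤ k := by rw [hk]; push_cast; have : (1 : ℝ) ≤ m := by exact_mod_cast hm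
                               linarith
  have hd0 : -0.03 ≤ Real.pi / 3 - α := by nlinarith
  have hd1 : Real.pi / 3 - α ≤ 0.03 := by nlinarith
  have hA := (abs_le.1 (GR'_approx_of_mod_two hm hk h0 h1 (b := 0.25) (t := 1.62) (M := 2.9)
    (ε := 0.17) (by norm_num) (by norm_num) hv1 (by norm_num) (by norm_num) (by norm_num)
    (by norm_num) (by norm_num) (by norm_num) (by norm_num))).1
  have hs : 1 / 2 ≤ -Real.sin ((k + 1) * (Real.pi / 3 - α) - α) := by
    rw [← Real.sin_neg]
    exact half_le_sin (by linarith) (by linarith)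
  have hp : 0.4 ≤ (2 * Real.cos α) ^ (k + 2) := by
    rcases le_total α (Real.pi / 3) with h | h
    · have := one_le_pow₀ (one_le_two_cos h0.le h) (n := k + 2)
      linarith
    · set δ := α - Real.pi / 3 with hδ
      have hδ0 : 0 ≤ δ := by linarith
      have e : 2 * Real.cos α = Real.cos δ - √3 * Real.sin δ := by
        rw [show α = Real.pi / 3 + δ by rw [hδ]; ring, Real.cos_add, Real.cos_pi_div_three,
          Real.sin_pi_div_three]; ring
      have h3 : √3 ≤ 1.7321 := Real.sqrt_le_iff.2 (by norm_num)
      have h4 : √3 * Real.sin δ ≤ 1.7321 * δ :=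
        mul_le_mul h3 (Real.sin_le hδ0) (Real.sin_nonneg_of_nonneg_of_le_pi hδ0 (by linarith))
          (by norm_num)
      have h5 := Real.one_sub_sq_div_two_le_cos (x := δ)
      have h6 : 1 + (-1.75 * δ) ≤ 2 * Real.cos α := by rw [e]; nlinarith
      have h7 := one_add_mul_le_pow (a := -1.75 * δ) (by linarith) (k + 2)
      have h8 : (1 + (-1.75 * δ)) ^ (k + 2) ≤ (2 * Real.cos α) ^ (k + 2) :=
        pow_le_pow_left₀ (by linarith) h6 _
      push_cast at h7
      have h9 : ((k : ℝ) + 1) * δ ≤ 0.25 := by rw [hδ]; linarith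
      linarith
  have h6 : 0 < GR' k (Real.tan α / 2) / (k + 1) := by nlinarith
  exact (div_pos_iff_of_pos_right (by positivity)).1 h6

lemma GR_pos_of_mod_two_of_le {k m : ℕ} (hm : 1 ≤ m) (hk : k = 6 * m + 2) {α : ℝ} (h0 : 0 < α)
    (h1 : α < Real.pi / 2) (hv0 : ((k : ℝ) + 1) * (Real.pi / 3 - α) ≤ -0.25) :
    0 < GR k (Real.tan α / 2) := by
  have hk8 : (8 : ℝ) ≤ k := by rw [hk]; push_cast; have : (1 : ℝ) ≤ m := by exact_mod_cast hm
                               linarith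
  have hz := one_le_zr (k := k) (by omega)
  have hA := (abs_le.1 (GR_approx_of_mod_two hm hk h0 h1 (b := 0) (t := 1.7) (M := 2.9)
    (ε := 0.2) (by norm_num) (by norm_num) (by linarith) (by norm_num) (by norm_num) (by norm_num)
    (by norm_num) (by norm_num) (by norm_num) (by norm_num))).1
  have hp := pow_two_cos_le (s := k + 1) (φ := 0.25) h1 (by norm_num)
    (by push_cast; linarith) (by push_cast; linarith)
  norm_num at hp
  have hc := Real.cos_pos_of_mem_Ioo (x := α) ⟨by linarith [Real.pi_pos], h1⟩
  have hq : 0 < (2 * Real.cos α) ^ (k + 1) := by positivity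
  have := Real.cos_le_one ((k + 1) * (Real.pi / 3 - α))
  nlinarith

lemma exists_zero_of_mod_two {k m : ℕ} (hm : 1 ≤ m) (hk : k = 6 * m + 2) :
    ∃ β, samp k (2 * m) < β ∧ β < Real.pi / 3 ∧
      ∀ α, samp k (2 * m) ≤ α → α < Real.pi / 2 → (gR k α = 0 ↔ α = β ∨ α = Real.pi / 3) := by
  have hpi := Real.pi_gt_d4
  have hpi' := Real.pi_lt_d4
  have hke : Even k := Nat.even_iff.2 (by omega)
  have hkr : (k : ℝ) = 6 * m + 2 := by rw [hk]; push_cast; ring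
  have hm' : (1 : ℝ) ≤ m := by exact_mod_cast hm
  have hk1 : (0 : ℝ) < k + 1 := by positivity
  set a := samp k (2 * m) with ha
  have ha0 : 0 < a := samp_pos (by omega)
  have has : a = Real.pi / 3 - Real.pi / (k + 1) := by
    rw [ha, samp]; push_cast; rw [hkr]; field_simp; ring
  have hle (x y : ℝ) : Real.pi / 3 - x / (k + 1) ≤ y ↔ (k + 1) * (Real.pi / 3 - y) ≤ x := by
    rw [mul_comm, ← le_div_iff₀ hk1]
    constructor <;> intro h <;> linarith
  have hge (x y : ℝ) : y ≤ Real.pi / 3 - x / (k + 1) ↔ x ≤ (k + 1) * (Real.pi / 3 - y) := by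
    rw [mul_comm (_ + _), ← div_le_iff₀ hk1]
    constructor <;> intro h <;> linarith
  have hsub {x y : ℝ} (h : x ≤ y) : Real.pi / 3 - y / (k + 1) ≤ Real.pi / 3 - x / (k + 1) := by
    gcongr
  have hlt {x : ℝ} (hx : 0 < x) : Real.pi / 3 - x / (k + 1) < Real.pi / 3 := by
    have : 0 < x / (k + 1 : ℝ) := by positivity
    linarith
  have ha' : ∀ x : ℝ, x ≤ Real.pi → a ≤ Real.pi / 3 - x / (k + 1) := fun x hx => by
    rw [has]; exact hsub hx
  have h25 : Real.pi / 3 - -0.25 / ((k : ℝ) + 1) < Real.pi / 2 := by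
    have : (0.25 : ℝ) / (k + 1) ≤ 0.25 / 1 := by
      gcongr; linarith [(Nat.cast_nonneg k : (0 : ℝ) ≤ k)]
    rw [neg_div]; linarith
  have hanti : StrictAntiOn (fun α => GR k (Real.tan α / 2))
      (Set.Icc (Real.pi / 3 - (Real.pi / 2) / (k + 1)) (Real.pi / 3 - 1.2 / (k + 1))) := by
    have hp := ha0.trans_le (ha' (Real.pi / 2) (by linarith))
    have hlt := hlt (x := 1.2) (by norm_num)
    refine strictAntiOn_GR_tan hp (by linarith) fun α hα => ?_
    exact GR'_neg_of_mod_two hm hk (hp.trans_le hα.1) (by linarith [hα.2]) ((hge _ _).1 hα.2)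
      ((hle _ _).1 hα.1)
  have hmono : StrictMonoOn (fun α => GR k (Real.tan α / 2))
      (Set.Icc (Real.pi / 3 - 0.25 / (k + 1)) (Real.pi / 3 - -0.25 / (k + 1))) := by
    have hp := ha0.trans_le (ha' 0.25 (by linarith))
    refine strictMonoOn_GR_tan hp h25 fun α hα => ?_
    exact GR'_pos_of_mod_two hm hk (hp.trans_le hα.1) (by linarith [hα.2]) ((hge _ _).1 hα.2)
      ((hle _ _).1 hα.1)
  have hpi2 := hlt (x := Real.pi / 2) (by linarith)
  have h12 := hlt (x := 1.2) (by norm_num)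
  have hpa := ha0.trans_le (ha' (Real.pi / 2) (by linarith))
  have hp12 := ha0.trans_le (ha' 1.2 (by linarith))
  obtain ⟨β, hβ1, hβ2, hβ⟩ := exists_unique_zero_of_strictMonoOn
    (F := fun α => -GR k (Real.tan α / 2)) (hsub (by linarith : (1.2 : ℝ) ≤ Real.pi / 2))
    (continuousOn_GR_tan k hpa (by linarith)).neg hanti.neg
    (neg_neg_of_pos (GR_pos_of_mod_two hm hk hpa (by linarith) ((hge _ _).1 le_rfl)
      (((hle _ _).1 le_rfl).trans (by linarith))))
    (neg_pos_of_neg (GR_neg_of_mod_two hm hk hp12 (by linarith)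
      (le_trans (by norm_num) ((hge _ _).1 le_rfl)) ((hle _ _).1 le_rfl)))
  have hthree : GR k (Real.tan (Real.pi / 3) / 2) = 0 := by
    rw [Real.tan_pi_div_three]; exact GR_rho_eq_zero (by omega) (by omega)
  refine ⟨β, (ha' _ (by linarith)).trans_lt hβ1, hβ2.trans h12, fun α h0 h1 => ?_⟩
  have hα0 := ha0.trans_le h0
  have hαv : (k + 1) * (Real.pi / 3 - α) ≤ Real.pi := by rw [has] at h0; exact (hle _ _).1 h0
  rw [gR_eq_zero_iff_GR (by omega) hke hα0 h1]
  rcases le_total (Real.pi / 2) ((k + 1) * (Real.pi / 3 - α)) with h | h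
  · refine iff_of_false (GR_pos_of_mod_two hm hk hα0 h1 h hαv).ne' ?_
    have := (hge _ _).2 h
    rintro (h | h) <;> linarith
  rcases le_total 1.2 ((k + 1) * (Real.pi / 3 - α)) with h' | h'
  · have h2 := hβ α ⟨(hle _ _).2 h, (hge _ _).2 h'⟩
    rw [neg_eq_zero] at h2
    rw [h2, or_iff_left]
    have := (hge _ _).2 h'
    intro h; linarith
  rcases le_total 0.25 ((k + 1) * (Real.pi / 3 - α)) with h2 | h2
  · refine iff_of_false (GR_neg_of_mod_two hm hk hα0 h1 h2 h').ne ?_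
    have h3 := (hle _ _).2 h'
    have h4 := (hge _ _).2 h2
    have h5 := hlt (x := 0.25) (by norm_num)
    rintro (h | h) <;> linarith
  have hβα : α ≠ β := by
    have h3 := (hle _ _).2 h2
    have h5 := hsub (by norm_num : (0.25 : ℝ) ≤ 1.2)
    intro h
    linarith
  rw [or_iff_right hβα]
  rcases le_total (-0.25) ((k + 1) * (Real.pi / 3 - α)) with h3 | h3
  · have m1 : α ∈ Set.Icc (Real.pi / 3 - 0.25 / ((k : ℝ) + 1)) (Real.pi / 3 - -0.25 / (k + 1)) :=
      ⟨(hle _ _).2 h2, (hge _ _).2 h3⟩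
    have m2 : Real.pi / 3 ∈
        Set.Icc (Real.pi / 3 - 0.25 / ((k : ℝ) + 1)) (Real.pi / 3 - -0.25 / (k + 1)) :=
      ⟨(hle _ _).2 (by norm_num), (hge _ _).2 (by norm_num)⟩
    rw [← hthree]
    exact hmono.eq_iff_eq m1 m2
  · refine iff_of_false (GR_pos_of_mod_two_of_le hm hk hα0 h1 h3).ne' ?_
    rintro rfl
    norm_num at h3

lemma exists_Ek_eight_eq : ∃ d : ℂ, ∀ z : ℂ, 0 < z.im → Ek 8 z = d * Ek 4 z ^ 2 := by
  have hr : Module.rank ℂ (ModularForm (Matrix.SpecialLinearGroup.mapGL (n := Fin 2) (R := ℤ) ℝ).range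
      ((8 : ℕ) : ℤ)) = 1 :=
    (ModularForm.rank_eq_one_add_rank_cuspForm (by norm_num) ⟨4, rfl⟩).trans
      ((congrArg (1 + ·) (CuspForm.rank_eq_zero_of_weight_lt_twelve (by norm_num))).trans
        (by norm_cast))
  have hne : ModularForm.E (k := 4) (by norm_num) ≠ 0 := EisensteinSeries.E_ne_zero _ ⟨2, rfl⟩
  let F : ModularForm (Matrix.SpecialLinearGroup.mapGL (n := Fin 2) (R := ℤ) ℝ).range ((8 : ℕ) : ℤ) :=
    ModularForm.mcast (by norm_num)
      ((ModularForm.E (k := 4) (by norm_num)).mul (ModularForm.E (k := 4) (by norm_num)))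
  have hF (z : UpperHalfPlane) : F z = ModularForm.E (k := 4) (by norm_num) z ^ 2 := by
    rw [sq]; rfl
  have hF0 : F ≠ 0 := by
    intro h
    refine hne (DFunLike.ext _ _ fun z => ?_)
    have := hF z
    rw [h] at this
    exact pow_eq_zero_iff two_ne_zero |>.1 this.symm
  obtain ⟨d, hd⟩ := (finrank_eq_one_iff_of_nonzero' F hF0).1
    (Module.rank_eq_one_iff_finrank_eq_one.1 hr) (ModularForm.E (k := 8) (by norm_num))
  refine ⟨d, fun z hz => ?_⟩
  have h8 := Ek_eq_E (k := 8) (by norm_num) ⟨4, rfl⟩ ⟨z, hz⟩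
  have h4 := Ek_eq_E (k := 4) (by norm_num) ⟨2, rfl⟩ ⟨z, hz⟩
  change Ek 8 z = _ at h8
  change Ek 4 z = _ at h4
  rw [h8, h4, ← hF, ← hd]
  rfl

lemma deriv_Ek_eight_eq_zero {z : ℂ} (hz : 0 < z.im) (h : deriv (Ek 4) z = 0) :
    deriv (Ek 8) z = 0 := by
  obtain ⟨d, hd⟩ := exists_Ek_eight_eq
  have h4 := (hasDerivAt_Ek 4 hz).differentiableAt.hasDerivAt
  rw [h] at h4
  have he : Ek 8 =ᶠ[𝓝 z] fun z => d * Ek 4 z ^ 2 :=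
    Filter.eventually_of_mem ((isOpen_lt continuous_const Complex.continuous_im).mem_nhds hz)
      fun w hw => hd w hw
  have hs := ((h4.pow 2).const_mul d).deriv
  rw [he.deriv_eq]
  simpa using hs

lemma norm_divSum_le (p n : ℕ) : ‖divSum p n‖ ≤ (n : ℝ) ^ (p + 1) := by
  refine (norm_sum_le _ _).trans ?_
  calc ∑ d ∈ n.divisors, ‖(d : ℂ) ^ p‖ ≤ ∑ d ∈ n.divisors, (n : ℝ) ^ p := by
        refine Finset.sum_le_sum fun d hd => ?_
        rw [norm_pow, Complex.norm_natCast]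
        gcongr
        exact Nat.divisor_le hd
    _ ≤ n * (n : ℝ) ^ p := by
        rw [Finset.sum_const, nsmul_eq_mul]
        gcongr
        exact Nat.card_divisors_le_self n
    _ = _ := by ring

lemma pow_five_le (n : ℕ) : ((n : ℝ) + 2) ^ 5 ≤ 32 * 16 ^ n := by
  induction n with
  | zero => norm_num
  | succ n ih =>
    have h : ((n : ℝ) + 3) ^ 5 ≤ (3 / 2 * (n + 2)) ^ 5 := by gcongr; linarith
    rw [mul_pow] at h
    push_cast
    rw [pow_succ 16 n, show (n : ℝ) + 1 + 2 = n + 3 by ring]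
    have : (0 : ℝ) ≤ (n + 2) ^ 5 := by positivity
    norm_num at h
    linarith

lemma Dser_three_ne_zero {q : ℂ} (hq0 : q ≠ 0) (hq : ‖q‖ ≤ 1 / 100) : Dser 3 1 q ≠ 0 := by
  have hs := (polyGrowth_Dser 3 1).summable (q := q) (by linarith)
  have hr : 0 < ‖q‖ := norm_pos_iff.2 hq0
  have h := hs.sum_add_tsum_nat_add 2
  have hg : HasSum (fun n : ℕ => 32 * ‖q‖ ^ 2 * (16 * ‖q‖) ^ n) (32 * ‖q‖ ^ 2 * (1 - 16 * ‖q‖)⁻¹) :=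
    (hasSum_geometric_of_lt_one (by positivity) (by linarith)).mul_left _
  have ht : ‖∑' n : ℕ, ((n + 2 : ℕ) : ℂ) ^ 1 * divSum 3 (n + 2) * q ^ (n + 2)‖
      ≤ 32 * ‖q‖ ^ 2 * (1 - 16 * ‖q‖)⁻¹ := by
    refine tsum_of_norm_bounded hg fun n => ?_
    rw [norm_mul, norm_mul, norm_pow, norm_pow, Complex.norm_natCast, pow_one]
    have h1 := norm_divSum_le 3 (n + 2)
    have h2 := pow_five_le n
    push_cast at h1 ⊢
    calc ((n : ℝ) + 2) * ‖divSum 3 (n + 2)‖ * ‖q‖ ^ (n + 2)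
        ≤ ((n : ℝ) + 2) * ((n : ℝ) + 2) ^ (3 + 1) * ‖q‖ ^ (n + 2) := by gcongr
      _ = ((n : ℝ) + 2) ^ 5 * ‖q‖ ^ (n + 2) := by ring
      _ ≤ 32 * 16 ^ n * ‖q‖ ^ (n + 2) := by gcongr
      _ = _ := by rw [mul_pow]; ring
  intro h0
  rw [Dser, pser] at h0
  rw [h0] at h
  simp only [Finset.sum_range_succ, Finset.sum_range_zero] at h
  have e1 : divSum 3 1 = 1 := by simp [divSum]
  rw [e1] at h
  have h2 : q = -∑' n : ℕ, ((n + 2 : ℕ) : ℂ) ^ 1 * divSum 3 (n + 2) * q ^ (n + 2) := by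
    rw [eq_neg_iff_add_eq_zero, ← h]
    simp
  have h3 : ‖q‖ ≤ 32 * ‖q‖ ^ 2 * (1 - 16 * ‖q‖)⁻¹ := by
    refine le_trans (le_of_eq ?_) ht
    conv_lhs => rw [h2]
    rw [norm_neg]
  have h4 : (1 - 16 * ‖q‖)⁻¹ ≤ 2 := by
    rw [inv_le_comm₀ (by linarith) (by norm_num)]
    linarith
  have h5 : 32 * ‖q‖ ^ 2 * (1 - 16 * ‖q‖)⁻¹ ≤ 32 * ‖q‖ ^ 2 * 2 := by gcongr
  nlinarith

lemma DR_four_rho_ne_zero : DR 4 1 (√3 / 2) ≠ 0 := by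
  have h : Dser (4 - 1) 1 (nome (√3 / 2) : ℂ) ≠ 0 := by
    refine Dser_three_ne_zero ?_ ?_
    · exact_mod_cast neg_ne_zero.2 (Real.exp_pos _).ne'
    · rw [Complex.norm_real, nome, norm_neg, Real.norm_of_nonneg (Real.exp_pos _).le, Real.exp_neg,
        one_div]
      refine inv_anti₀ (by norm_num) ?_
      have h3 : (1.7 : ℝ) ≤ √3 := Real.le_sqrt_of_sq_le (by norm_num)
      have hp := Real.pi_gt_three
      have he := Real.exp_one_gt_d9
      calc (100 : ℝ) ≤ 2.7 ^ 5 := by norm_num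
        _ ≤ Real.exp 1 ^ 5 := by gcongr; linarith
        _ = Real.exp 5 := by rw [← Real.exp_nat_mul]; norm_num
        _ ≤ _ := by
          refine Real.exp_le_exp.2 ?_
          nlinarith
  intro h0
  rw [Dser_nome, h0] at h
  exact h Complex.ofReal_zero

lemma Ek_half_add_inv {k : ℕ} (hk : 4 ≤ k) (hke : Even k) {τ : ℝ} (hτ : 0 < τ)
    (h : Ek k (1 / 2 + τ * Complex.I) = 0) :
    Ek k (1 / 2 + ((1 / (4 * τ) : ℝ) : ℂ) * Complex.I) = 0 := by
  have hτ' : (τ : ℂ) ≠ 0 := by exact_mod_cast hτ.ne'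
  have hI := Complex.I_ne_zero
  have hden : ((2 : ℤ) : ℂ) * (1 / 2 + τ * Complex.I) + ((-1 : ℤ) : ℂ) = 2 * τ * Complex.I := by
    push_cast; ring
  have hw : (((1 : ℤ) : ℂ) * (1 / 2 + τ * Complex.I) + ((-1 : ℤ) : ℂ)) /
      (((2 : ℤ) : ℂ) * (1 / 2 + τ * Complex.I) + ((-1 : ℤ) : ℂ))
      = 1 / 2 + ((1 / (4 * τ) : ℝ) : ℂ) * Complex.I := by
    rw [hden]
    push_cast
    field_simp
    linear_combination (-4 : ℂ) * Complex.I_sq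
  rw [← hw, Ek_modular (by omega) hke 1 (-1) 2 (-1) (by norm_num)
    (by rw [half_add_im]; exact hτ), h, mul_zero]

lemma exists_DR_four_eq_zero : ∃ t, √3 / 6 < t ∧ t < √3 / 2 ∧ DR 4 1 t = 0 := by
  have h3 : 0 < √3 := by positivity
  have hz (t : ℝ) (h : Ek 4 (1 / 2 + t * Complex.I) = 0) : zr 4 + eisCoeff 4 * DR 4 0 t = 0 := by
    have := Ek_half_add (k := 4) le_rfl ⟨2, rfl⟩ t
    rw [h, mul_zero] at this
    exact_mod_cast this.symm
  have h1 := Ek_rho_eq_zero (k := 4) le_rfl (Or.inr rfl)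
  have h2 := Ek_half_add_inv (k := 4) le_rfl ⟨2, rfl⟩ (by positivity) h1
  have e : 1 / (4 * (√3 / 2)) = √3 / 6 := by
    have : √3 ^ 2 = 3 := Real.sq_sqrt (by norm_num)
    field_simp
    linarith
  rw [e] at h2
  have hd (t : ℝ) (ht : 0 < t) : HasDerivAt (fun t => zr 4 + eisCoeff 4 * DR 4 0 t)
      (eisCoeff 4 * (-(2 * Real.pi) * DR 4 1 t)) t :=
    ((hasDerivAt_DR 4 0 ht).const_mul _).const_add _
  obtain ⟨t, ht, ht0⟩ := exists_hasDerivAt_eq_zero (a := √3 / 6) (b := √3 / 2) (by linarith)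
    (fun t ht => (hd t (by linarith [ht.1])).continuousAt.continuousWithinAt)
    ((hz _ h2).trans (hz _ h1).symm) (fun t ht => hd t (by linarith [ht.1]))
  refine ⟨t, ht.1, ht.2, ?_⟩
  have := eisCoeff_ne_zero 4
  simpa [this, Real.pi_ne_zero] using ht0

/-- Half the cotangent. -/
noncomputable def halfCot (α : ℝ) : ℝ := Real.cos α / (2 * Real.sin α)

lemma halfCot_strictAntiOn : StrictAntiOn halfCot (Set.Ioo 0 (Real.pi / 2)) := by
  intro a ha b hb hab
  have hsa : 0 < Real.sin a := Real.sin_pos_of_pos_of_lt_pi ha.1 (by linarith [ha.2, Real.pi_pos])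
  have hsb : 0 < Real.sin b := Real.sin_pos_of_pos_of_lt_pi hb.1 (by linarith [hb.2, Real.pi_pos])
  have hs : 0 < Real.sin (b - a) :=
    Real.sin_pos_of_pos_of_lt_pi (by linarith) (by linarith [ha.1, hb.2, Real.pi_pos])
  rw [Real.sin_sub] at hs
  unfold halfCot
  rw [div_lt_div_iff₀ (by positivity) (by positivity)]
  nlinarith

lemma halfCot_pos {α : ℝ} (hα : α ∈ Set.Ioo 0 (Real.pi / 2)) : 0 < halfCot α := by
  have hs : 0 < Real.sin α := Real.sin_pos_of_pos_of_lt_pi hα.1 (by linarith [hα.2, Real.pi_pos])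
  have hc : 0 < Real.cos α := Real.cos_pos_of_mem_Ioo ⟨by linarith [hα.1, Real.pi_pos], hα.2⟩
  unfold halfCot
  positivity

lemma exists_halfCot_eq {t : ℝ} (ht : 0 < t) : ∃ α ∈ Set.Ioo 0 (Real.pi / 2), halfCot α = t := by
  refine ⟨Real.arctan (1 / (2 * t)), ⟨Real.arctan_pos.2 (by positivity), Real.arctan_lt_pi_div_two _⟩, ?_⟩
  have hc := Real.cos_arctan_pos (1 / (2 * t))
  have h := Real.tan_arctan (1 / (2 * t))
  rw [Real.tan_eq_sin_div_cos, div_eq_iff hc.ne'] at h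
  unfold halfCot
  rw [h]
  field_simp

lemma halfCot_pi_div_six : halfCot (Real.pi / 6) = √3 / 2 := by
  rw [halfCot, Real.cos_pi_div_six, Real.sin_pi_div_six]
  ring

lemma halfCot_pi_div_three : halfCot (Real.pi / 3) = √3 / 6 := by
  rw [halfCot, Real.cos_pi_div_three, Real.sin_pi_div_three]
  have h : √3 * √3 = 3 := Real.mul_self_sqrt (by norm_num)
  have h0 : √3 ≠ 0 := by positivity
  field_simp
  linarith

lemma deriv_Ek_halfCot_eq_zero_iff {k : ℕ} (hk : 4 ≤ k) (hke : Even k) {α : ℝ}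
    (hα : α ∈ Set.Ioo 0 (Real.pi / 2)) :
    deriv (Ek k) (1 / 2 + halfCot α * Complex.I) = 0 ↔ gR k α = 0 := by
  rw [deriv_Ek_eq_zero_iff hk hke (halfCot_pos hα), gR_eq_DR, halfCot]

/-- The zeros of `gR k` strictly between `π / 6` and `s`. -/
def midZset (k : ℕ) (s : ℝ) : Set ℝ := {α | Real.pi / 6 < α ∧ α < s ∧ gR k α = 0}

lemma pi_div_six_mem : Real.pi / 6 ∈ Set.Ioo 0 (Real.pi / 2) :=
  ⟨by linarith [Real.pi_pos], by linarith [Real.pi_pos]⟩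

lemma pi_div_three_mem : Real.pi / 3 ∈ Set.Ioo 0 (Real.pi / 2) :=
  ⟨by linarith [Real.pi_pos], by linarith [Real.pi_pos]⟩

/-- Translation of a count of the zeros of `gR k` on `(0, π / 2)` into one of the zeros of the
derivative of `Ek k` on the line of real part `1 / 2`. -/
lemma zeros_deriv_Ek_of_zeros_gR {k : ℕ} (hke : Even k) (hk4 : 4 ≤ k)
    (hA : (Zset k (Real.pi / 6)).Finite) (hAc : (Zset k (Real.pi / 6)).ncard = (k - 4) / 6)
    (hM : (midZset k (Real.pi / 3)).Finite)
    (hMc : (midZset k (Real.pi / 3)).ncard = (k + 2) / 6)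
    (hlast : ∀ α, Real.pi / 3 < α → α < Real.pi / 2 → gR k α ≠ 0)
    (h6 : gR k (Real.pi / 6) = 0 ↔ k % 6 = 2) (h3 : gR k (Real.pi / 3) = 0 ↔ k % 6 = 2) :
    let S : Set ℝ := {t : ℝ | 0 < t ∧ deriv (Ek k) (1 / 2 + t * Complex.I) = 0}
    S.Finite ∧ S.ncard = 1 + 2 * ((k - 2) / 6) ∧ {t ∈ S | √3 / 2 < t}.ncard = (k - 4) / 6 ∧
    {t ∈ S | √3 / 6 < t ∧ t < √3 / 2}.ncard = (k + 2) / 6 ∧ {t ∈ S | t < √3 / 6} = ∅ ∧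
    (k % 6 = 2 → √3 / 6 ∈ S ∧ √3 / 2 ∈ S) ∧ (k % 6 ≠ 2 → √3 / 6 ∉ S ∧ √3 / 2 ∉ S) := by
  intro S
  have hmem : ∀ α ∈ Set.Ioo 0 (Real.pi / 2), (halfCot α ∈ S ↔ gR k α = 0) := fun α hα =>
    ⟨fun h => (deriv_Ek_halfCot_eq_zero_iff hk4 hke hα).1 h.2,
      fun h => ⟨halfCot_pos hα, (deriv_Ek_halfCot_eq_zero_iff hk4 hke hα).2 h⟩⟩
  have hanti := halfCot_strictAntiOn
  have hp := Real.pi_pos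
  have hS3 : √3 / 6 ∈ S ↔ k % 6 = 2 := by
    rw [← halfCot_pi_div_three, hmem _ pi_div_three_mem, h3]
  have hS6 : √3 / 2 ∈ S ↔ k % 6 = 2 := by
    rw [← halfCot_pi_div_six, hmem _ pi_div_six_mem, h6]
  have hAsub : Zset k (Real.pi / 6) ⊆ Set.Ioo 0 (Real.pi / 2) := fun α hα =>
    ⟨hα.1, by linarith [hα.2.1]⟩
  have hMsub : midZset k (Real.pi / 3) ⊆ Set.Ioo 0 (Real.pi / 2) := fun α hα =>
    ⟨by linarith [hα.1], by linarith [hα.2.1]⟩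
  have eA : {t ∈ S | √3 / 2 < t} = halfCot '' Zset k (Real.pi / 6) := by
    ext t
    constructor
    · rintro ⟨hS, ht⟩
      obtain ⟨α, hα, rfl⟩ := exists_halfCot_eq hS.1
      rw [← halfCot_pi_div_six, hanti.lt_iff_gt pi_div_six_mem hα] at ht
      exact ⟨α, ⟨hα.1, ht, (hmem α hα).1 hS⟩, rfl⟩
    · rintro ⟨α, hα, rfl⟩
      refine ⟨(hmem α (hAsub hα)).2 hα.2.2, ?_⟩
      rw [← halfCot_pi_div_six]
      exact hanti (hAsub hα) pi_div_six_mem hα.2.1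
  have eM : {t ∈ S | √3 / 6 < t ∧ t < √3 / 2} = halfCot '' midZset k (Real.pi / 3) := by
    ext t
    constructor
    · rintro ⟨hS, ht, ht'⟩
      obtain ⟨α, hα, rfl⟩ := exists_halfCot_eq hS.1
      rw [← halfCot_pi_div_three, hanti.lt_iff_gt pi_div_three_mem hα] at ht
      rw [← halfCot_pi_div_six, hanti.lt_iff_gt hα pi_div_six_mem] at ht'
      exact ⟨α, ⟨ht', ht, (hmem α hα).1 hS⟩, rfl⟩
    · rintro ⟨α, hα, rfl⟩
      refine ⟨(hmem α (hMsub hα)).2 hα.2.2, ?_, ?_⟩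
      · rw [← halfCot_pi_div_three]
        exact hanti (hMsub hα) pi_div_three_mem hα.2.1
      · rw [← halfCot_pi_div_six]
        exact hanti pi_div_six_mem (hMsub hα) hα.1
  have eL : {t ∈ S | t < √3 / 6} = ∅ := by
    rw [Set.eq_empty_iff_forall_notMem]
    rintro t ⟨hS, ht⟩
    obtain ⟨α, hα, rfl⟩ := exists_halfCot_eq hS.1
    rw [← halfCot_pi_div_three, hanti.lt_iff_gt hα pi_div_three_mem] at ht
    exact hlast α ht hα.2 ((hmem α hα).1 hS)
  have fA : {t ∈ S | √3 / 2 < t}.Finite := by rw [eA]; exact hA.image _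
  have fM : {t ∈ S | √3 / 6 < t ∧ t < √3 / 2}.Finite := by rw [eM]; exact hM.image _
  have cA : {t ∈ S | √3 / 2 < t}.ncard = (k - 4) / 6 := by
    rw [eA, (hanti.injOn.mono hAsub).ncard_image, hAc]
  have cM : {t ∈ S | √3 / 6 < t ∧ t < √3 / 2}.ncard = (k + 2) / 6 := by
    rw [eM, (hanti.injOn.mono hMsub).ncard_image, hMc]
  have h36 : √3 / 6 < √3 / 2 := by
    have : 0 < √3 := by positivity
    linarith
  have hge : ∀ t ∈ S, √3 / 6 ≤ t := fun t ht => by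
    by_contra! h
    exact (Set.eq_empty_iff_forall_notMem.1 eL) t ⟨ht, h⟩
  have hdisj : Disjoint {t ∈ S | √3 / 2 < t} {t ∈ S | √3 / 6 < t ∧ t < √3 / 2} :=
    Set.disjoint_left.2 fun t ht ht' => lt_asymm ht.2 ht'.2.2
  have cU := Set.ncard_union_eq hdisj fA fM
  have fU := fA.union fM
  set U := {t ∈ S | √3 / 2 < t} ∪ {t ∈ S | √3 / 6 < t ∧ t < √3 / 2} with hU
  have h3U : √3 / 6 ∉ U := by
    rintro (h | h)
    · exact lt_asymm h36 h.2
    · exact lt_irrefl _ h.2.1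
  have h6U : √3 / 2 ∉ U := by
    rintro (h | h)
    · exact lt_irrefl _ h.2
    · exact lt_irrefl _ h.2.2
  have hSU : ∀ t, t ∈ S → t = √3 / 6 ∨ t = √3 / 2 ∨ t ∈ U := by
    intro t ht
    rcases (hge t ht).eq_or_lt with h | h
    · exact Or.inl h.symm
    rcases lt_trichotomy t (√3 / 2) with h' | h' | h'
    · exact Or.inr (Or.inr (Or.inr ⟨ht, h, h'⟩))
    · exact Or.inr (Or.inl h')
    · exact Or.inr (Or.inr (Or.inl ⟨ht, h'⟩))
  have hUS : U ⊆ S := by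
    rintro t (h | h)
    · exact h.1
    · exact h.1
  have htotal : S.Finite ∧ S.ncard = 1 + 2 * ((k - 2) / 6) := by
    by_cases hmod : k % 6 = 2
    · have e : S = insert (√3 / 6) (insert (√3 / 2) U) := by
        ext t
        refine ⟨fun ht => hSU t ht, ?_⟩
        rintro (rfl | rfl | h)
        · exact hS3.2 hmod
        · exact hS6.2 hmod
        · exact hUS h
      have hn : √3 / 6 ∉ insert (√3 / 2) U := by
        rintro (h | h)
        · exact h36.ne h
        · exact h3U h
      rw [e]
      refine ⟨(fU.insert _).insert _, ?_⟩
      rw [Set.ncard_insert_of_notMem hn (fU.insert _), Set.ncard_insert_of_notMem h6U fU, cU, cA, cM]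
      omega
    · have e : S = U := by
        refine Set.Subset.antisymm (fun t ht => ?_) hUS
        rcases hSU t ht with rfl | rfl | h
        · exact absurd (hS3.1 ht) hmod
        · exact absurd (hS6.1 ht) hmod
        · exact h
      refine ⟨e ▸ fU, ?_⟩
      have : S.ncard = U.ncard := congrArg _ e
      rw [this, cU, cA, cM]
      obtain ⟨l, rfl⟩ := hke
      omega
  exact ⟨htotal.1, htotal.2, cA, cM, eL, fun h => ⟨hS3.2 h, hS6.2 h⟩,
    fun h => ⟨fun h' => h (hS3.1 h'), fun h' => h (hS6.1 h')⟩⟩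

lemma Zset_eq_union_midZset {k : ℕ} {s : ℝ} (hs : Real.pi / 6 < s) (h6 : gR k (Real.pi / 6) ≠ 0) :
    Zset k s = Zset k (Real.pi / 6) ∪ midZset k s := by
  ext α
  constructor
  · rintro ⟨h0, h1, h2⟩
    rcases lt_trichotomy α (Real.pi / 6) with h | rfl | h
    · exact Or.inl ⟨h0, h, h2⟩
    · exact absurd h2 h6
    · exact Or.inr ⟨h, h1, h2⟩
  · rintro (h | h)
    · exact ⟨h.1, h.2.1.trans hs, h.2.2⟩
    · exact ⟨by linarith [Real.pi_pos, h.1], h.2.1, h.2.2⟩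

lemma Zset_eq_insert_union_midZset {k : ℕ} {s : ℝ} (hs : Real.pi / 6 < s)
    (h6 : gR k (Real.pi / 6) = 0) :
    Zset k s = insert (Real.pi / 6) (Zset k (Real.pi / 6) ∪ midZset k s) := by
  ext α
  constructor
  · rintro ⟨h0, h1, h2⟩
    rcases lt_trichotomy α (Real.pi / 6) with h | rfl | h
    · exact Or.inr (Or.inl ⟨h0, h, h2⟩)
    · exact Or.inl rfl
    · exact Or.inr (Or.inr ⟨h, h1, h2⟩)
  · rintro (rfl | h | h)
    · exact ⟨by linarith [Real.pi_pos], hs, h6⟩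
    · exact ⟨h.1, h.2.1.trans hs, h.2.2⟩
    · exact ⟨by linarith [Real.pi_pos, h.1], h.2.1, h.2.2⟩

lemma disjoint_Zset_midZset (k : ℕ) (s : ℝ) : Disjoint (Zset k (Real.pi / 6)) (midZset k s) :=
  Set.disjoint_left.2 fun _ h h' => lt_asymm h.2.1 h'.1

lemma midZset_subset_Zset (k : ℕ) (s : ℝ) : midZset k s ⊆ Zset k s := fun α h =>
  ⟨by linarith [Real.pi_pos, h.1], h.2.1, h.2.2⟩

lemma ncard_midZset_of_ne {k : ℕ} {s : ℝ} (hs : Real.pi / 6 < s) (h6 : gR k (Real.pi / 6) ≠ 0)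
    (hf : (Zset k s).Finite) :
    (Zset k s).ncard = (Zset k (Real.pi / 6)).ncard + (midZset k s).ncard := by
  have hA := hf.subset (Zset_mono k hs.le : Zset k (Real.pi / 6) ⊆ Zset k s)
  have hM := hf.subset (midZset_subset_Zset k s)
  rw [Zset_eq_union_midZset hs h6, Set.ncard_union_eq (disjoint_Zset_midZset k s) hA hM]

lemma ncard_midZset_of_eq {k : ℕ} {s : ℝ} (hs : Real.pi / 6 < s) (h6 : gR k (Real.pi / 6) = 0)
    (hf : (Zset k s).Finite) :
    (Zset k s).ncard = (Zset k (Real.pi / 6)).ncard + (midZset k s).ncard + 1 := by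
  have hA := hf.subset (Zset_mono k hs.le : Zset k (Real.pi / 6) ⊆ Zset k s)
  have hM := hf.subset (midZset_subset_Zset k s)
  rw [Zset_eq_insert_union_midZset hs h6, Set.ncard_insert_of_notMem _ (hA.union hM),
    Set.ncard_union_eq (disjoint_Zset_midZset k s) hA hM]
  rintro (h | h)
  · exact lt_irrefl _ h.2.1
  · exact lt_irrefl _ h.1

lemma pi_div_six_lt_samp {k j : ℕ} (h : k + 1 < 6 * j) : Real.pi / 6 < samp k j := by
  have hk : ((k + 1 : ℕ) : ℝ) < 6 * j := by exact_mod_cast h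
  have h0 : (0 : ℝ) < ((k + 1 : ℕ) : ℝ) := by positivity
  unfold samp
  rw [div_lt_div_iff₀ (by norm_num) h0]
  nlinarith [Real.pi_pos]

lemma samp_lt_pi_div_three {k j : ℕ} (h : 3 * j < k + 1) : samp k j < Real.pi / 3 := by
  have hk : (3 * j : ℝ) < ((k + 1 : ℕ) : ℝ) := by exact_mod_cast h
  have h0 : (0 : ℝ) < ((k + 1 : ℕ) : ℝ) := by positivity
  unfold samp
  rw [div_lt_div_iff₀ h0 (by norm_num)]
  nlinarith [Real.pi_pos]

lemma midZset_eq_insert {k : ℕ} {s β : ℝ} (hs : Real.pi / 6 < s) (hsβ : s < β)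
    (hβ : β < Real.pi / 3) (h : ∀ α, s ≤ α → α < Real.pi / 3 → (gR k α = 0 ↔ α = β)) :
    midZset k (Real.pi / 3) = insert β (midZset k s) := by
  ext α
  constructor
  · rintro ⟨h0, h1, h2⟩
    rcases lt_or_ge α s with hl | hl
    · exact Or.inr ⟨h0, hl, h2⟩
    · exact Or.inl ((h α hl h1).1 h2)
  · rintro (rfl | hα)
    · exact ⟨hs.trans hsβ, hβ, (h α hsβ.le hβ).2 rfl⟩
    · exact ⟨hα.1, by linarith [hα.2.1], hα.2.2⟩

lemma gR_pi_div_six_eq_zero {k : ℕ} (hk : 4 ≤ k) (h : k % 6 = 2) : gR k (Real.pi / 6) = 0 := by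
  rw [gR_eq_DR]
  change DR k 1 (halfCot (Real.pi / 6)) = 0
  rw [halfCot_pi_div_six]
  exact DR_rho hk h

lemma ncard_midZset_insert {k : ℕ} {s β : ℝ} (hs : Real.pi / 6 < s) (hsβ : s < β)
    (hβ : β < Real.pi / 3) (h : ∀ α, s ≤ α → α < Real.pi / 3 → (gR k α = 0 ↔ α = β))
    (hf : (Zset k s).Finite) :
    (midZset k (Real.pi / 3)).Finite ∧
      (midZset k (Real.pi / 3)).ncard = (midZset k s).ncard + 1 := by
  have hM := hf.subset (midZset_subset_Zset k s)
  rw [midZset_eq_insert hs hsβ hβ h]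
  exact ⟨hM.insert _, Set.ncard_insert_of_notMem (fun h' => lt_asymm hsβ h'.2.1) hM⟩

lemma ncard_midZset_of_mod_zero {k m : ℕ} (hm : 1 ≤ m) (hk : k = 6 * m) :
    (midZset k (Real.pi / 3)).Finite ∧ (midZset k (Real.pi / 3)).ncard = m := by
  have hke : Even k := Nat.even_iff.2 (by omega)
  obtain ⟨hf, hc⟩ := Zset_samp hke (by omega) (by omega) (by omega : 3 * (2 * m) ≤ k)
  have hs : Real.pi / 6 < samp k (2 * m) := pi_div_six_lt_samp (by omega)
  have hs' : samp k (2 * m) < Real.pi / 3 := samp_lt_pi_div_three (by omega)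
  obtain ⟨-, hAc, h6⟩ := Zset_pi_div_six_of_mod_zero hm hk
  have hM := ncard_midZset_of_ne hs h6 hf
  have e : midZset k (Real.pi / 3) = midZset k (samp k (2 * m)) := by
    refine Set.Subset.antisymm (fun α h => ⟨h.1, ?_, h.2.2⟩) fun α h => ⟨h.1, h.2.1.trans hs', h.2.2⟩
    by_contra! hα
    exact gR_ne_zero_of_mod_zero hm hk hα (by linarith [Real.pi_pos, h.2.1]) h.2.2
  rw [e]
  exact ⟨hf.subset (midZset_subset_Zset _ _), by omega⟩

lemma ncard_midZset_of_mod_two {k m : ℕ} (hm : 1 ≤ m) (hk : k = 6 * m + 2) :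
    (midZset k (Real.pi / 3)).Finite ∧ (midZset k (Real.pi / 3)).ncard = m := by
  have hke : Even k := Nat.even_iff.2 (by omega)
  obtain ⟨hf, hc⟩ := Zset_samp hke (by omega) (by omega) (by omega : 3 * (2 * m) ≤ k)
  have hs : Real.pi / 6 < samp k (2 * m) := pi_div_six_lt_samp (by omega)
  have h6 : gR k (Real.pi / 6) = 0 := gR_pi_div_six_eq_zero (by omega) (by omega)
  obtain ⟨-, hAc⟩ := Zset_pi_div_six_of_mod_two hm hk h6
  have hM := ncard_midZset_of_eq hs h6 hf
  obtain ⟨β, hβ, hβ', h⟩ := exists_zero_of_mod_two hm hk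
  obtain ⟨hF, hC⟩ := ncard_midZset_insert hs hβ hβ' (fun α h0 h1 => by
    rw [h α h0 (by linarith [Real.pi_pos])]
    exact or_iff_left h1.ne) hf
  exact ⟨hF, by omega⟩

lemma ncard_midZset_of_mod_four {k m : ℕ} (hm : 1 ≤ m) (hk : k = 6 * m + 4) :
    (midZset k (Real.pi / 3)).Finite ∧ (midZset k (Real.pi / 3)).ncard = m + 1 := by
  have hke : Even k := Nat.even_iff.2 (by omega)
  obtain ⟨hf, hc⟩ := Zset_samp hke (by omega) (by omega) (by omega : 3 * (2 * m + 1) ≤ k)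
  have hs : Real.pi / 6 < samp k (2 * m + 1) := pi_div_six_lt_samp (by omega)
  obtain ⟨-, hAc, h6⟩ := Zset_pi_div_six_of_mod_four hm hk
  have hM := ncard_midZset_of_ne hs h6 hf
  obtain ⟨β, hβ, hβ', h⟩ := exists_zero_of_mod_four hm hk
  obtain ⟨hF, hC⟩ := ncard_midZset_insert hs hβ hβ'
    (fun α h0 h1 => h α h0 (by linarith [Real.pi_pos])) hf
  exact ⟨hF, by omega⟩

lemma gR_eight_eq_zero {α : ℝ} (hα : α ∈ Set.Ioo 0 (Real.pi / 2)) (h : gR 4 α = 0) :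
    gR 8 α = 0 := by
  rw [← deriv_Ek_halfCot_eq_zero_iff (by norm_num) ⟨4, rfl⟩ hα]
  refine deriv_Ek_eight_eq_zero ?_ ((deriv_Ek_halfCot_eq_zero_iff le_rfl ⟨2, rfl⟩ hα).2 h)
  simpa using halfCot_pos hα

lemma gR_four_pi_div_six_ne_zero : gR 4 (Real.pi / 6) ≠ 0 := by
  rw [gR_eq_DR]
  change DR 4 1 (halfCot (Real.pi / 6)) ≠ 0
  rw [halfCot_pi_div_six]
  exact DR_four_rho_ne_zero

lemma gR_four_pi_div_three_ne_zero : gR 4 (Real.pi / 3) ≠ 0 := by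
  rw [Ne, gR_eq_zero_iff_GR le_rfl ⟨2, rfl⟩ pi_div_three_mem.1 pi_div_three_mem.2,
    Real.tan_pi_div_three, GR_rho le_rfl (Or.inr rfl)]
  have h := DR_four_rho_ne_zero
  have h' : eisCoeff 4 ≠ 0 := eisCoeff_ne_zero 4
  simp [h, h', Real.pi_ne_zero]

lemma Zset_four_eq_empty : Zset 4 (Real.pi / 6) = ∅ := by
  obtain ⟨hf, hc⟩ := Zset_pi_div_six_of_mod_two (k := 8) (m := 1) le_rfl rfl
    (gR_pi_div_six_eq_zero (by norm_num) (by norm_num))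
  have h8 : Zset 8 (Real.pi / 6) = ∅ := (Set.ncard_eq_zero hf).1 (by omega)
  refine Set.subset_eq_empty (fun α h => ?_) h8
  exact ⟨h.1, h.2.1, gR_eight_eq_zero ⟨h.1, by linarith [Real.pi_pos, h.2.1]⟩ h.2.2⟩

lemma ncard_midZset_four :
    (midZset 4 (Real.pi / 3)).Finite ∧ (midZset 4 (Real.pi / 3)).ncard = 1 := by
  obtain ⟨hf, hc⟩ := ncard_midZset_of_mod_two (k := 8) (m := 1) le_rfl rfl
  have hsub : midZset 4 (Real.pi / 3) ⊆ midZset 8 (Real.pi / 3) := fun α h =>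
    ⟨h.1, h.2.1, gR_eight_eq_zero ⟨by linarith [Real.pi_pos, h.1],
      by linarith [Real.pi_pos, h.2.1]⟩ h.2.2⟩
  have hf4 := hf.subset hsub
  have hle := Set.ncard_le_ncard hsub hf
  have hpos : 0 < (midZset 4 (Real.pi / 3)).ncard := by
    rw [Set.ncard_pos hf4]
    obtain ⟨t, h0, h1, h2⟩ := exists_DR_four_eq_zero
    obtain ⟨α, hα, rfl⟩ := exists_halfCot_eq (lt_trans (by positivity) h0)
    rw [← halfCot_pi_div_three, halfCot_strictAntiOn.lt_iff_gt pi_div_three_mem hα] at h0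
    rw [← halfCot_pi_div_six, halfCot_strictAntiOn.lt_iff_gt hα pi_div_six_mem] at h1
    exact ⟨α, h1, h0, by rw [gR_eq_DR]; exact h2⟩
  exact ⟨hf4, by omega⟩

lemma gR_ne_zero_of_pi_div_three_lt {k : ℕ} (hke : Even k) (hk4 : 4 ≤ k) {α : ℝ}
    (h0 : Real.pi / 3 < α) (h1 : α < Real.pi / 2) : gR k α ≠ 0 := by
  have main : ∀ l : ℕ, Even l → 6 ≤ l → gR l α ≠ 0 := by
    intro l hl hl6
    rw [Nat.even_iff] at hl
    obtain ⟨m, hm, hk | hk | hk⟩ : ∃ m, 1 ≤ m ∧ (l = 6 * m ∨ l = 6 * m + 2 ∨ l = 6 * m + 4) :=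
      ⟨l / 6, by omega, by omega⟩
    · have hs : samp l (2 * m) < Real.pi / 3 := samp_lt_pi_div_three (by omega)
      exact gR_ne_zero_of_mod_zero hm hk (hs.trans h0).le h1
    · have hs : samp l (2 * m) < Real.pi / 3 := samp_lt_pi_div_three (by omega)
      obtain ⟨β, hβ, hβ', h⟩ := exists_zero_of_mod_two hm hk
      rw [Ne, h α (hs.trans h0).le h1]
      rintro (rfl | rfl) <;> linarith
    · have hs : samp l (2 * m + 1) < Real.pi / 3 := samp_lt_pi_div_three (by omega)
      obtain ⟨β, hβ, hβ', h⟩ := exists_zero_of_mod_four hm hk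
      rw [Ne, h α (hs.trans h0).le h1]
      rintro rfl
      linarith
  rcases hk4.eq_or_lt with rfl | hk
  · exact fun h => main 8 ⟨4, rfl⟩ (by norm_num)
      (gR_eight_eq_zero ⟨by linarith [Real.pi_pos], h1⟩ h)
  · exact main k hke (by rw [Nat.even_iff] at hke; omega)

end EisensteinDerivativeZeros

theorem stmt5 (k : ℕ) (hke : Even k) (hk4 : 4 ≤ k) :
    let S : Set ℝ := {t : ℝ | 0 < t ∧ deriv (Ek k) (1 / 2 + t * Complex.I) = 0}
    S.Finite ∧ S.ncard = 1 + 2 * ((k - 2) / 6) ∧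
    {t ∈ S | Real.sqrt 3 / 2 < t}.ncard = (k - 4) / 6 ∧
    {t ∈ S | Real.sqrt 3 / 6 < t ∧ t < Real.sqrt 3 / 2}.ncard = (k + 2) / 6 ∧
    {t ∈ S | t < Real.sqrt 3 / 6} = ∅ ∧
    (k % 6 = 2 → Real.sqrt 3 / 6 ∈ S ∧ Real.sqrt 3 / 2 ∈ S) ∧
    (k % 6 ≠ 2 → Real.sqrt 3 / 6 ∉ S ∧ Real.sqrt 3 / 2 ∉ S) := by
  have hlast : ∀ α, Real.pi / 3 < α → α < Real.pi / 2 → gR k α ≠ 0 :=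
    fun α h0 h1 => gR_ne_zero_of_pi_div_three_lt hke hk4 h0 h1
  have hp := pi_div_three_mem.2
  rcases hk4.eq_or_lt with rfl | hk
  · obtain ⟨hM, hMc⟩ := ncard_midZset_four
    refine zeros_deriv_Ek_of_zeros_gR hke hk4 ?_ ?_ hM hMc hlast ?_ ?_
    · rw [Zset_four_eq_empty]
      exact Set.finite_empty
    · rw [Zset_four_eq_empty, Set.ncard_empty]
    · simp [gR_four_pi_div_six_ne_zero]
    · simp [gR_four_pi_div_three_ne_zero]
  obtain ⟨m, hm, hk | hk | hk⟩ : ∃ m, 1 ≤ m ∧ (k = 6 * m ∨ k = 6 * m + 2 ∨ k = 6 * m + 4) := by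
    rw [Nat.even_iff] at hke
    exact ⟨k / 6, by omega, by omega⟩
  · obtain ⟨hM, hMc⟩ := ncard_midZset_of_mod_zero hm hk
    obtain ⟨hA, hAc, h6⟩ := Zset_pi_div_six_of_mod_zero hm hk
    have hs : samp k (2 * m) < Real.pi / 3 := samp_lt_pi_div_three (by omega)
    exact zeros_deriv_Ek_of_zeros_gR hke hk4 hA (by omega) hM (by omega) hlast
      (iff_of_false h6 (by omega))
      (iff_of_false (gR_ne_zero_of_mod_zero hm hk hs.le hp) (by omega))
  · obtain ⟨hM, hMc⟩ := ncard_midZset_of_mod_two hm hk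
    have h6 : gR k (Real.pi / 6) = 0 := gR_pi_div_six_eq_zero (by omega) (by omega)
    obtain ⟨hA, hAc⟩ := Zset_pi_div_six_of_mod_two hm hk h6
    have hs : samp k (2 * m) < Real.pi / 3 := samp_lt_pi_div_three (by omega)
    obtain ⟨β, -, -, h⟩ := exists_zero_of_mod_two hm hk
    exact zeros_deriv_Ek_of_zeros_gR hke hk4 hA (by omega) hM (by omega) hlast
      (iff_of_true h6 (by omega))
      (iff_of_true ((h _ hs.le hp).2 (Or.inr rfl)) (by omega))
  · obtain ⟨hM, hMc⟩ := ncard_midZset_of_mod_four hm hk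
    obtain ⟨hA, hAc, h6⟩ := Zset_pi_div_six_of_mod_four hm hk
    have hs : samp k (2 * m + 1) < Real.pi / 3 := samp_lt_pi_div_three (by omega)
    obtain ⟨β, -, hβ, h⟩ := exists_zero_of_mod_four hm hk
    exact zeros_deriv_Ek_of_zeros_gR hke hk4 hA (by omega) hM (by omega) hlast
      (iff_of_false h6 (by omega))
      (iff_of_false (fun h' => hβ.ne' ((h _ hs.le hp).1 h')) (by omega))
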